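/- Let F/K be a finite Galois extension of number fields with Galois group G, let d be the degree of K over ℚ, let S∞ be the set of archimedean places of F, and let μ_F be the group of roots of unity of F. Then both elements d·[ℤ[G]] − [ℤ] − [Ãr_F] and [ℤ[S∞]] − [ℤ] − σ[μ_F] − [Ar_F] lie in the torsion subgroup G₀(ℤ[G])_tors of G₀(ℤ[G]). -/

import Mathlib

/-- A bundled finitely generated module over a ring `R`. -/
structure FGMod (R : Type) [Ring R] : Type 1 where
  carrier : Type
  [isAddCommGroup : AddCommGroup carrier]
  [isModule : Module R carrier]
  [isFinite : Module.Finite R carrier]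

attribute [instance] FGMod.isAddCommGroup FGMod.isModule FGMod.isFinite

/-- The subgroup of relations defining the Grothendieck group `G₀(R)`:
one relation `[M] = [L] + [N]` for each short exact sequence `0 → L → M → N → 0`
of finitely generated `R`-modules. -/
def G0Rel (R : Type) [Ring R] : AddSubgroup (FreeAbelianGroup (FGMod R)) :=
  AddSubgroup.closure
    { x | ∃ (L M N : FGMod R) (f : L.carrier →ₗ[R] M.carrier)
            (g : M.carrier →ₗ[R] N.carrier),
        Function.Injective f ∧ Function.Surjective g ∧ Function.Exact f g ∧
        x = FreeAbelianGroup.of M - FreeAbelianGroup.of L - FreeAbelianGroup.of N }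

/-- The Grothendieck group `G₀(R)` of the category of finitely generated `R`-modules. -/
def G0 (R : Type) [Ring R] : Type 1 :=
  FreeAbelianGroup (FGMod R) ⧸ G0Rel R

instance (R : Type) [Ring R] : AddCommGroup (G0 R) :=
  QuotientAddGroup.Quotient.addCommGroup _

/-- The class `[M] ∈ G₀(R)` of a finitely generated `R`-module `M` (junk value `0` if `M` is
not finitely generated). -/
noncomputable def G0.cls (R : Type) [Ring R] (M : Type) [AddCommGroup M] [Module R M] :
    G0 R := by
  classical
  exact
    if h : Module.Finite R M then
      QuotientAddGroup.mk (FreeAbelianGroup.of (@FGMod.mk R _ M _ _ h))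
    else 0

open NumberField
open scoped nonZeroDivisors TensorProduct

noncomputable section

variable (F : Type) [Field F] [NumberField F]

/-- The étale ℝ-algebra F_ℝ = F ⊗_ℚ ℝ. -/
abbrev FReal := ℝ ⊗[ℚ] F

/-- The canonical (finite-dimensional real vector space) topology on F_ℝ. -/
instance : TopologicalSpace (FReal F) :=
  TopologicalSpace.induced (Module.finBasis ℝ (FReal F)).equivFun inferInstance

/-- The group of fractional ideals of F. -/
abbrev IdealGroup := (FractionalIdeal (𝓞 F)⁰ F)ˣ

/-- The group of fractional ideals carries the discrete topology. -/
instance : TopologicalSpace (IdealGroup F) := ⊥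

/-- The ideal norm, as a group homomorphism to ℝˣ. -/
def idealNormHom : IdealGroup F →* ℝˣ :=
  (Units.map (Rat.castHom ℝ).toMonoidHom).comp
    (Units.map (FractionalIdeal.absNorm (R := 𝓞 F) (K := F)).toMonoidHom)

/-- The absolute value of the algebra norm on F_ℝˣ, as a group homomorphism to ℝˣ. -/
def absNormFR : (FReal F)ˣ →* ℝˣ :=
  (Units.map (absHom (α := ℝ)).toMonoidHom).comp (Units.map (Algebra.norm ℝ (S := FReal F)))

/-- The fibre product Id_F ×_{ℝ>0} F_ℝˣ, i.e. the subgroup of pairs (I, b) with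
N(I) = |Nm(b)|, formalized as the kernel of the quotient of the two norm maps. -/
def picDom : Subgroup (IdealGroup F × (FReal F)ˣ) :=
  MonoidHom.ker (((idealNormHom F).comp (MonoidHom.fst _ _)) /
    ((absNormFR F).comp (MonoidHom.snd _ _)))

/-- The map F^× → Id_F ×_{ℝ>0} F_ℝˣ, α ↦ (αO_F, α ⊗ 1). -/
def principalHom : Fˣ →* IdealGroup F × (FReal F)ˣ :=
  (toPrincipalIdeal (𝓞 F) F).prod
    (Units.map (Algebra.TensorProduct.includeRight : F →ₐ[ℚ] FReal F).toMonoidHom)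

/-- The subgroup of the fibre product coming from principal oriented Arakelov divisors. -/
def principalSub : Subgroup (picDom F) :=
  Subgroup.comap (picDom F).subtype (MonoidHom.range (principalHom F))

/-- The oriented Arakelov class group of F: the cokernel of F^× → Id_F ×_{ℝ>0} F_ℝˣ. -/
def PicTilde := picDom F ⧸ principalSub F

instance : CommGroup (PicTilde F) := QuotientGroup.Quotient.commGroup _
instance : TopologicalSpace (PicTilde F) := instTopologicalSpaceQuotient

/-- The class of an oriented Arakelov divisor in the oriented Arakelov class group. -/
def PicTilde.mk : picDom F → PicTilde F := QuotientGroup.mk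

/-- The maximal compact subgroup comp(F_ℝˣ) of F_ℝˣ: the subgroup generated by all
compact subgroups. -/
def maxCompact : Subgroup (FReal F)ˣ :=
  sSup { H : Subgroup (FReal F)ˣ | IsCompact (H : Set (FReal F)ˣ) }

/-- The image of {1} × comp(F_ℝˣ) in the oriented Arakelov class group. -/
def compImage : Subgroup (PicTilde F) :=
  Subgroup.map (QuotientGroup.mk' (principalSub F))
    (Subgroup.comap (picDom F).subtype ((⊥ : Subgroup (IdealGroup F)).prod (maxCompact F)))

/-- The Arakelov class group of F: the quotient of the oriented Arakelov class group by
the image of {1} × comp(F_ℝˣ). -/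
def PicZero := PicTilde F ⧸ compImage F

instance : CommGroup (PicZero F) := QuotientGroup.Quotient.commGroup _
instance : TopologicalSpace (PicZero F) := instTopologicalSpaceQuotient

/-- The class of an oriented Arakelov divisor in the Arakelov class group. -/
def PicZero.mk : picDom F → PicZero F := fun x => QuotientGroup.mk (PicTilde.mk F x)

/-- ℝ/ℤ. -/
abbrev RmodZ := AddCircle (1 : ℝ)

/-- The Pontryagin dual Ãr_F of the oriented Arakelov class group: the group of
continuous homomorphisms to ℝ/ℤ. -/
def ArTilde := ContinuousAddMonoidHom (Additive (PicTilde F)) RmodZ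

instance : AddCommGroup (ArTilde F) := by unfold ArTilde; infer_instance
instance : FunLike (ArTilde F) (Additive (PicTilde F)) RmodZ := by unfold ArTilde; infer_instance

/-- The Pontryagin dual Ar_F of the Arakelov class group. -/
def ArF := ContinuousAddMonoidHom (Additive (PicZero F)) RmodZ

instance : AddCommGroup (ArF F) := by unfold ArF; infer_instance
instance : FunLike (ArF F) (Additive (PicZero F)) RmodZ := by unfold ArF; infer_instance

/-- ℚ/ℤ as a ℤ-module. -/
abbrev QmodZ := ℚ ⧸ (Submodule.span ℤ {(1 : ℚ)})

variable {F} in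
/-- The automorphism of F_ℝ = ℝ ⊗_ℚ F induced by an automorphism of F over a subfield K. -/
def galFReal (K : Type) [Field K] [CharZero K] [Algebra K F] (g : F ≃ₐ[K] F) : FReal F ≃ₐ[ℚ] FReal F :=
  Algebra.TensorProduct.congr AlgEquiv.refl (g.restrictScalars ℚ)

end

namespace ArakelovG0

section Classes

variable {G : Type} [Group G]

/-- The `ℤ[G]`-module structure attached to an integral representation. -/
noncomputable abbrev moduleOf {M : Type} [AddCommGroup M] (ρ : Representation ℤ G M) :
    Module (MonoidAlgebra ℤ G) M :=
  Module.compHom M ρ.asAlgebraHom.toRingHom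

/-- The class in `G₀(ℤ[G])` of an integral representation. -/
noncomputable def cl {M : Type} [AddCommGroup M] (ρ : Representation ℤ G M) :
    G0 (MonoidAlgebra ℤ G) :=
  @G0.cls (MonoidAlgebra ℤ G) _ M _ (moduleOf ρ)

theorem moduleOf_single_smul {M : Type} [AddCommGroup M] (ρ : Representation ℤ G M)
    (g : G) (n : ℤ) (x : M) :
    (moduleOf ρ).toSMul.smul (MonoidAlgebra.single g n) x = n • ρ g x := by
  change ρ.asAlgebraHom (MonoidAlgebra.single g n) x = _
  simp [Representation.asAlgebraHom_single]

theorem cls_eq_cl {M : Type} [AddCommGroup M] [m : Module (MonoidAlgebra ℤ G) M]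
    (ρ : Representation ℤ G M)
    (h : ∀ g x, (MonoidAlgebra.single g (1 : ℤ) : MonoidAlgebra ℤ G) • x = ρ g x) :
    G0.cls (MonoidAlgebra ℤ G) M = cl ρ := by
  have : m = moduleOf ρ := by
    refine Module.ext' _ _ fun r x => ?_
    induction r using MonoidAlgebra.induction_linear with
    | zero =>
      rw [zero_smul]
      exact (@zero_smul _ _ _ _ (moduleOf ρ).toMulActionWithZero.toSMulWithZero x).symm
    | add a b ha hb =>
      rw [add_smul, ha, hb]
      exact (@add_smul _ _ _ _ (moduleOf ρ) a b x).symm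
    | single g n =>
      have e : (MonoidAlgebra.single g n : MonoidAlgebra ℤ G) = n • MonoidAlgebra.single g (1 : ℤ) := by
        simp
      refine Eq.trans ?_ (moduleOf_single_smul ρ g n x).symm
      rw [e, smul_assoc, h]
  subst this
  rfl

theorem moduleFinite_of {M : Type} [AddCommGroup M] (ρ : Representation ℤ G M)
    [Module.Finite ℤ M] : @Module.Finite (MonoidAlgebra ℤ G) M _ _ (moduleOf ρ) := by
  let := moduleOf ρ
  obtain ⟨s, hs⟩ := (Module.Finite.fg_top : (⊤ : Submodule ℤ M).FG)
  refine ⟨⟨s, ?_⟩⟩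
  rw [eq_top_iff]
  rintro x -
  have hx : x ∈ Submodule.span ℤ (s : Set M) := hs ▸ Submodule.mem_top
  induction hx using Submodule.span_induction with
  | mem x h => exact Submodule.subset_span h
  | zero => exact zero_mem _
  | add x y _ _ hx hy => exact add_mem hx hy
  | smul n x _ hx => exact zsmul_mem hx n

/-- An equivariant additive map, as a `ℤ[G]`-linear map. -/
noncomputable def toMALinear {L M : Type} [AddCommGroup L] [AddCommGroup M]
    (ρ : Representation ℤ G L) (σ : Representation ℤ G M) (f : L →ₗ[ℤ] M)
    (hf : ∀ g x, f (ρ g x) = σ g (f x)) :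
    @LinearMap (MonoidAlgebra ℤ G) (MonoidAlgebra ℤ G) _ _ (RingHom.id _) L M _ _
      (moduleOf ρ) (moduleOf σ) :=
  letI := moduleOf ρ
  letI := moduleOf σ
  { toFun := f
    map_add' := map_add f
    map_smul' := fun r x => by
      induction r using MonoidAlgebra.induction_linear with
      | zero => simp
      | add a b ha hb => simp only [add_smul, map_add, ha, hb, RingHom.id_apply]
      | single g n =>
        refine (congrArg f (moduleOf_single_smul ρ g n x)).trans ?_
        rw [map_zsmul, hf]
        exact (moduleOf_single_smul σ g n (f x)).symm }

/-- Short exact sequences of finitely generated integral representations give relations. -/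
theorem cl_exact {L M N : Type} [AddCommGroup L] [AddCommGroup M] [AddCommGroup N]
    [Module.Finite ℤ M]
    (ρL : Representation ℤ G L) (ρM : Representation ℤ G M) (ρN : Representation ℤ G N)
    (f : L →ₗ[ℤ] M) (g : M →ₗ[ℤ] N)
    (hf : ∀ s x, f (ρL s x) = ρM s (f x)) (hg : ∀ s x, g (ρM s x) = ρN s (g x))
    (inj : Function.Injective f) (surj : Function.Surjective g) (ex : Function.Exact f g) :
    cl ρM = cl ρL + cl ρN := by
  have : Module.Finite ℤ L := Module.Finite.of_injective f inj
  have : Module.Finite ℤ N := Module.Finite.of_surjective g surj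
  have hL := moduleFinite_of ρL
  have hM := moduleFinite_of ρM
  have hN := moduleFinite_of ρN
  refine (dif_pos hM).trans (Eq.trans ?_ (congrArg₂ (· + ·) (dif_pos hL) (dif_pos hN)).symm)
  refine Eq.trans ?_ (QuotientAddGroup.mk_add (G0Rel (MonoidAlgebra ℤ G)) _ _)
  refine (QuotientAddGroup.eq_iff_sub_mem).2 ?_
  refine AddSubgroup.subset_closure ?_
  refine ⟨@FGMod.mk _ _ L _ (moduleOf ρL) hL, @FGMod.mk _ _ M _ (moduleOf ρM) hM,
    @FGMod.mk _ _ N _ (moduleOf ρN) hN, toMALinear ρL ρM f hf, toMALinear ρM ρN g hg,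
    inj, surj, ex, ?_⟩
  abel

theorem cl_zero {M : Type} [AddCommGroup M] [Subsingleton M] (ρ : Representation ℤ G M) :
    cl ρ = 0 := by
  have := cl_exact ρ ρ ρ LinearMap.id LinearMap.id (fun _ _ => rfl) (fun _ _ => rfl)
    Function.injective_id Function.surjective_id
    (fun x => ⟨fun _ => ⟨x, rfl⟩, fun _ => Subsingleton.elim _ _⟩)
  simpa using this

theorem cl_congr {M N : Type} [AddCommGroup M] [AddCommGroup N] [Module.Finite ℤ M]
    (ρ : Representation ℤ G M) (σ : Representation ℤ G N) (e : M ≃ₗ[ℤ] N)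
    (he : ∀ g x, e (ρ g x) = σ g (e x)) : cl ρ = cl σ := by
  have := cl_exact (1 : Representation ℤ G PUnit) ρ σ 0 e.toLinearMap (by simp)
    he (fun _ _ _ => Subsingleton.elim _ _) e.surjective
    (fun x => by simp [eq_comm (a := (0 : M))])
  rw [this, cl_zero, zero_add]

/-- Additivity along an invariant submodule. -/
theorem cl_sub_quot {M : Type} [AddCommGroup M] [Module.Finite ℤ M] (ρ : Representation ℤ G M)
    (W : Submodule ℤ M) (hW : ∀ g, W ≤ W.comap (ρ g)) :
    cl ρ = cl (ρ.subrepresentation W hW) + cl (ρ.quotient W hW) :=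
  cl_exact _ _ _ W.subtype W.mkQ (fun _ _ => rfl) (fun _ _ => rfl) W.injective_subtype
    W.mkQ_surjective (LinearMap.exact_subtype_mkQ W)

/-- Additivity along the kernel and the range of an equivariant map. -/
theorem cl_ker_range {M N : Type} [AddCommGroup M] [AddCommGroup N] [Module.Finite ℤ M]
    (ρ : Representation ℤ G M) (σ : Representation ℤ G N) (f : M →ₗ[ℤ] N)
    (hf : ∀ g x, f (ρ g x) = σ g (f x)) (hk : ∀ g, f.ker ≤ f.ker.comap (ρ g))
    (hr : ∀ g, f.range ≤ f.range.comap (σ g)) :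
    cl ρ = cl (ρ.subrepresentation f.ker hk) + cl (σ.subrepresentation f.range hr) :=
  cl_exact _ _ _ f.ker.subtype f.rangeRestrict (fun _ _ => rfl)
    (fun g x => Subtype.ext (hf g x)) f.ker.injective_subtype
    f.surjective_rangeRestrict (by
      intro x
      simp [Subtype.ext_iff])

theorem ker_le_comap {M N : Type} [AddCommGroup M] [AddCommGroup N]
    (ρ : Representation ℤ G M) (σ : Representation ℤ G N) (f : M →ₗ[ℤ] N)
    (hf : ∀ g x, f (ρ g x) = σ g (f x)) (g : G) : f.ker ≤ f.ker.comap (ρ g) := by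
  intro x hx
  simp only [LinearMap.mem_ker, Submodule.mem_comap] at hx ⊢
  rw [hf, hx, map_zero]

theorem range_le_comap {M N : Type} [AddCommGroup M] [AddCommGroup N]
    (ρ : Representation ℤ G M) (σ : Representation ℤ G N) (f : M →ₗ[ℤ] N)
    (hf : ∀ g x, f (ρ g x) = σ g (f x)) (g : G) : f.range ≤ f.range.comap (σ g) := by
  rintro _ ⟨x, rfl⟩
  exact ⟨ρ g x, hf g x⟩

theorem cl_prod {M N : Type} [AddCommGroup M] [AddCommGroup N] [Module.Finite ℤ M]
    [Module.Finite ℤ N] (ρ : Representation ℤ G M) (σ : Representation ℤ G N) :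
    cl (ρ.prod σ) = cl ρ + cl σ :=
  cl_exact _ _ _ (LinearMap.inl ℤ M N) (LinearMap.snd ℤ M N) (fun _ _ => by simp)
    (fun _ _ => rfl) LinearMap.inl_injective LinearMap.snd_surjective
    (fun x => by simp [Prod.ext_iff, eq_comm])

end Classes

section Characters

theorem trace_exact {k U V W : Type*} [Field k] [AddCommGroup U] [AddCommGroup V] [AddCommGroup W]
    [Module k U] [Module k V] [Module k W] [FiniteDimensional k V]
    (f : U →ₗ[k] V) (q : V →ₗ[k] W) (inj : Function.Injective f) (surj : Function.Surjective q)
    (ex : Function.Exact f q) (a : U →ₗ[k] U) (b : V →ₗ[k] V) (c : W →ₗ[k] W)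
    (hf : ∀ x, f (a x) = b (f x)) (hq : ∀ x, q (b x) = c (q x)) :
    LinearMap.trace k V b = LinearMap.trace k U a + LinearMap.trace k W c := by
  have : FiniteDimensional k U := Module.Finite.of_injective f inj
  have : FiniteDimensional k W := Module.Finite.of_surjective q surj
  obtain ⟨s, hs⟩ := q.exists_rightInverse_of_surjective (LinearMap.range_eq_top.2 surj)
  have hs' (x : W) : q (s x) = x := LinearMap.congr_fun hs x
  have key (x : V) : x - s (q x) ∈ f.range := by
    have := (ex (x - s (q x))).1 (by simp [hs'])
    exact this
  obtain ⟨r, hr⟩ := f.exists_leftInverse_of_injective (LinearMap.ker_eq_bot.2 inj)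
  have hr' (x : U) : r (f x) = x := LinearMap.congr_fun hr x
  set r' : V →ₗ[k] U := r ∘ₗ (LinearMap.id - s ∘ₗ q) with hr'def
  have qf (x : U) : q (f x) = 0 := (ex (f x)).2 ⟨x, rfl⟩
  have e1 : f ∘ₗ r' + s ∘ₗ q = LinearMap.id := by
    ext x
    obtain ⟨u, hu⟩ := key x
    simp only [hr'def, LinearMap.add_apply, LinearMap.comp_apply, LinearMap.sub_apply,
      LinearMap.id_apply, ← hu, hr']
    rw [hu]; abel
  have e2 : r' ∘ₗ b ∘ₗ f = a := by
    ext x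
    simp [hr'def, ← hf, hr', qf]
  have e3 : q ∘ₗ b ∘ₗ s = c := by
    ext x
    simp [hq, hs']
  calc LinearMap.trace k V b = LinearMap.trace k V (b ∘ₗ (f ∘ₗ r' + s ∘ₗ q)) := by
        rw [e1, LinearMap.comp_id]
    _ = LinearMap.trace k V ((b ∘ₗ f) ∘ₗ r') + LinearMap.trace k V ((b ∘ₗ s) ∘ₗ q) := by
        rw [LinearMap.comp_add, map_add]; rfl
    _ = _ := by
        rw [LinearMap.trace_comp_comm' r', LinearMap.trace_comp_comm' q, e2, e3]

open TensorProduct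

variable {G : Type} [Group G]

/-- The rational representation spanned by an integral representation. -/
noncomputable def rat {M : Type} [AddCommGroup M] (ρ : Representation ℤ G M) :
    Representation ℚ G (ℚ ⊗[ℤ] M) where
  toFun g := (ρ g).baseChange ℚ
  map_one' := by simp [Module.End.one_eq_id]
  map_mul' g h := by simp [Module.End.mul_eq_comp, LinearMap.baseChange_comp]

@[simp]
theorem rat_tmul {M : Type} [AddCommGroup M] (ρ : Representation ℤ G M) (g : G) (r : ℚ) (x : M) :
    rat ρ g (r ⊗ₜ x) = r ⊗ₜ ρ g x := rfl

/-- The rational character of an integral representation. -/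
noncomputable def ch {M : Type} [AddCommGroup M] (ρ : Representation ℤ G M) : G → ℚ :=
  (rat ρ).character

theorem ch_exact {L M N : Type} [AddCommGroup L] [AddCommGroup M] [AddCommGroup N]
    [Module.Finite ℤ M]
    (ρL : Representation ℤ G L) (ρM : Representation ℤ G M) (ρN : Representation ℤ G N)
    (f : L →ₗ[ℤ] M) (g : M →ₗ[ℤ] N)
    (hf : ∀ s x, f (ρL s x) = ρM s (f x)) (hg : ∀ s x, g (ρM s x) = ρN s (g x))
    (inj : Function.Injective f) (surj : Function.Surjective g) (ex : Function.Exact f g) :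
    ch ρM = ch ρL + ch ρN := by
  ext s
  refine trace_exact (f.baseChange ℚ) (g.baseChange ℚ)
    (Module.Flat.lTensor_preserves_injective_linearMap f inj)
    (LinearMap.lTensor_surjective ℚ surj) (lTensor_exact ℚ ex surj) _ _ _ ?_ ?_
  · intro x
    induction x with
    | zero => simp
    | add x y hx hy => simp only [map_add, hx, hy]
    | tmul r x => simp [hf]
  · intro x
    induction x with
    | zero => simp
    | add x y hx hy => simp only [map_add, hx, hy]
    | tmul r x => simp [hg]

theorem subsingleton_rat {M : Type} [AddCommGroup M] (h : ∀ x : M, ∃ n : ℕ, 0 < n ∧ n • x = 0) :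
    Subsingleton (ℚ ⊗[ℤ] M) := by
  refine ⟨fun a b => ?_⟩
  have (a : ℚ ⊗[ℤ] M) : a = 0 := by
    induction a with
    | zero => rfl
    | add x y hx hy => rw [hx, hy, add_zero]
    | tmul r x =>
      obtain ⟨n, hn, hx⟩ := h x
      have e : r = (n : ℤ) • (r / n) := by
        simp only [zsmul_eq_mul, Int.cast_natCast]; field_simp
      rw [e, TensorProduct.smul_tmul, natCast_zsmul, hx, TensorProduct.tmul_zero]
  rw [this a, this b]

theorem ch_eq_zero {M : Type} [AddCommGroup M] (ρ : Representation ℤ G M)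
    (h : ∀ x : M, ∃ n : ℕ, 0 < n ∧ n • x = 0) : ch ρ = 0 := by
  ext g
  have := subsingleton_rat h
  simp [ch, Representation.character, Subsingleton.elim (rat ρ g) 0]

theorem ch_sub_quot {M : Type} [AddCommGroup M] [Module.Finite ℤ M] (ρ : Representation ℤ G M)
    (W : Submodule ℤ M) (hW : ∀ g, W ≤ W.comap (ρ g)) :
    ch ρ = ch (ρ.subrepresentation W hW) + ch (ρ.quotient W hW) :=
  ch_exact _ _ _ W.subtype W.mkQ (fun _ _ => rfl) (fun _ _ => rfl) W.injective_subtype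
    W.mkQ_surjective (LinearMap.exact_subtype_mkQ W)

theorem ch_congr {M N : Type} [AddCommGroup M] [AddCommGroup N] [Module.Finite ℤ M]
    (ρ : Representation ℤ G M) (σ : Representation ℤ G N) (e : M ≃ₗ[ℤ] N)
    (he : ∀ g x, e (ρ g x) = σ g (e x)) : ch ρ = ch σ := by
  have := ch_exact (1 : Representation ℤ G PUnit) ρ σ 0 e.toLinearMap (by simp)
    he (fun _ _ _ => Subsingleton.elim _ _) e.surjective
    (fun x => by simp [eq_comm (a := (0 : M))])
  rw [this, ch_eq_zero _ (fun x => ⟨1, one_pos, Subsingleton.elim _ _⟩), zero_add]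

theorem ch_prod {M N : Type} [AddCommGroup M] [AddCommGroup N] [Module.Finite ℤ M]
    [Module.Finite ℤ N] (ρ : Representation ℤ G M) (σ : Representation ℤ G N) :
    ch (ρ.prod σ) = ch ρ + ch σ :=
  ch_exact _ _ _ (LinearMap.inl ℤ M N) (LinearMap.snd ℤ M N) (fun _ _ => by simp)
    (fun _ _ => rfl) LinearMap.inl_injective LinearMap.snd_surjective
    (fun x => by simp [Prod.ext_iff, eq_comm])

theorem ch_one {M : Type} [AddCommGroup M] [Module.Finite ℤ M] [Module.Free ℤ M]
    (ρ : Representation ℤ G M) : ch ρ 1 = Module.finrank ℤ M := by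
  rw [ch, Representation.char_one, Module.finrank_baseChange]

/-- The class and the character of the multiples of an integral representation. -/
theorem exists_nsmul {M : Type} [AddCommGroup M] [Module.Finite ℤ M]
    (ρ : Representation ℤ G M) (n : ℕ) :
    ∃ (N : Type) (_ : AddCommGroup N) (_ : Module.Finite ℤ N) (σ : Representation ℤ G N),
      cl σ = n • cl ρ ∧ ch σ = n • ch ρ := by
  induction n with
  | zero => exact ⟨PUnit, inferInstance, inferInstance, 1, by rw [cl_zero, zero_smul],
      by rw [ch_eq_zero _ (fun x => ⟨1, one_pos, Subsingleton.elim _ _⟩), zero_smul]⟩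
  | succ n ih =>
    obtain ⟨N, _, _, σ, h, h'⟩ := ih
    exact ⟨N × M, inferInstance, inferInstance, σ.prod ρ, by rw [cl_prod, h, succ_nsmul],
      by rw [ch_prod, h', succ_nsmul]⟩

end Characters

section Lattices

open TensorProduct

variable {G : Type} [Group G] {A : Type*} [AddCommGroup A]

/-- An invariant of integral representations on lattices which is additive on short exact
sequences and does not change along inclusions whose cokernel is killed by a prime. -/
structure IsLatticeInvariant
    (Ψ : ∀ (M : Type) [AddCommGroup M], Representation ℤ G M → A) : Prop where
  exact : ∀ {L M N : Type} [AddCommGroup L] [AddCommGroup M] [AddCommGroup N]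
    [Module.Finite ℤ L] [Module.Finite ℤ M] [Module.Finite ℤ N]
    [Module.Free ℤ L] [Module.Free ℤ M] [Module.Free ℤ N]
    (ρL : Representation ℤ G L) (ρM : Representation ℤ G M) (ρN : Representation ℤ G N)
    (f : L →ₗ[ℤ] M) (g : M →ₗ[ℤ] N),
    (∀ s x, f (ρL s x) = ρM s (f x)) → (∀ s x, g (ρM s x) = ρN s (g x)) →
    Function.Injective f → Function.Surjective g → Function.Exact f g →
    Ψ M ρM = Ψ L ρL + Ψ N ρN
  index : ∀ {L M : Type} [AddCommGroup L] [AddCommGroup M]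
    [Module.Finite ℤ L] [Module.Finite ℤ M] [Module.Free ℤ L] [Module.Free ℤ M]
    (ρL : Representation ℤ G L) (ρM : Representation ℤ G M) (f : L →ₗ[ℤ] M),
    (∀ s x, f (ρL s x) = ρM s (f x)) → Function.Injective f →
    ∀ p : ℕ, p.Prime → (∀ x : M, p • x ∈ f.range) → Ψ L ρL = Ψ M ρM

theorem finite_of_nsmul_eq_zero {M : Type} [AddCommGroup M] [Module.Finite ℤ M] (n : ℕ)
    (hn : 0 < n) (h : ∀ x : M, n • x = 0) : Finite M := by
  refine Module.finite_of_fg_torsion M fun x => ⟨⟨n, ?_⟩, ?_⟩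
  · simp [hn.ne']
  · exact (natCast_zsmul x n).trans (h x)

theorem IsLatticeInvariant.index' {Ψ : ∀ (M : Type) [AddCommGroup M], Representation ℤ G M → A}
    (hΨ : IsLatticeInvariant Ψ) (n : ℕ) : ∀ {L M : Type} [AddCommGroup L] [AddCommGroup M]
    [Module.Finite ℤ L] [Module.Finite ℤ M] [Module.Free ℤ L] [Module.Free ℤ M]
    (ρL : Representation ℤ G L) (ρM : Representation ℤ G M) (f : L →ₗ[ℤ] M),
    (∀ s x, f (ρL s x) = ρM s (f x)) → Function.Injective f →
    0 < n → (∀ x : M, n • x ∈ f.range) → Ψ L ρL = Ψ M ρM := by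
  induction n using induction_on_primes with
  | zero => intros; omega
  | one =>
    intro L M _ _ _ _ _ _ ρL ρM f hf inj _ h
    refine hΨ.index ρL ρM f hf inj 2 Nat.prime_two fun x => ?_
    have := h x
    rw [one_smul] at this
    exact nsmul_mem this 2
  | prime_mul p n hp ih =>
    intro L M _ _ _ _ _ _ ρL ρM f hf inj hn h
    let W : Submodule ℤ M := f.range.comap ((p : ℤ) • LinearMap.id)
    have hW (x : M) : x ∈ W ↔ p • x ∈ f.range := by
      simp [W]
    have hWinv (g : G) : W ≤ W.comap (ρM g) := by
      intro x hx
      rw [hW] at hx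
      rw [Submodule.mem_comap, hW]
      obtain ⟨y, hy⟩ := hx
      exact ⟨ρL g y, by rw [hf, hy, map_nsmul]⟩
    have hLW (x : L) : f x ∈ W := (hW _).2 (nsmul_mem (f.mem_range_self x) p)
    refine (hΨ.index ρL (ρM.subrepresentation W hWinv) (f.codRestrict W hLW)
      (fun s x => Subtype.ext (hf s x)) (fun x y h => inj (congrArg Subtype.val h)) p hp ?_).trans
      (ih (ρM.subrepresentation W hWinv) ρM W.subtype (fun _ _ => rfl) W.injective_subtype
        (Nat.pos_of_mul_pos_left hn) ?_)
    · rintro ⟨x, hx⟩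
      obtain ⟨y, hy⟩ := (hW x).1 hx
      exact ⟨y, Subtype.ext hy⟩
    · intro x
      rw [Submodule.range_subtype, hW, smul_smul]
      exact h x

theorem IsLatticeInvariant.congr {Ψ : ∀ (M : Type) [AddCommGroup M], Representation ℤ G M → A}
    (hΨ : IsLatticeInvariant Ψ) {L M : Type} [AddCommGroup L] [AddCommGroup M]
    [Module.Finite ℤ L] [Module.Finite ℤ M] [Module.Free ℤ L] [Module.Free ℤ M]
    (ρL : Representation ℤ G L) (ρM : Representation ℤ G M) (f : L ≃ₗ[ℤ] M)
    (hf : ∀ s x, f (ρL s x) = ρM s (f x)) : Ψ L ρL = Ψ M ρM :=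
  hΨ.index' 1 ρL ρM f.toLinearMap hf f.injective one_pos (fun x => by simp)

theorem isLatticeInvariant_ch : IsLatticeInvariant (fun M _ (ρ : Representation ℤ G M) => ch ρ) where
  exact ρL ρM ρN f g hf hg inj surj ex := ch_exact ρL ρM ρN f g hf hg inj surj ex
  index {L M} _ _ _ _ _ _ ρL ρM f hf inj p hp h := by
    have hr := range_le_comap ρL ρM f hf
    have e := ch_exact ρL ρM (ρM.quotient f.range hr) f f.range.mkQ hf (fun _ _ => rfl) inj
      f.range.mkQ_surjective (LinearMap.exact_map_mkQ_range f)
    rw [ch_eq_zero (ρM.quotient f.range hr), add_zero] at e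
    · exact e.symm
    · intro x
      obtain ⟨x, rfl⟩ := f.range.mkQ_surjective x
      exact ⟨p, hp.pos, by rw [← map_nsmul]; exact (Submodule.Quotient.mk_eq_zero _).2 (h x)⟩

theorem IsLatticeInvariant.prodMk {B : Type*} [AddCommGroup B]
    {Ψ : ∀ (M : Type) [AddCommGroup M], Representation ℤ G M → A}
    {Φ : ∀ (M : Type) [AddCommGroup M], Representation ℤ G M → B}
    (hΨ : IsLatticeInvariant Ψ) (hΦ : IsLatticeInvariant Φ) :
    IsLatticeInvariant (fun M _ (ρ : Representation ℤ G M) => (Ψ M ρ, Φ M ρ)) where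
  exact ρL ρM ρN f g hf hg inj surj ex :=
    Prod.ext (hΨ.exact ρL ρM ρN f g hf hg inj surj ex) (hΦ.exact ρL ρM ρN f g hf hg inj surj ex)
  index ρL ρM f hf inj p hp h :=
    Prod.ext (hΨ.index ρL ρM f hf inj p hp h) (hΦ.index ρL ρM f hf inj p hp h)

/-- If the rational characters have a nonzero pairing, there is a nonzero equivariant map. -/
theorem exists_equivariant [Finite G] {M N : Type} [AddCommGroup M] [AddCommGroup N]
    [Module.Finite ℤ M] [Module.Finite ℤ N] [Module.Free ℤ M] [Module.Free ℤ N]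
    (ρ : Representation ℤ G M) (σ : Representation ℤ G N) (h : ch ρ = ch σ)
    (hM : 0 < Module.finrank ℤ M) :
    ∃ f : M →ₗ[ℤ] N, f ≠ 0 ∧ ∀ g x, f (ρ g x) = σ g (f x) := by
  have := Fintype.ofFinite G
  have : Invertible (Nat.card G : ℚ) := invertibleOfNonzero (by simp)
  have e1 := Representation.card_inv_mul_sum_char_mul_char_eq_finrank (rat ρ) (rat σ)
  have e2 := Representation.card_inv_mul_sum_char_mul_char_eq_finrank (rat ρ) (rat ρ)
  rw [show (rat σ).character = (rat ρ).character from h.symm, e2, Nat.cast_inj] at e1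
  have hnt : Nontrivial (ℚ ⊗[ℤ] M) := by
    refine Module.nontrivial_of_finrank_pos (R := ℚ) ?_
    rwa [Module.finrank_baseChange]
  have : Nontrivial ((rat ρ).IntertwiningMap (rat ρ)) := by
    obtain ⟨x, hx⟩ := exists_ne (0 : ℚ ⊗[ℤ] M)
    exact ⟨⟨Representation.IntertwiningMap.id _, 0, fun h => hx (congrArg (fun F => F x) h)⟩⟩
  have hpos : 0 < Module.finrank ℚ ((rat ρ).IntertwiningMap (rat σ)) := by
    rw [← e1]
    exact Module.finrank_pos
  have := Module.nontrivial_of_finrank_pos hpos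
  obtain ⟨F, hF⟩ := exists_ne (0 : (rat ρ).IntertwiningMap (rat σ))
  have := Module.finitePresentation_of_finite ℤ M
  obtain ⟨f, s, hfs⟩ := Module.FinitePresentation.exists_lift_of_isLocalizedModule
    (nonZeroDivisors ℤ) (TensorProduct.mk ℤ ℚ N 1)
    ((F.toLinearMap.restrictScalars ℤ) ∘ₗ TensorProduct.mk ℤ ℚ M 1)
  have hfs' (x : M) : (1 : ℚ) ⊗ₜ[ℤ] f x = (s : ℤ) • F (1 ⊗ₜ x) := LinearMap.congr_fun hfs x
  have hinj : Function.Injective (TensorProduct.mk ℤ ℚ N 1) :=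
    fun x y hxy => by
      obtain ⟨c, hc⟩ := (IsLocalizedModule.eq_iff_exists (nonZeroDivisors ℤ) _).1 hxy
      exact smul_right_injective N (nonZeroDivisors.coe_ne_zero c) hc
  refine ⟨f, ?_, ?_⟩
  · rintro rfl
    refine hF (DFunLike.ext _ _ fun x => ?_)
    induction x with
    | zero => simp
    | add x y hx hy => rw [map_add, map_add, hx, hy]
    | tmul r x =>
      have h1 := hfs' x
      rw [LinearMap.zero_apply, TensorProduct.tmul_zero, eq_comm,
        ← Int.cast_smul_eq_zsmul ℚ, smul_eq_zero] at h1
      have h2 : F (1 ⊗ₜ x) = 0 := h1.resolve_left (by simp)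
      have h3 : r ⊗ₜ[ℤ] x = r • ((1 : ℚ) ⊗ₜ[ℤ] x) := by simp [TensorProduct.smul_tmul']
      rw [h3, map_smul, h2, smul_zero]
      rfl
  · intro g x
    apply hinj
    change (1 : ℚ) ⊗ₜ[ℤ] f (ρ g x) = rat σ g ((1 : ℚ) ⊗ₜ[ℤ] f x)
    rw [hfs', hfs', map_zsmul]
    exact congrArg ((s : ℤ) • ·) (LinearMap.congr_fun (F.isIntertwining' g) (1 ⊗ₜ[ℤ] x))

theorem IsLatticeInvariant.eq_of_ch [Finite G]
    {Ψ : ∀ (M : Type) [AddCommGroup M], Representation ℤ G M → A}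
    (hΨ : IsLatticeInvariant Ψ) (n : ℕ) : ∀ {M N : Type} [AddCommGroup M] [AddCommGroup N]
    [Module.Finite ℤ M] [Module.Finite ℤ N] [Module.Free ℤ M] [Module.Free ℤ N]
    (ρ : Representation ℤ G M) (σ : Representation ℤ G N),
    Module.finrank ℤ M = n → ch ρ = ch σ → Ψ M ρ = Ψ N σ := by
  induction n using Nat.strong_induction_on with
  | _ n ih =>
  intro M N _ _ _ _ _ _ ρ σ hn h
  have hrank : Module.finrank ℤ M = Module.finrank ℤ N := by
    have := congrFun h 1
    rwa [ch_one, ch_one, Nat.cast_inj] at this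
  rcases Nat.eq_zero_or_pos n with rfl | hpos
  · have : Subsingleton M := (Module.finrank_eq_zero_iff_of_free _ _).1 hn
    have : Subsingleton N := (Module.finrank_eq_zero_iff_of_free _ _).1 (hrank ▸ hn)
    exact hΨ.congr ρ σ 0 (fun _ _ => Subsingleton.elim _ _)
  obtain ⟨f, hf0, hf⟩ := exists_equivariant ρ σ h (hn ▸ hpos)
  have hk := ker_le_comap ρ σ f hf
  have hr := range_le_comap ρ σ f hf
  let W : Submodule ℤ N := (Submodule.torsion ℤ (N ⧸ f.range)).comap f.range.mkQ
  have hWmem (y : N) : y ∈ W ↔ ∃ a : ℤ, a ≠ 0 ∧ a • y ∈ f.range := by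
    simp only [W, Submodule.mem_comap, Submodule.mem_torsion_iff]
    constructor
    · rintro ⟨a, ha⟩
      refine ⟨a, nonZeroDivisors.coe_ne_zero a, ?_⟩
      rw [← Submodule.Quotient.mk_eq_zero]
      exact ha
    · rintro ⟨a, ha, hy⟩
      refine ⟨⟨a, mem_nonZeroDivisors_of_ne_zero ha⟩, ?_⟩
      rw [← Submodule.Quotient.mk_eq_zero] at hy
      exact hy
  have hW (g : G) : W ≤ W.comap (σ g) := by
    intro y hy
    rw [Submodule.mem_comap, hWmem]
    obtain ⟨a, ha, hy⟩ := (hWmem y).1 hy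
    exact ⟨a, ha, by rw [← map_zsmul]; exact hr g hy⟩
  have : Module.IsTorsionFree ℤ (N ⧸ W) := by
    refine Module.IsTorsionFree.of_smul_eq_zero fun a x hx => ?_
    obtain ⟨x, rfl⟩ := W.mkQ_surjective x
    by_contra! hcon
    refine hcon.2 ((Submodule.Quotient.mk_eq_zero _).2 ?_)
    rw [← map_smul] at hx
    obtain ⟨b, hb, hb'⟩ := (hWmem _).1 ((Submodule.Quotient.mk_eq_zero _).1 hx)
    exact (hWmem x).2 ⟨b * a, mul_ne_zero hb hcon.1, by rwa [mul_smul]⟩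
  obtain ⟨m, hm, hmW⟩ : ∃ m : ℕ, 0 < m ∧ ∀ y ∈ W, m • y ∈ f.range := by
    have : Finite (Submodule.torsion ℤ (N ⧸ f.range)) :=
      Module.finite_of_fg_torsion _ (Submodule.torsion_isTorsion)
    refine ⟨Nat.card (Submodule.torsion ℤ (N ⧸ f.range)), Nat.card_pos, fun y hy => ?_⟩
    have := congrArg Subtype.val
      (card_nsmul_eq_zero' (x := (⟨f.range.mkQ y, hy⟩ : Submodule.torsion ℤ (N ⧸ f.range))))
    rw [← Submodule.Quotient.mk_eq_zero]
    exact this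
  have hfW (x : f.range) : (x : N) ∈ W := (hWmem _).2 ⟨1, one_ne_zero, by simp⟩
  have key : ∃ c : (G → ℚ) × A,
      (ch ρ, Ψ M ρ) = (ch (ρ.subrepresentation f.ker hk), Ψ _ (ρ.subrepresentation f.ker hk)) + c ∧
      (ch σ, Ψ N σ) = c + (ch (σ.quotient W hW), Ψ _ (σ.quotient W hW)) := by
    have hΦ := isLatticeInvariant_ch.prodMk hΨ
    set Φ := fun M [AddCommGroup M] (ρ : Representation ℤ G M) => (ch ρ, Ψ M ρ)
    refine ⟨Φ f.range (σ.subrepresentation f.range hr), ?_, ?_⟩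
    · exact hΦ.exact _ _ _ f.ker.subtype f.rangeRestrict (fun _ _ => rfl)
        (fun g x => Subtype.ext (hf g x)) f.ker.injective_subtype
        f.surjective_rangeRestrict (fun x => by simp [Subtype.ext_iff])
    · rw [hΦ.index' m (σ.subrepresentation f.range hr) (σ.subrepresentation W hW)
        (f.range.subtype.codRestrict W hfW) (fun _ _ => rfl)
        (fun x y h => Subtype.ext (congrArg (fun z : W => (z : N)) h)) hm
        (fun y => by
          obtain ⟨x, hx⟩ := hmW y y.2
          exact ⟨⟨_, ⟨x, rfl⟩⟩, Subtype.ext hx⟩)]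
      exact hΦ.exact _ _ _ W.subtype W.mkQ (fun _ _ => rfl) (fun _ _ => rfl) W.injective_subtype
        W.mkQ_surjective (LinearMap.exact_subtype_mkQ W)
  obtain ⟨⟨c, d⟩, h1, h2⟩ := key
  obtain ⟨hc1, hd1⟩ := Prod.ext_iff.1 h1
  obtain ⟨hc2, hd2⟩ := Prod.ext_iff.1 h2
  simp only [Prod.fst_add, Prod.snd_add] at hc1 hd1 hc2 hd2
  rw [hd1, hd2, add_comm d]
  congr 1
  refine ih _ ?_ _ _ rfl ?_
  · have h1 := Submodule.finrank_quotient_add_finrank f.ker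
    rw [f.quotKerEquivRange.finrank_eq] at h1
    have h2 : 0 < Module.finrank ℤ f.range := by
      rw [Module.finrank_pos_iff_of_free, Submodule.nontrivial_iff_ne_bot]
      rwa [Ne, LinearMap.range_eq_bot]
    omega
  · rw [hc1, hc2, add_comm] at h
    exact add_left_cancel h

end Lattices

section TorsionFreeClass

variable {G : Type} [Group G]

/-- The class of an integral representation in `G₀(ℤ[G])` modulo torsion. -/
noncomputable def tcl {M : Type} [AddCommGroup M] (ρ : Representation ℤ G M) :
    G0 (MonoidAlgebra ℤ G) ⧸ AddCommGroup.torsion (G0 (MonoidAlgebra ℤ G)) :=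
  QuotientAddGroup.mk (cl ρ)

theorem tcl_exact {L M N : Type} [AddCommGroup L] [AddCommGroup M] [AddCommGroup N]
    [Module.Finite ℤ M]
    (ρL : Representation ℤ G L) (ρM : Representation ℤ G M) (ρN : Representation ℤ G N)
    (f : L →ₗ[ℤ] M) (g : M →ₗ[ℤ] N)
    (hf : ∀ s x, f (ρL s x) = ρM s (f x)) (hg : ∀ s x, g (ρM s x) = ρN s (g x))
    (inj : Function.Injective f) (surj : Function.Surjective g) (ex : Function.Exact f g) :
    tcl ρM = tcl ρL + tcl ρN :=
  congrArg (QuotientAddGroup.mk' _) (cl_exact ρL ρM ρN f g hf hg inj surj ex)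

theorem tcl_zero {M : Type} [AddCommGroup M] [Subsingleton M] (ρ : Representation ℤ G M) :
    tcl ρ = 0 :=
  congrArg (QuotientAddGroup.mk' _) (cl_zero ρ)

theorem tcl_congr {M N : Type} [AddCommGroup M] [AddCommGroup N] [Module.Finite ℤ M]
    (ρ : Representation ℤ G M) (σ : Representation ℤ G N) (e : M ≃ₗ[ℤ] N)
    (he : ∀ g x, e (ρ g x) = σ g (e x)) : tcl ρ = tcl σ :=
  congrArg (QuotientAddGroup.mk' _) (cl_congr ρ σ e he)

theorem eq_zero_of_nsmul_eq_zero {A : Type*} [AddCommGroup A] {n : ℕ} (hn : n ≠ 0)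
    {x : A ⧸ AddCommGroup.torsion A} (h : n • x = 0) : x = 0 := by
  have := nsmul_right_injective (M := A ⧸ AddCommGroup.torsion A) hn
  exact this (by simpa using h)

end TorsionFreeClass

section Coinduction

variable {G : Type} [Group G]

/-- Functions on `G` which are equivariant for left translation by `c` and the operator `T`. -/
def coindSub {X : Type} [AddCommGroup X] (c : G) (T : X →ₗ[ℤ] X) : Submodule ℤ (G → X) where
  carrier := {f | ∀ g, f (c * g) = T (f g)}
  add_mem' ha hb g := by simp [ha g, hb g]
  zero_mem' g := by simp
  smul_mem' n f hf g := by simp [hf g]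

/-- The coinduced representation: `G` acts by right translation. -/
def coindRep {X : Type} [AddCommGroup X] (c : G) (T : X →ₗ[ℤ] X) :
    Representation ℤ G (coindSub c T) where
  toFun s :=
    { toFun := fun f => ⟨fun g => f.1 (g * s), fun g => by
        simp only [mul_assoc]; exact f.2 _⟩
      map_add' := fun _ _ => rfl
      map_smul' := fun _ _ => rfl }
  map_one' := by ext; simp
  map_mul' s t := by
    refine LinearMap.ext fun f => Subtype.ext (funext fun g => ?_)
    change f.1 _ = f.1 _
    rw [mul_assoc]

/-- Functoriality of coinduction. -/
def coindMap {X Y : Type} [AddCommGroup X] [AddCommGroup Y] (c : G) (T : X →ₗ[ℤ] X)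
    (U : Y →ₗ[ℤ] Y) (a : X →ₗ[ℤ] Y) (ha : ∀ x, a (T x) = U (a x)) :
    coindSub c T →ₗ[ℤ] coindSub c U where
  toFun f := ⟨fun g => a (f.1 g), fun g => by simp only [f.2 g, ha]⟩
  map_add' _ _ := Subtype.ext (funext fun _ => map_add a _ _)
  map_smul' _ _ := Subtype.ext (funext fun _ => map_smul a _ _)

/-- The class of a coinduced representation modulo torsion. -/
noncomputable def coindCls {X : Type} [AddCommGroup X] (c : G) (T : X →ₗ[ℤ] X) :
    G0 (MonoidAlgebra ℤ G) ⧸ AddCommGroup.torsion (G0 (MonoidAlgebra ℤ G)) :=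
  tcl (coindRep c T)

theorem coindCls_zero {X : Type} [AddCommGroup X] [Subsingleton X] (c : G) (T : X →ₗ[ℤ] X) :
    coindCls c T = 0 :=
  tcl_zero _

variable [Finite G]

theorem coindMap_surjective {X Y : Type} [AddCommGroup X] [AddCommGroup Y] (c : G)
    (T : X →ₗ[ℤ] X) (U : Y →ₗ[ℤ] Y) (hT : T ^ orderOf c = 1)
    (a : X →ₗ[ℤ] Y) (ha : ∀ x, a (T x) = U (a x)) (surj : Function.Surjective a) :
    Function.Surjective (coindMap c T U a ha) := by
  intro f
  let t : G → G := fun g => Quotient.out (Quotient.mk (QuotientGroup.rightRel (Subgroup.zpowers c)) g)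
  have ht (g : G) : ∃ i : ℕ, c ^ i * t g = g := by
    have h : QuotientGroup.rightRel (Subgroup.zpowers c) (t g) g := Quotient.exact (Quotient.out_eq _)
    rw [QuotientGroup.rightRel_apply] at h
    obtain ⟨i, hi⟩ := (isOfFinOrder_of_finite c).mem_powers_iff_mem_zpowers.2 h
    exact ⟨i, by simp only at hi; rw [hi]; group⟩
  have ht' (g : G) : t (c * g) = t g := by
    refine congrArg Quotient.out (Quotient.sound ?_)
    change QuotientGroup.rightRel (Subgroup.zpowers c) _ _
    rw [QuotientGroup.rightRel_apply]
    simp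
  choose i hi using ht
  choose l hl using surj
  have hpow (k : ℕ) (g : G) : f.1 (c ^ k * g) = (U ^ k) (f.1 g) := by
    induction k with
    | zero => simp
    | succ k ih => rw [pow_succ', mul_assoc, f.2, ih, pow_succ']; rfl
  have ha' (k : ℕ) (x : X) : a ((T ^ k) x) = (U ^ k) (a x) := by
    induction k with
    | zero => simp
    | succ k ih => rw [pow_succ', pow_succ', Module.End.mul_apply, ha, ih]; rfl
  refine ⟨⟨fun g => (T ^ i g) (l (f.1 (t g))), fun g => ?_⟩, Subtype.ext (funext fun g => ?_)⟩
  · simp only [ht']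
    rw [← Module.End.mul_apply, ← pow_succ']
    refine LinearMap.congr_fun (pow_eq_pow_of_modEq (pow_eq_pow_iff_modEq.1 ?_) hT) _
    have h1 := hi (c * g)
    rw [ht'] at h1
    refine mul_right_cancel (b := t g) ?_
    rw [h1, pow_succ', mul_assoc, hi]
  · change a ((T ^ i g) (l (f.1 (t g)))) = f.1 g
    rw [ha', hl, ← hpow, hi]

theorem coindCls_exact {X Y Z : Type} [AddCommGroup X] [AddCommGroup Y] [AddCommGroup Z]
    [Module.Finite ℤ Y] (c : G)
    (T : X →ₗ[ℤ] X) (U : Y →ₗ[ℤ] Y) (V : Z →ₗ[ℤ] Z) (hU : U ^ orderOf c = 1)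
    (a : X →ₗ[ℤ] Y) (b : Y →ₗ[ℤ] Z)
    (ha : ∀ x, a (T x) = U (a x)) (hb : ∀ x, b (U x) = V (b x))
    (inj : Function.Injective a) (surj : Function.Surjective b) (ex : Function.Exact a b) :
    coindCls c U = coindCls c T + coindCls c V := by
  refine tcl_exact _ _ _ (coindMap c T U a ha) (coindMap c U V b hb) (fun _ _ => rfl)
    (fun _ _ => rfl) ?_ (coindMap_surjective c U V hU b hb surj) ?_
  · intro f f' h
    refine Subtype.ext (funext fun g => inj ?_)
    exact congrFun (congrArg Subtype.val h) g
  · intro f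
    constructor
    · intro h
      have h' (g : G) : ∃ x, a x = f.1 g := (ex _).1 (congrFun (congrArg Subtype.val h) g)
      choose e he using h'
      refine ⟨⟨e, fun g => inj ?_⟩, Subtype.ext (funext he)⟩
      rw [he, ha, he, f.2]
    · rintro ⟨e, rfl⟩
      exact Subtype.ext (funext fun g => (ex _).2 ⟨_, rfl⟩)

theorem coindCls_congr {X Y : Type} [AddCommGroup X] [AddCommGroup Y] [Module.Finite ℤ Y] (c : G)
    (T : X →ₗ[ℤ] X) (U : Y →ₗ[ℤ] Y) (hU : U ^ orderOf c = 1)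
    (e : X ≃ₗ[ℤ] Y) (he : ∀ x, e (T x) = U (e x)) : coindCls c T = coindCls c U := by
  have := coindCls_exact c T U (0 : PUnit →ₗ[ℤ] PUnit) hU e.toLinearMap 0 he (by simp) e.injective
    (fun _ => ⟨0, rfl⟩) (fun x => by simp)
  rw [this, coindCls_zero (X := PUnit), add_zero]

theorem coindCls_pi {X : Type} [AddCommGroup X] [Module.Finite ℤ X] (c : G)
    (T : X →ₗ[ℤ] X) (hT : T ^ orderOf c = 1) (r : ℕ) :
    coindCls c (T.compLeft (Fin r)) = r • coindCls c T := by
  induction r with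
  | zero => rw [coindCls_zero, zero_smul]
  | succ r ih =>
    have hT' : (T.compLeft (Fin (r + 1))) ^ orderOf c = 1 := by
      have (k : ℕ) : (T.compLeft (Fin (r + 1))) ^ k = (T ^ k).compLeft (Fin (r + 1)) := by
        induction k with
        | zero => rfl
        | succ k ih => rw [pow_succ', ih, pow_succ']; rfl
      rw [this, hT]
      rfl
    rw [coindCls_exact c T (T.compLeft (Fin (r + 1))) (T.compLeft (Fin r)) hT'
      (LinearMap.single ℤ (fun _ => X) 0) (LinearMap.funLeft ℤ X Fin.succ) ?_ (fun _ => rfl)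
      (Pi.single_injective (M := fun _ => X) 0) ?_ ?_, ih, succ_nsmul']
    · intro x
      ext j
      by_cases hj : j = 0
      · subst hj; simp
      · simp [hj]
    · intro f
      exact ⟨Fin.cons 0 f, by ext j; simp [LinearMap.funLeft_apply]⟩
    · intro f
      constructor
      · intro h
        refine ⟨f 0, ?_⟩
        ext j
        refine Fin.cases (by simp) (fun j => ?_) j
        have := congrFun h j
        simp only [LinearMap.funLeft_apply, Pi.zero_apply] at this
        simp [this]
      · rintro ⟨x, rfl⟩
        ext j
        simp [LinearMap.funLeft_apply]

end Coinduction

section Dedekind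

variable {G : Type} [Group G] [Finite G] {O : Type} [CommRing O]

/-- Multiplication by a scalar, as a `ℤ`-linear map. -/
def scalarMap (X : Type) [AddCommGroup X] [Module O X] (z : O) : X →ₗ[ℤ] X :=
  (LinearMap.lsmul O X z).restrictScalars ℤ

theorem scalarMap_pow (X : Type) [AddCommGroup X] [Module O X] (z : O) (k : ℕ) (hz : z ^ k = 1) :
    scalarMap X z ^ k = 1 := by
  have (k : ℕ) (x : X) : (scalarMap X z ^ k) x = z ^ k • x := by
    induction k with
    | zero => simp
    | succ k ih => rw [pow_succ', Module.End.mul_apply, ih, pow_succ', mul_smul]; rfl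
  ext x
  rw [this, hz, one_smul]
  rfl

theorem scalarCls_exact {X Y Z : Type} [AddCommGroup X] [AddCommGroup Y] [AddCommGroup Z]
    [Module O X] [Module O Y] [Module O Z]
    [Module.Finite ℤ Y] (c : G) (z : O) (hz : z ^ orderOf c = 1)
    (a : X →ₗ[O] Y) (b : Y →ₗ[O] Z)
    (inj : Function.Injective a) (surj : Function.Surjective b) (ex : Function.Exact a b) :
    coindCls c (scalarMap Y z) = coindCls c (scalarMap X z) + coindCls c (scalarMap Z z) :=
  coindCls_exact c _ _ _ (scalarMap_pow Y z _ hz) (a.restrictScalars ℤ) (b.restrictScalars ℤ)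
    (fun x => map_smul a z x) (fun x => map_smul b z x) inj surj ex

theorem scalarCls_congr {X Y : Type} [AddCommGroup X] [AddCommGroup Y]
    [Module O X] [Module O Y]
    [Module.Finite ℤ Y] (c : G) (z : O) (hz : z ^ orderOf c = 1) (e : X ≃ₗ[O] Y) :
    coindCls c (scalarMap X z) = coindCls c (scalarMap Y z) :=
  coindCls_congr c _ _ (scalarMap_pow Y z _ hz) (e.restrictScalars ℤ) (fun x => map_smul e z x)

variable [IsDedekindDomain O]

theorem exists_surjective_quotient (P : Ideal O) [P.IsPrime] (hP : P ≠ ⊥) (i : ℕ) :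
    ∃ q : ↥(P ^ i) →ₗ[O] (O ⧸ P), Function.Surjective q ∧
      ∀ y, q y = 0 ↔ (y : O) ∈ P ^ (i + 1) := by
  let W : Submodule O ↥(P ^ i) := Submodule.comap (P ^ i).subtype (P ^ (i + 1))
  have hmem (y : ↥(P ^ i)) : y ∈ W ↔ (y : O) ∈ P ^ (i + 1) := Iff.rfl
  obtain ⟨a, ha, ha'⟩ := Ideal.exists_mem_pow_notMem_pow_succ P hP (Ideal.IsPrime.ne_top ‹_›) i
  let f : O →ₗ[O] (↥(P ^ i) ⧸ W) := W.mkQ ∘ₗ LinearMap.toSpanSingleton O _ (⟨a, ha⟩ : ↥(P ^ i))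
  have hker : f.ker = P := by
    ext x
    rw [LinearMap.mem_ker]
    change W.mkQ (x • (⟨a, ha⟩ : ↥(P ^ i))) = 0 ↔ _
    rw [Submodule.mkQ_apply, Submodule.Quotient.mk_eq_zero, hmem]
    change x * a ∈ _ ↔ _
    constructor
    · intro h
      rw [mul_comm] at h
      exact Ideal.mem_prime_of_mul_mem_pow hP ha' h
    · intro h
      rw [pow_succ']
      exact Ideal.mul_mem_mul h ha
  have hsurj : Function.Surjective f := by
    intro y
    obtain ⟨y, rfl⟩ := W.mkQ_surjective y
    obtain ⟨d, e, he, hde⟩ := Ideal.exists_mul_add_mem_pow_succ hP a (y : O) ha ha' y.2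
    refine ⟨d, ?_⟩
    change W.mkQ (d • (⟨a, ha⟩ : ↥(P ^ i))) = W.mkQ y
    rw [Submodule.mkQ_apply, Submodule.mkQ_apply, Submodule.Quotient.eq, hmem]
    change d * a - (y : O) ∈ _
    rw [← hde, show d * a - (a * d + e) = -e by ring]
    exact neg_mem he
  let e := (Submodule.quotEquivOfEq _ _ hker.symm).trans (f.quotKerEquivOfSurjective hsurj)
  refine ⟨e.symm.toLinearMap ∘ₗ W.mkQ, e.symm.surjective.comp W.mkQ_surjective, fun y => ?_⟩
  rw [← hmem, ← Submodule.Quotient.mk_eq_zero]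
  exact e.symm.map_eq_zero_iff

variable [Module.Finite ℤ O]

theorem scalarCls_quotient_prime [Finite (ClassGroup O)] (P : Ideal O) [P.IsPrime] (hP : P ≠ ⊥)
    (c : G) (z : O) (hz : z ^ orderOf c = 1) : coindCls c (scalarMap (O ⧸ P) z) = 0 := by
  have fin (I : Ideal O) : Module.Finite ℤ I :=
    inferInstanceAs (Module.Finite ℤ (I.restrictScalars ℤ))
  have step (i : ℕ) : coindCls c (scalarMap (↥(P ^ i)) z) =
      coindCls c (scalarMap (↥(P ^ (i + 1))) z) + coindCls c (scalarMap (O ⧸ P) z) := by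
    obtain ⟨q, hq, hq'⟩ := exists_surjective_quotient P hP i
    refine scalarCls_exact c z hz
      (Submodule.inclusion (Ideal.pow_le_pow_right (Nat.le_succ i))) q
      (Submodule.inclusion_injective _) hq (fun y => ?_)
    rw [hq']
    exact ⟨fun h => ⟨⟨y, h⟩, rfl⟩, fun ⟨x, hx⟩ => hx ▸ x.2⟩
  have tot (i : ℕ) : coindCls c (scalarMap (↥(P ^ 0)) z) =
      coindCls c (scalarMap (↥(P ^ i)) z) + i • coindCls c (scalarMap (O ⧸ P) z) := by
    induction i with
    | zero => simp
    | succ i ih => rw [ih, step i, succ_nsmul']; abel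
  have hP0 : P ∈ nonZeroDivisors (Ideal O) := mem_nonZeroDivisors_of_ne_zero hP
  have hprin : (P ^ Nat.card (ClassGroup O)).IsPrincipal := by
    rw [← ClassGroup.mk0_eq_one_iff (pow_mem hP0 _)]
    have := pow_card_eq_one' (x := ClassGroup.mk0 ⟨P, hP0⟩)
    rwa [← map_pow] at this
  obtain ⟨a, ha⟩ := hprin.principal
  have ha0 : a ≠ 0 := by
    rintro rfl
    refine pow_ne_zero (Nat.card (ClassGroup O)) hP ?_
    rw [ha]
    simp
  have e1 : coindCls c (scalarMap O z) = coindCls c (scalarMap (↥(P ^ Nat.card (ClassGroup O))) z) :=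
    scalarCls_congr c z hz ((LinearEquiv.toSpanNonzeroSingleton O O a ha0).trans
      (LinearEquiv.ofEq _ _ ha.symm))
  have e0 : coindCls c (scalarMap O z) = coindCls c (scalarMap (↥(P ^ 0)) z) :=
    scalarCls_congr c z hz (Submodule.topEquiv.symm.trans
      (LinearEquiv.ofEq _ _ (by simp)))
  have := tot (Nat.card (ClassGroup O))
  rw [← e0, ← e1, left_eq_add] at this
  exact eq_zero_of_nsmul_eq_zero Nat.card_pos.ne' this

/-- The coinduced modules of a finite module over `O[T]/(Tⁿ - 1)` have trivial class. -/
theorem coindCls_finite [Finite (ClassGroup O)] [CharZero O] (c : G) (ζ : O)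
    (hζ : IsPrimitiveRoot ζ (orderOf c)) (n : ℕ) : ∀ {X : Type} [AddCommGroup X] [Module O X]
    [Finite X] (T : X →ₗ[O] X), T ^ orderOf c = 1 → Nat.card X = n →
    coindCls c (T.restrictScalars ℤ) = 0 := by
  induction n using Nat.strong_induction_on with
  | _ n ih =>
  intro X _ _ _ T hT hn
  rcases subsingleton_or_nontrivial X with hX | hX
  · exact coindCls_zero _ _
  obtain ⟨z, hz, hzT⟩ : ∃ z : O, z ^ orderOf c = 1 ∧ ∃ x : X, x ≠ 0 ∧ T x = z • x := by
    by_contra! hcon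
    have hinj : Function.Injective (Polynomial.aeval T (Polynomial.X ^ orderOf c - 1 : Polynomial O)) := by
      rw [Polynomial.X_pow_sub_one_eq_prod (orderOf_pos c) hζ]
      refine Finset.prod_induction _ (fun p => Function.Injective (Polynomial.aeval T p)) ?_ ?_ ?_
      · intro p q hp hq
        rw [map_mul]
        exact hp.comp hq
      · rw [map_one]
        exact Function.injective_id
      · intro z hz
        rw [← LinearMap.ker_eq_bot, LinearMap.ker_eq_bot']
        intro x hx
        by_contra hx0
        refine hcon z ((Polynomial.mem_nthRootsFinset (orderOf_pos c) _).1 hz) x hx0 ?_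
        simpa [sub_eq_zero] using hx
    have h0 : Polynomial.aeval T (Polynomial.X ^ orderOf c - 1 : Polynomial O) = 0 := by
      simp [hT]
    obtain ⟨x, hx⟩ := exists_ne (0 : X)
    exact hx (hinj (by simp [h0]))
  obtain ⟨x, hx0, hx⟩ := hzT
  let W : Submodule O X := LinearMap.ker (T - LinearMap.lsmul O X z)
  have hW (y : X) : y ∈ W ↔ T y = z • y := by
    simp [W, sub_eq_zero]
  obtain ⟨P, hP, -⟩ := exists_le_isAssociatedPrime_of_isNoetherianRing O
    (⟨x, (hW x).2 hx⟩ : W) (by simpa [Subtype.ext_iff] using hx0)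
  obtain ⟨hPprime, y, hy⟩ := isAssociatedPrime_iff.1 hP
  let f : O →ₗ[O] X := LinearMap.toSpanSingleton O X y
  have hker : f.ker = P := by
    ext a
    rw [hy, Submodule.mem_colon_singleton, LinearMap.mem_ker, Submodule.mem_bot, Subtype.ext_iff]
    rfl
  have hinf : Infinite O := Infinite.of_injective _ (Nat.cast_injective (R := O))
  have hP0 : P ≠ ⊥ := by
    rintro rfl
    exact not_injective_infinite_finite f (LinearMap.ker_eq_bot.1 hker)
  have hfT (v : X) (hv : v ∈ f.range) : T v = z • v := by
    obtain ⟨a, rfl⟩ := hv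
    change T (a • (y : X)) = z • a • (y : X)
    rw [map_smul, (hW y).1 y.2, smul_comm]
  let V : Submodule O X := f.range
  have : Finite (X ⧸ V) := Finite.of_surjective V.mkQ V.mkQ_surjective
  have hTV : V ≤ V.comap T := fun v hv => by
    rw [Submodule.mem_comap, hfT v hv]
    exact V.smul_mem z hv
  have hV0 : (y : X) ≠ 0 := by
    intro h0
    refine hPprime.ne_top ?_
    rw [← hker, LinearMap.ker_eq_top]
    ext
    simp [f, h0]
  have hT' : (T.restrictScalars ℤ) ^ orderOf c = 1 := by
    have (k : ℕ) : (T.restrictScalars ℤ) ^ k = (T ^ k).restrictScalars ℤ := by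
      induction k with
      | zero => rfl
      | succ k ih => rw [pow_succ', ih, pow_succ']; rfl
    rw [this, hT]
    rfl
  have hquot : (V.mapQ V T hTV) ^ orderOf c = 1 := by
    have (k : ℕ) (x : X) : ((V.mapQ V T hTV) ^ k) (V.mkQ x) = V.mkQ ((T ^ k) x) := by
      induction k with
      | zero => rfl
      | succ k ih => rw [pow_succ', Module.End.mul_apply, ih, pow_succ']; rfl
    refine LinearMap.ext fun x => ?_
    obtain ⟨x, rfl⟩ := V.mkQ_surjective x
    rw [this, hT]
    rfl
  have hex := coindCls_exact c (scalarMap V z) (T.restrictScalars ℤ)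
    ((V.mapQ V T hTV).restrictScalars ℤ) hT' (V.subtype.restrictScalars ℤ)
    (V.mkQ.restrictScalars ℤ) (fun v => (hfT v v.2).symm) (fun _ => rfl)
    V.injective_subtype V.mkQ_surjective (LinearMap.exact_subtype_mkQ V)
  have hVP : coindCls c (scalarMap V z) = 0 := by
    rw [← scalarCls_congr c z hz (f.quotKerEquivRange), hker]
    exact scalarCls_quotient_prime P hP0 c z hz
  have hlt : Nat.card (X ⧸ V) < n := by
    have hVn : Nontrivial V := ⟨⟨⟨y, 1, by simp [f]⟩, 0, fun h => hV0 (congrArg Subtype.val h)⟩⟩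
    have h1 := V.card_eq_card_quotient_mul_card
    have h2 : 1 < Nat.card V := Finite.one_lt_card
    have h3 : 0 < Nat.card (X ⧸ V) := Nat.card_pos
    rw [← hn, h1]
    nlinarith
  rw [hex, hVP, zero_add]
  exact ih _ hlt _ hquot rfl

end Dedekind

section Cyclic

variable {G : Type} [Group G] [Finite G]

theorem coindCls_cyclic {S : Type} [AddCommGroup S] [Finite S] (c : G)
    (ρ : Representation ℤ G S) : coindCls c (ρ c) = 0 := by
  have hpos := orderOf_pos c
  have : NeZero (orderOf c) := ⟨hpos.ne'⟩
  let K := CyclotomicField (orderOf c) ℚ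
  have : IsCyclotomicExtension {orderOf c} ℚ K := CyclotomicField.isCyclotomicExtension _ _
  have : NumberField K := IsCyclotomicExtension.numberField {orderOf c} ℚ K
  let O := 𝓞 K
  have hζ := (IsCyclotomicExtension.zeta_spec (orderOf c) ℚ K).toInteger_isPrimitiveRoot
  let b : Module.Basis (Fin (Module.finrank ℤ O)) ℤ O := Module.finBasis ℤ O
  let e : (O ⊗[ℤ] S) ≃ₗ[ℤ] (Fin (Module.finrank ℤ O) → S) :=
    (TensorProduct.equivFinsuppOfBasisLeft b).trans
      (Finsupp.linearEquivFunOnFinite ℤ S (Fin (Module.finrank ℤ O)))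
  have he (x : O) (y : S) (i) : e (x ⊗ₜ[ℤ] y) i = b.repr x i • y :=
    TensorProduct.equivFinsuppOfBasisLeft_apply_tmul_apply b x y i
  have hfin : Finite (O ⊗[ℤ] S) := Finite.of_equiv _ e.symm.toEquiv
  have hpow : (ρ c) ^ orderOf c = 1 := by
    rw [← map_pow, pow_orderOf_eq_one, map_one]
  have hpow' : ((ρ c).baseChange O) ^ orderOf c = 1 := by
    rw [← LinearMap.baseChange_pow, hpow, LinearMap.baseChange_one]
  have h0 := coindCls_finite c _ hζ _ ((ρ c).baseChange O) hpow' rfl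
  have hpowF : ((ρ c).compLeft (Fin (Module.finrank ℤ O))) ^ orderOf c = 1 := by
    have (k : ℕ) : ((ρ c).compLeft (Fin (Module.finrank ℤ O))) ^ k =
        ((ρ c) ^ k).compLeft (Fin (Module.finrank ℤ O)) := by
      induction k with
      | zero => rfl
      | succ k ih => rw [pow_succ', ih, pow_succ']; rfl
    rw [this, hpow]
    rfl
  have h1 := coindCls_congr c (((ρ c).baseChange O).restrictScalars ℤ)
    ((ρ c).compLeft (Fin (Module.finrank ℤ O))) hpowF e.toAddEquiv.toIntLinearEquiv (by
      intro x
      induction x with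
      | zero => simp
      | add x y hx hy => rw [map_add, map_add, hx, hy, map_add, map_add]
      | tmul x y =>
        ext i
        change e (x ⊗ₜ[ℤ] ρ c y) i = ρ c (e (x ⊗ₜ[ℤ] y) i)
        rw [he, he, map_zsmul])
  rw [h0, coindCls_pi c _ hpow] at h1
  exact eq_zero_of_nsmul_eq_zero (Module.finrank_pos (R := ℤ) (M := O)).ne' h1.symm

end Cyclic

section Permutation

variable {G : Type} [Group G]

/-- Functions on a `G`-set with values in a representation. -/
def funRep {X S : Type} [AddCommGroup S] (a : G →* Equiv.Perm X) (ρ : Representation ℤ G S) :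
    Representation ℤ G (X → S) where
  toFun g :=
    { toFun := fun f x => ρ g (f (a g⁻¹ x))
      map_add' := fun _ _ => by ext; simp
      map_smul' := fun _ _ => by ext; simp }
  map_one' := by ext; simp
  map_mul' g h := by
    refine LinearMap.ext fun f => funext fun x => ?_
    change ρ (g * h) (f (a (g * h)⁻¹ x)) = ρ g (ρ h (f (a h⁻¹ (a g⁻¹ x))))
    simp

theorem funRep_apply {X S : Type} [AddCommGroup S] (a : G →* Equiv.Perm X)
    (ρ : Representation ℤ G S) (g : G) (f : X → S) (x : X) :
    funRep a ρ g f x = ρ g (f (a g⁻¹ x)) := rfl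

/-- The number of fixed points of an element in a permutation action. -/
noncomputable def fixCount {X : Type} (a : G →* Equiv.Perm X) (g : G) : ℕ := Nat.card {x // a g x = x}

theorem ch_eq_trace {M : Type} [AddCommGroup M] [Module.Finite ℤ M] [Module.Free ℤ M]
    (ρ : Representation ℤ G M) (g : G) : ch ρ g = (LinearMap.trace ℤ M (ρ g) : ℚ) := by
  change LinearMap.trace ℚ _ ((ρ g).baseChange ℚ) = _
  rw [LinearMap.trace_baseChange]
  rfl

theorem ch_permutation {X : Type} [Finite X] (a : G →* Equiv.Perm X) (g : G) :
    ch (funRep a (1 : Representation ℤ G ℤ)) g = fixCount a g := by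
  classical
  have := Fintype.ofFinite X
  rw [ch_eq_trace, LinearMap.trace_eq_matrix_trace ℤ (Pi.basisFun ℤ X), Matrix.trace]
  have (x : X) : Matrix.diag (LinearMap.toMatrix (Pi.basisFun ℤ X) (Pi.basisFun ℤ X)
      (funRep a (1 : Representation ℤ G ℤ) g)) x = if a g x = x then 1 else 0 := by
    rw [Matrix.diag_apply, LinearMap.toMatrix_apply, Pi.basisFun_repr, funRep_apply]
    simp only [Pi.basisFun_apply, map_inv, MonoidHom.one_apply, Module.End.one_apply,
      Pi.single_apply]
    refine if_congr ?_ rfl rfl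
    rw [Equiv.Perm.inv_eq_iff_eq, eq_comm]
  rw [Finset.sum_congr rfl fun x _ => this x, Finset.sum_boole, fixCount, Nat.card_eq_fintype_card,
    Fintype.card_subtype]
  push_cast
  rfl

/-- Permutation actions for which all function modules with values in finite modules have trivial
class up to torsion. -/
def FunTrivial {X : Type} (a : G →* Equiv.Perm X) : Prop :=
  ∀ (S : Type) [AddCommGroup S] [Finite S] (ρ : Representation ℤ G S), tcl (funRep a ρ) = 0

/-- The product of two permutation actions. -/
def permProd {X Y : Type} (a : G →* Equiv.Perm X) (b : G →* Equiv.Perm Y) :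
    G →* Equiv.Perm (X × Y) where
  toFun g := Equiv.prodCongr (a g) (b g)
  map_one' := by ext <;> simp
  map_mul' g h := by ext <;> simp

/-- The disjoint union of two permutation actions. -/
def permSum {X Y : Type} (a : G →* Equiv.Perm X) (b : G →* Equiv.Perm Y) :
    G →* Equiv.Perm (X ⊕ Y) where
  toFun g := Equiv.sumCongr (a g) (b g)
  map_one' := by ext (x | x) <;> simp
  map_mul' g h := by ext (x | x) <;> simp

theorem fixCount_prod {X Y : Type} (a : G →* Equiv.Perm X) (b : G →* Equiv.Perm Y) (g : G) :
    fixCount (permProd a b) g = fixCount a g * fixCount b g := by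
  rw [fixCount, fixCount, fixCount, ← Nat.card_prod]
  exact Nat.card_congr ((Equiv.subtypeEquivRight fun x => by simp [permProd, Prod.ext_iff]).trans
    (Equiv.subtypeProdEquivProd (p := fun x => a g x = x) (q := fun x => b g x = x)))

theorem fixCount_sum {X Y : Type} [Finite X] [Finite Y] (a : G →* Equiv.Perm X)
    (b : G →* Equiv.Perm Y) (g : G) :
    fixCount (permSum a b) g = fixCount a g + fixCount b g := by
  rw [fixCount, fixCount, fixCount, ← Nat.card_sum]
  exact Nat.card_congr ((Equiv.subtypeSum).trans
    (Equiv.sumCongr (Equiv.subtypeEquivRight fun x => by simp [permSum])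
      (Equiv.subtypeEquivRight fun x => by simp [permSum])))

theorem FunTrivial.prod {X Y : Type} [Finite X] [Finite Y] (a : G →* Equiv.Perm X)
    {b : G →* Equiv.Perm Y} (hb : FunTrivial b) : FunTrivial (permProd a b) := by
  intro S _ _ ρ
  rw [← hb (X → S) (funRep a ρ)]
  refine tcl_congr _ _ (AddEquiv.toIntLinearEquiv
    { toFun := fun f y x => f (x, y)
      invFun := fun f z => f z.2 z.1
      map_add' := fun _ _ => rfl }) fun g f => ?_
  rfl

theorem tcl_funRep_sum {X Y S : Type} [Finite X] [Finite Y] [AddCommGroup S] [Module.Finite ℤ S]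
    (a : G →* Equiv.Perm X) (b : G →* Equiv.Perm Y) (ρ : Representation ℤ G S) :
    tcl (funRep (permSum a b) ρ) = tcl (funRep a ρ) + tcl (funRep b ρ) := by
  refine tcl_exact _ _ _
    ((LinearEquiv.sumArrowLequivProdArrow X Y ℤ S).symm.toLinearMap ∘ₗ LinearMap.inl ℤ _ _)
    (LinearMap.funLeft ℤ S Sum.inr) ?_ (fun _ _ => rfl)
    ((LinearEquiv.sumArrowLequivProdArrow X Y ℤ S).symm.injective.comp
      (LinearMap.inl_injective (R := ℤ) (M := X → S) (M₂ := Y → S)))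
    (LinearMap.funLeft_surjective_of_injective ℤ S _ Sum.inr_injective) ?_
  · intro g f
    ext (x | x)
    · rfl
    · exact (map_zero (ρ g)).symm
  · intro f
    constructor
    · intro h
      refine ⟨fun x => f (Sum.inl x), ?_⟩
      ext (x | x)
      · rfl
      · exact (congrFun h x).symm
    · rintro ⟨f, rfl⟩
      rfl

theorem FunTrivial.sum {X Y : Type} [Finite X] [Finite Y] {a : G →* Equiv.Perm X}
    {b : G →* Equiv.Perm Y} (ha : FunTrivial a) (hb : FunTrivial b) : FunTrivial (permSum a b) := by
  intro S _ _ ρ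
  rw [tcl_funRep_sum, ha, hb, add_zero]

theorem FunTrivial.of_isEmpty {X : Type} [IsEmpty X] (a : G →* Equiv.Perm X) : FunTrivial a :=
  fun _ _ _ _ => tcl_zero _

variable [Finite G]

theorem funTrivial_zpowers (c : G) :
    FunTrivial (MulAction.toPermHom G (G ⧸ Subgroup.zpowers c)) := by
  intro S _ _ ρ
  rw [← coindCls_cyclic c ρ]
  let C := Subgroup.zpowers c
  have key (f : coindSub c (ρ c)) (g h : G) (hgh : (g : G ⧸ C) = h) :
      ρ g (f.1 g⁻¹) = ρ h (f.1 h⁻¹) := by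
    obtain ⟨i, hi⟩ := (isOfFinOrder_of_finite c).mem_powers_iff_mem_zpowers.2
      (QuotientGroup.eq.1 hgh)
    have hpow (k : ℕ) (g : G) : f.1 (c ^ k * g) = ρ (c ^ k) (f.1 g) := by
      induction k with
      | zero => simp
      | succ k ih => rw [pow_succ', mul_assoc, f.2, ih, map_mul]; rfl
    simp only at hi
    have h1 : g⁻¹ = c ^ i * h⁻¹ := by rw [hi]; group
    rw [h1, hpow, ← Module.End.mul_apply, ← map_mul, hi]
    simp
  let e : (G ⧸ C → S) →ₗ[ℤ] coindSub c (ρ c) :=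
    { toFun := fun F => ⟨fun g => ρ g (F ((g⁻¹ : G) : G ⧸ C)), fun g => by
        have : (((c * g)⁻¹ : G) : G ⧸ C) = ((g⁻¹ : G) : G ⧸ C) :=
          QuotientGroup.eq.2 (by simp [C])
        simp only [this, map_mul]
        rfl⟩
      map_add' := fun _ _ => Subtype.ext (funext fun g => map_add (ρ g) _ _)
      map_smul' := fun _ _ => Subtype.ext (funext fun g => map_smul (ρ g) _ _) }
  have he (F : G ⧸ C → S) (g : G) : (e F).1 g = ρ g (F ((g⁻¹ : G) : G ⧸ C)) := rfl
  have hbij : Function.Bijective e := by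
    constructor
    · intro F F' h
      ext x
      obtain ⟨g, rfl⟩ := QuotientGroup.mk_surjective x
      have := congrFun (congrArg Subtype.val h) g⁻¹
      rw [he, he, inv_inv] at this
      exact (ρ.apply_bijective _).1 this
    · intro f
      refine ⟨fun x => ρ x.out (f.1 x.out⁻¹), Subtype.ext (funext fun g => ?_)⟩
      rw [he, key f _ g⁻¹ (by simp), ← Module.End.mul_apply, ← map_mul]
      simp
  refine tcl_congr _ _ (LinearEquiv.ofBijective e hbij) fun g F => Subtype.ext (funext fun h => ?_)
  change ρ h (ρ g (F (g⁻¹ • ((h⁻¹ : G) : G ⧸ C)))) = ρ (h * g) (F (((h * g)⁻¹ : G) : G ⧸ C))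
  rw [map_mul, Module.End.mul_apply]
  congr 4
  rw [mul_inv_rev]
  rfl

/-- Artin induction for the trivial character. -/
theorem exists_funTrivial (T : Finset G) : ∃ (m : ℕ) (X Y : Type) (_ : Finite X) (_ : Finite Y)
    (a : G →* Equiv.Perm X) (b : G →* Equiv.Perm Y), 0 < m ∧ FunTrivial a ∧ FunTrivial b ∧
      ∀ g ∈ T, m + fixCount b g = fixCount a g := by
  classical
  induction T using Finset.induction_on with
  | empty =>
    exact ⟨1, Empty, Empty, inferInstance, inferInstance, 1, 1, one_pos,
      FunTrivial.of_isEmpty _, FunTrivial.of_isEmpty _, by simp⟩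
  | insert t T _ ih =>
    obtain ⟨m, X, Y, _, _, a, b, hm, ha, hb, h⟩ := ih
    have hz := funTrivial_zpowers t
    set z := MulAction.toPermHom G (G ⧸ Subgroup.zpowers t)
    have hk : 0 < fixCount z t := by
      have : Nonempty {x // z t x = x} := ⟨((1 : G) : G ⧸ Subgroup.zpowers t), by
        change ((t * 1 : G) : G ⧸ Subgroup.zpowers t) = _
        rw [QuotientGroup.eq]
        simp⟩
      exact Nat.card_pos
    set k := fixCount z t
    have hone (n : ℕ) (g : G) : fixCount (1 : G →* Equiv.Perm (Fin n)) g = n := by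
      simp [fixCount]
    refine ⟨m * k, _, _, inferInstance, inferInstance,
      permSum (permSum (permProd (1 : G →* Equiv.Perm (Fin k)) a)
        (permProd (1 : G →* Equiv.Perm (Fin m)) z)) (permProd b z),
      permSum (permProd (1 : G →* Equiv.Perm (Fin k)) b) (permProd a z), Nat.mul_pos hm hk,
      ((ha.prod _).sum (hz.prod _)).sum (hz.prod _), (hb.prod _).sum (hz.prod _), ?_⟩
    intro g hg
    simp only [fixCount_sum, fixCount_prod, hone]
    rcases Finset.mem_insert.1 hg with rfl | hg
    · change m * k + (k * fixCount b g + fixCount a g * k) =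
        k * fixCount a g + m * k + fixCount b g * k
      ring
    · rw [← h g hg]
      ring

end Permutation

section FiniteModules

variable {G : Type} [Group G]

theorem exists_comp_eq_of_ker_le {k U V W : Type*} [Field k] [AddCommGroup U] [AddCommGroup V]
    [AddCommGroup W] [Module k U] [Module k V] [Module k W] (f : U →ₗ[k] V) (g : U →ₗ[k] W)
    (h : ∀ x, f x = 0 → g x = 0) : ∃ e : V →ₗ[k] W, ∀ x, e (f x) = g x := by
  obtain ⟨e, he⟩ := LinearMap.exists_extend
    ((Submodule.liftQ f.ker g fun x hx => h x hx) ∘ₗ f.quotKerEquivRange.symm.toLinearMap)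
  refine ⟨e, fun x => ?_⟩
  have := LinearMap.congr_fun he (f.quotKerEquivRange (Submodule.Quotient.mk x))
  simp only [LinearMap.comp_apply, LinearEquiv.coe_coe, LinearEquiv.symm_apply_apply] at this
  exact this

theorem exists_factor_of_torsion {p : ℕ} [Fact p.Prime] {S L M : Type} [AddCommGroup S]
    [AddCommGroup L] [AddCommGroup M] (hS : ∀ s : S, p • s = 0) (k : M →+ L) (φ : M →+ S)
    (h : ∀ m l, k m = p • l → φ m = 0) : ∃ ψ : L →+ S, ψ.comp k = φ := by
  let _ : Module (ZMod p) S := AddCommGroup.zmodModule hS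
  let U : AddSubgroup L := (nsmulAddMonoidHom p).range
  let _ : Module (ZMod p) (L ⧸ U) := QuotientAddGroup.zmodModule fun x => ⟨x, rfl⟩
  have hkill (x : M ⧸ (nsmulAddMonoidHom (α := M) p).range) : p • x = 0 := by
    obtain ⟨x, rfl⟩ := QuotientAddGroup.mk_surjective x
    exact (QuotientAddGroup.eq_zero_iff _).2 ⟨x, rfl⟩
  let _ : Module (ZMod p) (M ⧸ (nsmulAddMonoidHom (α := M) p).range) :=
    AddCommGroup.zmodModule hkill
  let k' : (M ⧸ (nsmulAddMonoidHom (α := M) p).range) →+ (L ⧸ U) :=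
    QuotientAddGroup.map _ _ k (by rintro _ ⟨x, rfl⟩; exact ⟨k x, by simp⟩)
  let φ' : (M ⧸ (nsmulAddMonoidHom (α := M) p).range) →+ S :=
    QuotientAddGroup.lift _ φ (by rintro _ ⟨x, rfl⟩; simp [hS])
  obtain ⟨ψ, hψ⟩ := exists_comp_eq_of_ker_le (k'.toZModLinearMap p) (φ'.toZModLinearMap p) (by
    intro x hx
    obtain ⟨x, rfl⟩ := QuotientAddGroup.mk_surjective x
    obtain ⟨l, hl⟩ := (QuotientAddGroup.eq_zero_iff (k x)).1 hx
    exact h x l hl.symm)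
  exact ⟨ψ.toAddMonoidHom.comp (QuotientAddGroup.mk' U), AddMonoidHom.ext fun m =>
    hψ (QuotientAddGroup.mk m)⟩

theorem tcl_subrepresentation_congr {M : Type} [AddCommGroup M] (ρ : Representation ℤ G M)
    {W W' : Submodule ℤ M} (h : W = W') (hW : ∀ g, W ≤ W.comap (ρ g))
    (hW' : ∀ g, W' ≤ W'.comap (ρ g)) :
    tcl (ρ.subrepresentation W hW) = tcl (ρ.subrepresentation W' hW') := by
  subst h
  rfl

/-- Two representations joined by maps in both directions with mutually matching kernels and
ranges have the same class. -/
theorem tcl_eq_of_ker_eq_range {M N : Type} [AddCommGroup M] [AddCommGroup N] [Module.Finite ℤ M]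
    [Module.Finite ℤ N] (ρ : Representation ℤ G M) (σ : Representation ℤ G N) (f : M →ₗ[ℤ] N)
    (k : N →ₗ[ℤ] M) (hf : ∀ g x, f (ρ g x) = σ g (f x)) (hk : ∀ g x, k (σ g x) = ρ g (k x))
    (h1 : f.ker = k.range) (h2 : k.ker = f.range) : tcl ρ = tcl σ := by
  have e1 := congrArg (QuotientAddGroup.mk' (AddCommGroup.torsion (G0 (MonoidAlgebra ℤ G))))
    (cl_ker_range ρ σ f hf (ker_le_comap ρ σ f hf) (range_le_comap ρ σ f hf))
  have e2 := congrArg (QuotientAddGroup.mk' (AddCommGroup.torsion (G0 (MonoidAlgebra ℤ G))))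
    (cl_ker_range σ ρ k hk (ker_le_comap σ ρ k hk) (range_le_comap σ ρ k hk))
  have e3 := tcl_subrepresentation_congr ρ h1 (ker_le_comap ρ σ f hf) (range_le_comap σ ρ k hk)
  have e4 := tcl_subrepresentation_congr σ h2 (ker_le_comap σ ρ k hk) (range_le_comap ρ σ f hf)
  refine e1.trans (Eq.trans ?_ e2.symm)
  rw [map_add, map_add, add_comm]
  exact congrArg₂ _ e4.symm e3

/-- The representation on homomorphisms. -/
def homRep {M S : Type} [AddCommGroup M] [AddCommGroup S] (ρ : Representation ℤ G M)
    (σ : Representation ℤ G S) : Representation ℤ G (M →ₗ[ℤ] S) where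
  toFun g :=
    { toFun := fun f => σ g ∘ₗ f ∘ₗ ρ g⁻¹
      map_add' := fun _ _ => by ext; simp
      map_smul' := fun _ _ => by ext; simp }
  map_one' := by ext; simp
  map_mul' g h := by ext; simp

/-- Precomposition. -/
def precomp {L M : Type} (S : Type) [AddCommGroup L] [AddCommGroup M] [AddCommGroup S]
    (f : L →ₗ[ℤ] M) : (M →ₗ[ℤ] S) →ₗ[ℤ] (L →ₗ[ℤ] S) where
  toFun φ := φ ∘ₗ f
  map_add' _ _ := rfl
  map_smul' _ _ := rfl

theorem precomp_equivariant {L M S : Type} [AddCommGroup L] [AddCommGroup M] [AddCommGroup S]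
    (ρL : Representation ℤ G L) (ρM : Representation ℤ G M) (ρS : Representation ℤ G S)
    (f : L →ₗ[ℤ] M) (hf : ∀ s x, f (ρL s x) = ρM s (f x)) (g : G) (φ : M →ₗ[ℤ] S) :
    precomp S f (homRep ρM ρS g φ) = homRep ρL ρS g (precomp S f φ) := by
  ext x
  change ρS g (φ (ρM g⁻¹ (f x))) = ρS g (φ (f (ρL g⁻¹ x)))
  rw [hf]

theorem isLatticeInvariant_homRep {p : ℕ} [Fact p.Prime] {S : Type} [AddCommGroup S] [Finite S]
    (hS : ∀ s : S, p • s = 0) (ρS : Representation ℤ G S) :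
    IsLatticeInvariant (fun M _ (ρ : Representation ℤ G M) => tcl (homRep ρ ρS)) where
  exact := by
    intro L M N _ _ _ _ _ _ _ _ _ ρL ρM ρN f g hf hg inj surj ex
    rw [add_comm]
    have htfae := (ex.split_tfae').out 0 1
    obtain ⟨-, r, hr⟩ := htfae.1 ⟨inj, Module.projective_lifting_property g LinearMap.id surj⟩
    refine tcl_exact _ _ _ (precomp S g) (precomp S f) (precomp_equivariant _ _ _ g hg)
      (precomp_equivariant _ _ _ f hf) ?_ ?_ ?_
    · intro φ ψ h
      ext x
      obtain ⟨x, rfl⟩ := surj x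
      exact LinearMap.congr_fun h x
    · intro φ
      refine ⟨φ ∘ₗ r, LinearMap.ext fun x => ?_⟩
      exact congrArg φ (LinearMap.congr_fun hr x)
    · intro φ
      constructor
      · intro h
        have hle : g.ker ≤ φ.ker := by
          intro x hx
          obtain ⟨y, rfl⟩ := (ex x).1 hx
          exact LinearMap.congr_fun h y
        refine ⟨g.ker.liftQ φ hle ∘ₗ (g.quotKerEquivOfSurjective surj).symm.toLinearMap, ?_⟩
        ext x
        change g.ker.liftQ φ hle ((g.quotKerEquivOfSurjective surj).symm (g x)) = φ x
        have : (g.quotKerEquivOfSurjective surj).symm (g x) = Submodule.Quotient.mk x := by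
          rw [LinearEquiv.symm_apply_eq]
          rfl
        rw [this]
        rfl
      · rintro ⟨ψ, rfl⟩
        ext x
        change ψ (g (f x)) = 0
        rw [(ex (f x)).2 ⟨x, rfl⟩, map_zero]
  index := by
    intro L M _ _ _ _ _ _ ρL ρM f hf inj q hq h
    choose k hk using h
    let k' : M →ₗ[ℤ] L := AddMonoidHom.toIntLinearMap
      { toFun := k
        map_zero' := inj (by simp [hk])
        map_add' := fun x y => inj (by simp [hk]) }
    have hfk (x : M) : f (k' x) = q • x := hk x
    have hkf (y : L) : k' (f y) = q • y := inj (by rw [hfk, map_nsmul])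
    have hkeq (s : G) (x : M) : k' (ρM s x) = ρL s (k' x) := inj (by
      rw [hfk, hf, hfk, map_nsmul])
    by_cases hqp : q = p
    · subst hqp
      refine tcl_eq_of_ker_eq_range _ _ (precomp S k') (precomp S f)
        (precomp_equivariant _ _ _ k' hkeq) (precomp_equivariant _ _ _ f hf) ?_ ?_
      · ext ψ
        constructor
        · intro hψ
          obtain ⟨φ, hφ⟩ := exists_factor_of_torsion hS f.toAddMonoidHom ψ.toAddMonoidHom
            (fun y m hm => by
              have : y = k' m := inj (by rw [hfk]; exact hm)
              rw [this]
              exact LinearMap.congr_fun hψ m)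
          exact ⟨φ.toIntLinearMap, LinearMap.ext fun x => DFunLike.congr_fun hφ x⟩
        · rintro ⟨φ, rfl⟩
          refine LinearMap.ext fun x => ?_
          change φ (f (k' x)) = 0
          rw [hfk, map_nsmul, hS]
      · ext φ
        constructor
        · intro hφ
          obtain ⟨ψ, hψ⟩ := exists_factor_of_torsion hS k'.toAddMonoidHom φ.toAddMonoidHom
            (fun x y hy => by
              have : x = f y := by
                refine smul_right_injective M (Nat.cast_ne_zero.2 hq.ne_zero : (q : ℤ) ≠ 0) ?_
                simp only [natCast_zsmul]
                rw [← hfk, ← map_nsmul]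
                exact congrArg f hy
              rw [this]
              exact LinearMap.congr_fun hφ y)
          exact ⟨ψ.toIntLinearMap, LinearMap.ext fun x => DFunLike.congr_fun hψ x⟩
        · rintro ⟨ψ, rfl⟩
          refine LinearMap.ext fun y => ?_
          change ψ (k' (f y)) = 0
          rw [hkf, map_nsmul, hS]
    · have hcop : Nat.Coprime q p := (Nat.coprime_primes hq Fact.out).2 hqp
      have hbij (s : S) : q • s = 0 → s = 0 := fun h0 => by
        have h1 := addOrderOf_dvd_of_nsmul_eq_zero h0
        have h2 := addOrderOf_dvd_of_nsmul_eq_zero (hS s)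
        exact AddMonoid.addOrderOf_eq_one_iff.1 (Nat.eq_one_of_dvd_coprimes hcop h1 h2)
      obtain ⟨a, ha⟩ : ∃ a : ℕ, ∀ s : S, a • q • s = s := by
        obtain ⟨a, -, ha⟩ := Nat.exists_mul_mod_eq_one_of_coprime hcop (Fact.out : p.Prime).one_lt
        refine ⟨a, fun s => ?_⟩
        have h1 := Nat.div_add_mod (q * a) p
        rw [ha] at h1
        rw [← mul_smul, mul_comm, ← h1, add_smul, mul_smul, hS, zero_add, one_smul]
      symm
      refine tcl_congr _ _ (LinearEquiv.ofBijective (precomp S f) ⟨?_, ?_⟩)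
        (precomp_equivariant _ _ _ f hf)
      · rw [← LinearMap.ker_eq_bot, LinearMap.ker_eq_bot']
        intro φ hφ
        ext x
        refine hbij _ ?_
        rw [← map_nsmul, ← hfk]
        exact LinearMap.congr_fun hφ (k' x)
      · intro ψ
        refine ⟨a • (ψ ∘ₗ k'), LinearMap.ext fun y => ?_⟩
        change a • ψ (k' (f y)) = ψ y
        rw [hkf, map_nsmul, ha]

theorem tcl_homRep_permutation {X S : Type} [Finite X] [AddCommGroup S] [Module.Finite ℤ S]
    (a : G →* Equiv.Perm X) (ρ : Representation ℤ G S) :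
    tcl (homRep (funRep a (1 : Representation ℤ G ℤ)) ρ) = tcl (funRep a ρ) := by
  classical
  have := Fintype.ofFinite X
  symm
  refine tcl_congr _ _ ((Pi.basisFun ℤ X).constr ℤ).toAddEquiv.toIntLinearEquiv fun g f => ?_
  refine (Pi.basisFun ℤ X).ext fun x => ?_
  change (Pi.basisFun ℤ X).constr ℤ _ _ = ρ g ((Pi.basisFun ℤ X).constr ℤ f
    (funRep a (1 : Representation ℤ G ℤ) g⁻¹ (Pi.basisFun ℤ X x)))
  have : funRep a (1 : Representation ℤ G ℤ) g⁻¹ (Pi.basisFun ℤ X x) =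
      Pi.basisFun ℤ X (a g⁻¹ x) := by
    ext y
    simp only [funRep_apply, Pi.basisFun_apply, Pi.single_apply, inv_inv, MonoidHom.one_apply,
      Module.End.one_apply]
    refine if_congr ?_ rfl rfl
    rw [map_inv, Equiv.Perm.eq_inv_iff_eq]
  rw [this, Module.Basis.constr_basis, Module.Basis.constr_basis, funRep_apply]

end FiniteModules

section Main

variable {G : Type} [Group G]

theorem tcl_funRep_trivial {S : Type} [AddCommGroup S] [Module.Finite ℤ S]
    (ρ : Representation ℤ G S) (m : ℕ) :
    tcl (funRep (1 : G →* Equiv.Perm (Fin m)) ρ) = m • tcl ρ := by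
  induction m with
  | zero => rw [tcl_zero, zero_smul]
  | succ m ih =>
    rw [succ_nsmul, ← ih]
    have h1 : tcl (funRep (1 : G →* Equiv.Perm (Fin 1)) ρ) = tcl ρ :=
      tcl_congr _ _ (LinearEquiv.funUnique (Fin 1) ℤ S) fun _ _ => rfl
    rw [← h1, ← tcl_funRep_sum]
    refine tcl_congr _ _ (LinearEquiv.funCongrLeft ℤ S finSumFinEquiv) fun g f => ?_
    ext (x | x) <;> rfl

variable [Finite G]

theorem tcl_of_prime_torsion {p : ℕ} [Fact p.Prime] {S : Type} [AddCommGroup S] [Finite S]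
    (hS : ∀ s : S, p • s = 0) (ρ : Representation ℤ G S) : tcl ρ = 0 := by
  have := Fintype.ofFinite G
  obtain ⟨m, X, Y, _, _, a, b, hm, ha, hb, h⟩ := exists_funTrivial (Finset.univ : Finset G)
  have key := (isLatticeInvariant_homRep hS ρ).eq_of_ch _
    (funRep (permSum (1 : G →* Equiv.Perm (Fin m)) b) (1 : Representation ℤ G ℤ))
    (funRep a (1 : Representation ℤ G ℤ)) rfl (by
      ext g
      rw [ch_permutation, ch_permutation, fixCount_sum, ← h g (Finset.mem_univ g)]
      simp [fixCount])
  rw [tcl_homRep_permutation, tcl_homRep_permutation, ha, tcl_funRep_sum, hb, add_zero,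
    tcl_funRep_trivial] at key
  exact eq_zero_of_nsmul_eq_zero hm.ne' key

/-- Finite modules have torsion class in `G₀(ℤ[G])`. -/
theorem tcl_of_finite (n : ℕ) : ∀ {S : Type} [AddCommGroup S] [Finite S]
    (ρ : Representation ℤ G S), Nat.card S = n → tcl ρ = 0 := by
  induction n using Nat.strong_induction_on with
  | _ n ih =>
  intro S _ _ ρ hn
  rcases subsingleton_or_nontrivial S with h | h
  · exact tcl_zero ρ
  obtain ⟨p, hp, hpn⟩ := Nat.exists_prime_and_dvd (Finite.one_lt_card (α := S)).ne'
  have := Fact.mk hp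
  let f : S →ₗ[ℤ] S := (p : ℤ) • LinearMap.id
  have hf (x : S) : f x = p • x := natCast_zsmul x p
  have hfρ (g : G) (x : S) : f (ρ g x) = ρ g (f x) := by
    rw [hf, hf, map_nsmul]
  have e := congrArg (QuotientAddGroup.mk' (AddCommGroup.torsion (G0 (MonoidAlgebra ℤ G))))
    (cl_ker_range ρ ρ f hfρ (ker_le_comap ρ ρ f hfρ) (range_le_comap ρ ρ f hfρ))
  rw [map_add] at e
  have e1 : tcl (ρ.subrepresentation f.ker (ker_le_comap ρ ρ f hfρ)) = 0 :=
    tcl_of_prime_torsion (p := p) (fun s => Subtype.ext ((hf s).symm.trans s.2)) _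
  have e2 : tcl (ρ.subrepresentation f.range (range_le_comap ρ ρ f hfρ)) = 0 := by
    refine ih _ ?_ _ rfl
    obtain ⟨x, hx⟩ := exists_prime_addOrderOf_dvd_card' p hpn
    rw [← hn]
    refine lt_of_le_of_ne (Nat.card_le_card_of_injective _ Subtype.val_injective) fun hcard => ?_
    have hsurj : Function.Surjective f.rangeRestrict := f.surjective_rangeRestrict
    have hinj := (Nat.bijective_iff_surjective_and_card f.rangeRestrict).2 ⟨hsurj, hcard.symm⟩
    have hx0 : x = 0 := hinj.1 (Subtype.ext (by
      change f x = f 0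
      rw [hf, hf, smul_zero, ← hx, addOrderOf_nsmul_eq_zero]))
    rw [hx0, addOrderOf_zero] at hx
    exact hp.one_lt.ne hx
  refine e.trans ?_
  refine (congrArg₂ _ e1 e2).trans (add_zero 0)

theorem isLatticeInvariant_tcl :
    IsLatticeInvariant (fun M _ (ρ : Representation ℤ G M) => tcl ρ) where
  exact ρL ρM ρN f g hf hg inj surj ex := tcl_exact ρL ρM ρN f g hf hg inj surj ex
  index := by
    intro L M _ _ _ _ _ _ ρL ρM f hf inj p hp h
    have hr := range_le_comap ρL ρM f hf
    have : Finite (M ⧸ f.range) := finite_of_nsmul_eq_zero p hp.pos fun x => by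
      obtain ⟨x, rfl⟩ := f.range.mkQ_surjective x
      rw [← map_nsmul]
      exact (Submodule.Quotient.mk_eq_zero _).2 (h x)
    have e := tcl_exact ρL ρM (ρM.quotient f.range hr) f f.range.mkQ hf (fun _ _ => rfl) inj
      f.range.mkQ_surjective (LinearMap.exact_map_mkQ_range f)
    rw [e, tcl_of_finite _ (ρM.quotient f.range hr) rfl, add_zero]

/-- The class of a module modulo torsion is determined by its rational character. -/
theorem tcl_eq_of_ch {M N : Type} [AddCommGroup M] [AddCommGroup N] [Module.Finite ℤ M]
    [Module.Finite ℤ N] (ρ : Representation ℤ G M) (σ : Representation ℤ G N)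
    (h : ch ρ = ch σ) : tcl ρ = tcl σ := by
  have aux {M : Type} [AddCommGroup M] [Module.Finite ℤ M] (ρ : Representation ℤ G M) :
      ∃ (L : Type) (_ : AddCommGroup L) (_ : Module.Finite ℤ L) (_ : Module.Free ℤ L)
        (τ : Representation ℤ G L), tcl ρ = tcl τ ∧ ch ρ = ch τ := by
    let T := Submodule.torsion ℤ M
    have hT (g : G) : T ≤ T.comap (ρ g) := by
      rintro x ⟨a, ha⟩
      refine ⟨a, ?_⟩
      have := congrArg (ρ g) ha
      rwa [map_zero, Submonoid.smul_def, map_zsmul] at this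
    have hfin : Finite T := Module.finite_of_fg_torsion T (Submodule.torsion_isTorsion)
    refine ⟨M ⧸ T, inferInstance, inferInstance, inferInstance, ρ.quotient T hT, ?_, ?_⟩
    · have e := congrArg (QuotientAddGroup.mk' (AddCommGroup.torsion (G0 (MonoidAlgebra ℤ G))))
        (cl_sub_quot ρ T hT)
      rw [map_add] at e
      refine e.trans ((congrArg₂ _ (tcl_of_finite _ (ρ.subrepresentation T hT) rfl) rfl).trans
        (zero_add _))
    · rw [ch_sub_quot ρ T hT, ch_eq_zero _ fun x => ⟨Nat.card T, Nat.card_pos, card_nsmul_eq_zero'⟩,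
        zero_add]
  obtain ⟨L, _, _, _, ρ', h1, h1'⟩ := aux ρ
  obtain ⟨L', _, _, _, σ', h2, h2'⟩ := aux σ
  rw [h1, h2]
  exact isLatticeInvariant_tcl.eq_of_ch _ ρ' σ' rfl (by rw [← h1', ← h2', h])

end Main

section RealCharacter

variable {G : Type} [Group G]

theorem ch_cast_eq_trace_baseChange {M : Type} [AddCommGroup M] [Module.Finite ℤ M]
    (ρ : Representation ℤ G M) (g : G) :
    ((ch ρ g : ℚ) : ℝ) = LinearMap.trace ℝ (ℝ ⊗[ℤ] M) ((ρ g).baseChange ℝ) := by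
  let e := TensorProduct.AlgebraTensorModule.cancelBaseChange ℤ ℚ ℝ ℝ M
  have he : e.conj ((rat ρ g).baseChange ℝ) = (ρ g).baseChange ℝ := by
    refine TensorProduct.AlgebraTensorModule.ext fun r x => ?_
    rw [LinearEquiv.conj_apply_apply]
    simp [e]
  rw [← he, LinearMap.trace_conj', LinearMap.trace_baseChange]
  rfl

theorem ch_cast_eq_trace {M W : Type} [AddCommGroup M] [Module.Finite ℤ M] [AddCommGroup W]
    [Module ℝ W] [FiniteDimensional ℝ W] (ρ : Representation ℤ G M) (g : G) (R : M →+ W)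
    (T : W →ₗ[ℝ] W) (hR : ∀ x, R (ρ g x) = T (R x))
    (hspan : Submodule.span ℝ (Set.range R) = ⊤)
    (hrank : Module.finrank ℤ M ≤ Module.finrank ℝ W) :
    ((ch ρ g : ℚ) : ℝ) = LinearMap.trace ℝ W T := by
  let S : (ℝ ⊗[ℤ] M) →ₗ[ℝ] W := LinearMap.liftBaseChange ℝ R.toIntLinearMap
  have hS (r : ℝ) (x : M) : S (r ⊗ₜ x) = r • R x := by simp [S]
  have surj : Function.Surjective S := by
    rw [← LinearMap.range_eq_top, eq_top_iff, ← hspan, Submodule.span_le]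
    rintro _ ⟨x, rfl⟩
    exact ⟨1 ⊗ₜ x, by simp [hS]⟩
  have hfin : Module.finrank ℝ (ℝ ⊗[ℤ] M) = Module.finrank ℤ M :=
    (TensorProduct.isBaseChange ℤ M ℝ).finrank_eq
  have hd : Module.finrank ℝ (ℝ ⊗[ℤ] M) = Module.finrank ℝ W :=
    le_antisymm (hfin ▸ hrank) (LinearMap.finrank_le_finrank_of_surjective surj)
  let e := LinearEquiv.ofBijective S
    ⟨(LinearMap.injective_iff_surjective_of_finrank_eq_finrank hd).2 surj, surj⟩
  have he : e.conj ((ρ g).baseChange ℝ) = T := by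
    rw [LinearEquiv.conj_apply, LinearEquiv.comp_toLinearMap_symm_eq]
    refine TensorProduct.AlgebraTensorModule.ext fun r x => ?_
    change S (r ⊗ₜ ρ g x) = T (S (r ⊗ₜ x))
    rw [hS, hS, hR, map_smul]
  rw [ch_cast_eq_trace_baseChange, ← he, LinearMap.trace_conj']

end RealCharacter

section Lift

variable {V : Type} [NormedAddCommGroup V] [NormedSpace ℝ V]

theorem eq_zero_of_forall_coe_eq_zero (l : V →ₗ[ℝ] ℝ)
    (h : ∀ v, ((l v : ℝ) : AddCircle (1 : ℝ)) = 0) : l = 0 := by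
  refine LinearMap.ext fun v => ?_
  by_contra hv
  change l v ≠ 0 at hv
  have := h ((2 * l v)⁻¹ • v)
  rw [map_smul, smul_eq_mul, mul_inv, mul_assoc, inv_mul_cancel₀ hv, mul_one,
    AddCircle.coe_eq_zero_iff] at this
  obtain ⟨n, hn⟩ := this
  have h2 : (n : ℝ) = 2⁻¹ := by simpa using hn
  have h3 : ((2 * n : ℤ) : ℝ) = ((1 : ℤ) : ℝ) := by push_cast; rw [h2]; norm_num
  have := Int.cast_injective h3
  omega

theorem exists_continuousMap_lift (f : C(V, AddCircle (1 : ℝ))) (hf : f 0 = 0) :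
    ∃ l : C(V, ℝ), l 0 = 0 ∧ ∀ v, ((l v : ℝ) : AddCircle (1 : ℝ)) = f v := by
  obtain ⟨l, ⟨h0, hl⟩, -⟩ := (AddCircle.isCoveringMap_coe (1 : ℝ)).existsUnique_continuousMap_lifts
    f 0 0 (by simpa using hf.symm)
  exact ⟨l, h0, fun v => congrFun hl v⟩

theorem exists_linear_lift (ψ : V →+ AddCircle (1 : ℝ)) (hψ : Continuous ψ) :
    ∃ l : V →ₗ[ℝ] ℝ, ∀ v, ((l v : ℝ) : AddCircle (1 : ℝ)) = ψ v := by
  obtain ⟨l, h0, hl⟩ := exists_continuousMap_lift ⟨ψ, hψ⟩ (map_zero ψ)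
  have hl (v : V) : ((l v : ℝ) : AddCircle (1 : ℝ)) = ψ v := hl v
  have hadd (v w : V) : l (v + w) = l v + l w := by
    let f (t : ℝ) : ℝ := l (v + t • w) - l v - l (t • w)
    have hf : Continuous f := by fun_prop
    have hex (t : ℝ) : f t ∈ Set.range ((↑) : ℤ → ℝ) := by
      have : ((f t : ℝ) : AddCircle (1 : ℝ)) = 0 := by
        simp only [f, AddCircle.coe_sub, hl, map_add]
        abel
      obtain ⟨n, hn⟩ := (AddCircle.coe_eq_zero_iff _).1 this
      exact ⟨n, by simpa using hn⟩
    choose n hn using hex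
    have hnc : Continuous n := by
      rw [Int.isClosedEmbedding_coe_real.isEmbedding.continuous_iff]
      exact hf.congr fun t => (hn t).symm
    have : n 1 = n 0 := PreconnectedSpace.constant inferInstance hnc
    have h1 : f 1 = f 0 := by rw [← hn, ← hn, this]
    simp only [f, one_smul, zero_smul, add_zero, h0, sub_self] at h1
    linarith
  let L : V →+ ℝ := ⟨⟨l, h0⟩, hadd⟩
  exact ⟨(L.toRealLinearMap l.continuous).toLinearMap, hl⟩

end Lift

section Dual

variable {A V D : Type} [AddCommGroup A] [TopologicalSpace A]
  [NormedAddCommGroup V] [NormedSpace ℝ V] [AddCommGroup D]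

/-- The linear form on the universal cover attached to a continuous character. -/
noncomputable def linearForm (ev : D ≃+ ContinuousAddMonoidHom A (AddCircle (1 : ℝ)))
    (E : V →+ A) (hE : Continuous E) (φ : D) : V →ₗ[ℝ] ℝ :=
  (exists_linear_lift ((ev φ).toAddMonoidHom.comp E) ((ev φ).continuous_toFun.comp hE)).choose

variable (ev : D ≃+ ContinuousAddMonoidHom A (AddCircle (1 : ℝ))) (E : V →+ A) (hE : Continuous E)

theorem coe_linearForm (φ : D) (v : V) :
    ((linearForm ev E hE φ v : ℝ) : AddCircle (1 : ℝ)) = ev φ (E v) :=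
  (exists_linear_lift ((ev φ).toAddMonoidHom.comp E)
    ((ev φ).continuous_toFun.comp hE)).choose_spec v

theorem linearForm_eq (φ : D) (l : V →ₗ[ℝ] ℝ)
    (h : ∀ v, ((l v : ℝ) : AddCircle (1 : ℝ)) = ev φ (E v)) : linearForm ev E hE φ = l := by
  rw [← sub_eq_zero]
  refine eq_zero_of_forall_coe_eq_zero _ fun v => ?_
  rw [LinearMap.sub_apply, AddCircle.coe_sub, coe_linearForm, h, sub_self]

/-- The linear form on the universal cover attached to a continuous character, as a
homomorphism. -/
noncomputable def linearFormHom : D →+ Module.Dual ℝ V :=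
  AddMonoidHom.mk' (linearForm ev E hE) fun φ ψ => by
    refine linearForm_eq _ _ _ _ _ fun v => ?_
    rw [LinearMap.add_apply, AddCircle.coe_add, coe_linearForm, coe_linearForm, map_add]
    rfl

theorem coe_linearFormHom (φ : D) (v : V) :
    ((linearFormHom ev E hE φ v : ℝ) : AddCircle (1 : ℝ)) = ev φ (E v) :=
  coe_linearForm ev E hE φ v

theorem finite_ker_linearFormHom [Finite (A ⧸ E.range)] : Finite (linearFormHom ev E hE).ker := by
  let Q := A ⧸ E.range
  let m := Nat.card Q
  have hm : 0 < m := Nat.card_pos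
  have := (AddCircle.finite_torsion (1 : ℝ) hm).to_subtype
  have hker (φ : (linearFormHom ev E hE).ker) (v : V) : ev (φ : D) (E v) = 0 := by
    rw [← coe_linearFormHom ev E hE, (φ.2 : linearFormHom ev E hE φ = 0)]
    simp
  have htors (φ : (linearFormHom ev E hE).ker) (x : A) : m • ev (φ : D) x = 0 := by
    have h : m • x ∈ E.range := by
      rw [← QuotientAddGroup.eq_zero_iff, QuotientAddGroup.mk_nsmul]
      exact card_nsmul_eq_zero'
    obtain ⟨v, hv⟩ := h
    rw [← map_nsmul, ← hv, hker]
  refine Finite.of_injective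
    (β := Q → {u : AddCircle (1 : ℝ) | m • u = 0})
    (fun φ q => ⟨ev (φ : D) q.out, htors φ _⟩) fun φ ψ h => ?_
  refine Subtype.ext (ev.injective (ContinuousAddMonoidHom.ext fun x => ?_))
  have h1 : ev (φ : D) (x : Q).out = ev (ψ : D) (x : Q).out :=
    congrArg Subtype.val (congrFun h (x : Q))
  obtain ⟨⟨_, v, rfl⟩, hz⟩ := QuotientAddGroup.mk_out_eq_add E.range x
  change (x : Q).out = x + E v at hz
  rw [hz, map_add, map_add, hker, hker, add_zero, add_zero] at h1
  exact h1

variable (Λ : Submodule ℤ V)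

theorem linearFormHom_int (hΛ : ∀ v, E v = 0 ↔ v ∈ Λ) (φ : D) (v : Λ) :
    ∃ n : ℤ, (n : ℝ) = linearFormHom ev E hE φ v := by
  have := coe_linearFormHom ev E hE φ v
  rw [(hΛ v).2 v.2, map_zero, AddCircle.coe_eq_zero_iff] at this
  obtain ⟨n, hn⟩ := this
  exact ⟨n, by simpa using hn⟩

variable [FiniteDimensional ℝ V]

theorem exists_linearFormHom_eq_nsmul (hΛ : ∀ v, E v = 0 ↔ v ∈ Λ)
    [IsTopologicalAddGroup A] [Finite (A ⧸ E.range)]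
    (hopen : nhds 0 ≤ (nhds (0 : V)).map E)
    (l : V →ₗ[ℝ] ℝ) (hl : ∀ v ∈ Λ, ∃ n : ℤ, (n : ℝ) = l v) :
    ∃ φ, linearFormHom ev E hE φ = Nat.card (A ⧸ E.range) • l := by
  set m := Nat.card (A ⧸ E.range)
  have h (x : A) : ∃ v, E v = m • x := by
    change m • x ∈ E.range
    rw [← QuotientAddGroup.eq_zero_iff, QuotientAddGroup.mk_nsmul]
    exact card_nsmul_eq_zero'
  choose s hs using h
  have key (v w : V) (h : E v = E w) : ((l v : ℝ) : AddCircle (1 : ℝ)) = (l w : ℝ) := by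
    rw [← sub_eq_zero, ← AddCircle.coe_sub, ← map_sub]
    obtain ⟨n, hn⟩ := hl (v - w) ((hΛ _).1 (by rw [map_sub, h, sub_self]))
    rw [← hn, AddCircle.coe_eq_zero_iff]
    exact ⟨n, by simp⟩
  let f : A →+ AddCircle (1 : ℝ) := AddMonoidHom.mk' (fun x => ((l (s x) : ℝ) : AddCircle (1 : ℝ)))
    fun x y => by
      rw [← AddCircle.coe_add, ← map_add]
      exact key _ _ (by rw [map_add, hs, hs, hs, smul_add])
  have hfE (v : V) : f (E v) = ((l (m • v) : ℝ) : AddCircle (1 : ℝ)) :=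
    key _ _ (by rw [hs, map_nsmul])
  have hf : Continuous f := by
    refine continuous_of_continuousAt_zero f ?_
    change Filter.Tendsto f (nhds 0) (nhds (f 0))
    refine Filter.Tendsto.mono_left ?_ hopen
    rw [Filter.tendsto_map'_iff, map_zero]
    have hc : Continuous fun v : V => ((l (m • v) : ℝ) : AddCircle (1 : ℝ)) :=
      (AddCircle.continuous_mk' 1).comp
        (l.continuous_of_finiteDimensional.comp (continuous_const_smul m))
    refine (hc.tendsto' 0 0 (by simp)).congr fun v => (hfE v).symm
  refine ⟨ev.symm ⟨f, hf⟩, linearForm_eq ev E hE _ _ fun v => ?_⟩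
  rw [ev.apply_symm_apply, LinearMap.smul_apply, ← map_nsmul]
  exact (hfE v).symm

variable [DiscreteTopology Λ] [IsZLattice ℝ Λ]

theorem finite_and_finrank_le (ev : D ≃+ ContinuousAddMonoidHom A (AddCircle (1 : ℝ)))
    (hE : Continuous E) (hΛ : ∀ v, E v = 0 ↔ v ∈ Λ) [Finite (A ⧸ E.range)] :
    Module.Finite ℤ D ∧ Module.finrank ℤ D ≤ Module.finrank ℝ V := by
  have := ZLattice.module_finite ℝ Λ
  have := ZLattice.module_free ℝ Λ
  let b := Module.Free.chooseBasis ℤ Λ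
  let B := b.ofZLatticeBasis ℝ Λ
  choose n hn using linearFormHom_int ev E hE Λ hΛ
  let Φ : D →ₗ[ℤ] (Module.Free.ChooseBasisIndex ℤ Λ → ℤ) := AddMonoidHom.toIntLinearMap
    (AddMonoidHom.mk' (fun φ i => n φ (b i)) fun φ ψ => funext fun i => by
      refine Int.cast_injective (α := ℝ) ?_
      rw [Pi.add_apply, Int.cast_add, hn, hn, hn, map_add]
      rfl)
  have hker : LinearMap.ker Φ = AddSubgroup.toIntSubmodule (linearFormHom ev E hE).ker := by
    refine Submodule.ext fun φ => ?_
    change Φ φ = 0 ↔ linearFormHom ev E hE φ = 0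
    have h1 (i) : ((Φ φ i : ℤ) : ℝ) = linearFormHom ev E hE φ (B i) := by
      rw [show B i = b i from b.ofZLatticeBasis_apply ℝ Λ i]
      exact hn φ (b i)
    constructor
    · intro h
      refine B.ext fun i => ?_
      rw [← h1, h]
      simp
    · intro h
      refine funext fun i => Int.cast_injective (α := ℝ) ?_
      rw [h1, h]
      simp
  have hfk := finite_ker_linearFormHom ev E hE
  have : Finite (LinearMap.ker Φ) := by rw [hker]; exact hfk
  have : Module.Finite ℤ D :=
    have : Module.Finite ℤ (D ⧸ LinearMap.ker Φ) := Module.Finite.equiv Φ.quotKerEquivRange.symm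
    Module.Finite.of_submodule_quotient (LinearMap.ker Φ)
  refine ⟨this, ?_⟩
  have htors : Module.IsTorsion ℤ (LinearMap.ker Φ) := fun x =>
    ⟨⟨(Nat.card (LinearMap.ker Φ) : ℤ), mem_nonZeroDivisors_of_ne_zero
      (Int.natCast_ne_zero.2 Nat.card_pos.ne')⟩, by
      change (Nat.card (LinearMap.ker Φ) : ℤ) • x = 0
      rw [natCast_zsmul, card_nsmul_eq_zero']⟩
  rw [← Submodule.finrank_quotient_add_finrank (LinearMap.ker Φ),
    Φ.quotKerEquivRange.finrank_eq,
    Module.finrank_eq_zero_iff_isTorsion.2 htors, add_zero]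
  refine (Submodule.finrank_le (LinearMap.range Φ)).trans_eq ?_
  rw [Module.finrank_fintype_fun_eq_card, ← ZLattice.rank ℝ Λ]
  exact (Module.finrank_eq_card_basis b).symm

theorem span_range_linearFormHom (hΛ : ∀ v, E v = 0 ↔ v ∈ Λ)
    [IsTopologicalAddGroup A] [Finite (A ⧸ E.range)]
    (hopen : nhds 0 ≤ (nhds (0 : V)).map E) :
    Submodule.span ℝ (Set.range (linearFormHom ev E hE)) = ⊤ := by
  have := ZLattice.module_finite ℝ Λ
  have := ZLattice.module_free ℝ Λ
  let b := Module.Free.chooseBasis ℤ Λ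
  let B := b.ofZLatticeBasis ℝ Λ
  classical
  rw [eq_top_iff, ← B.dualBasis.span_eq, Submodule.span_le]
  rintro _ ⟨i, rfl⟩
  obtain ⟨φ, hφ⟩ := exists_linearFormHom_eq_nsmul ev E hE Λ hΛ hopen (B.dualBasis i) fun v hv =>
    ⟨b.repr ⟨v, hv⟩ i, by
      rw [Module.Basis.coe_dualBasis, Module.Basis.coord_apply]
      exact (b.ofZLatticeBasis_repr_apply ℝ Λ ⟨v, hv⟩ i).symm⟩
  have hm : ((Nat.card (A ⧸ E.range) : ℕ) : ℝ) ≠ 0 := Nat.cast_ne_zero.2 Nat.card_pos.ne'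
  have : B.dualBasis i = ((Nat.card (A ⧸ E.range) : ℕ) : ℝ)⁻¹ • linearFormHom ev E hE φ := by
    rw [hφ, ← Nat.cast_smul_eq_nsmul ℝ, inv_smul_smul₀ hm]
  rw [this]
  exact Submodule.smul_mem _ _ (Submodule.subset_span ⟨φ, rfl⟩)

/-- The character of the dual of a compact group whose identity component is the quotient of a
real vector space by a lattice. -/
theorem ch_dual (hE : Continuous E) (hΛ : ∀ v, E v = 0 ↔ v ∈ Λ)
    [IsTopologicalAddGroup A] [Finite (A ⧸ E.range)]
    (hopen : nhds 0 ≤ (nhds (0 : V)).map E) {G : Type} [Group G] (ρ : Representation ℤ G D)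
    (g : G) (T : V →ₗ[ℝ] V) (hT : ∀ φ v, ev (ρ g φ) (E v) = ev φ (E (T v))) :
    ((ch ρ g : ℚ) : ℝ) = LinearMap.trace ℝ V T := by
  obtain ⟨_, hrank⟩ := finite_and_finrank_le E Λ ev hE hΛ
  rw [← LinearMap.trace_transpose' T]
  refine ch_cast_eq_trace ρ g (linearFormHom ev E hE) _ (fun φ => ?_)
    (span_range_linearFormHom ev E hE Λ hΛ hopen) (by rwa [Subspace.dual_finrank_eq])
  refine linearForm_eq ev E hE _ _ fun v => ?_
  rw [hT]
  exact coe_linearFormHom ev E hE φ (T v)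

end Dual

section Algebra

variable (F : Type) [Field F] [NumberField F]

/-- The canonical map from `F_ℝ` to the mixed space. -/
noncomputable def toMixedHom : FReal F →ₐ[ℝ] mixedEmbedding.mixedSpace F :=
  Algebra.TensorProduct.lift (Algebra.ofId ℝ _) (mixedEmbedding F).toRatAlgHom
    fun _ _ => Commute.all _ _

theorem toMixedHom_tmul (r : ℝ) (a : F) :
    toMixedHom F (r ⊗ₜ a) = r • mixedEmbedding F a := by
  rw [toMixedHom, Algebra.TensorProduct.lift_tmul, Algebra.smul_def]
  rfl

theorem toMixedHom_bijective : Function.Bijective (toMixedHom F) := by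
  have surj : Function.Surjective (toMixedHom F).toLinearMap := by
    rw [← LinearMap.range_eq_top, eq_top_iff, ← (mixedEmbedding.latticeBasis F).span_eq,
      Submodule.span_le]
    rintro _ ⟨i, rfl⟩
    exact ⟨1 ⊗ₜ integralBasis F i, by
      rw [AlgHom.toLinearMap_apply, toMixedHom_tmul, one_smul, mixedEmbedding.latticeBasis_apply]⟩
  have hd : Module.finrank ℝ (FReal F) = Module.finrank ℝ (mixedEmbedding.mixedSpace F) := by
    rw [mixedEmbedding.finrank, Module.finrank_baseChange]
  exact ⟨(LinearMap.injective_iff_surjective_of_finrank_eq_finrank hd).2 surj, surj⟩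

/-- The identification of `F_ℝ` with the mixed space. -/
noncomputable def toMixed : FReal F ≃ₐ[ℝ] mixedEmbedding.mixedSpace F :=
  AlgEquiv.ofBijective (toMixedHom F) (toMixedHom_bijective F)

theorem toMixed_tmul (r : ℝ) (a : F) : toMixed F (r ⊗ₜ a) = r • mixedEmbedding F a :=
  toMixedHom_tmul F r a

theorem continuous_toMixed : Continuous (toMixed F) := by
  let l : (Fin (Module.finrank ℝ (FReal F)) → ℝ) →ₗ[ℝ] mixedEmbedding.mixedSpace F :=
    (toMixed F).toLinearMap ∘ₗ (Module.finBasis ℝ (FReal F)).equivFun.symm.toLinearMap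
  refine (l.continuous_of_finiteDimensional.comp
    (continuous_induced_dom (f := (Module.finBasis ℝ (FReal F)).equivFun))).congr fun x => ?_
  simp [l]

theorem continuous_toMixed_symm : Continuous (toMixed F).symm := by
  let l : mixedEmbedding.mixedSpace F →ₗ[ℝ] (Fin (Module.finrank ℝ (FReal F)) → ℝ) :=
    (Module.finBasis ℝ (FReal F)).equivFun.toLinearMap ∘ₗ (toMixed F).symm.toLinearMap
  exact continuous_induced_rng.2 l.continuous_of_finiteDimensional

instance continuousMul_FReal : ContinuousMul (FReal F) where
  continuous_mul := by
    have h : Continuous fun p : FReal F × FReal F =>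
        (toMixed F).symm (toMixed F p.1 * toMixed F p.2) :=
      (continuous_toMixed_symm F).comp (((continuous_toMixed F).comp continuous_fst).mul
        ((continuous_toMixed F).comp continuous_snd))
    refine h.congr fun p => ?_
    rw [← map_mul, AlgEquiv.symm_apply_apply]

end Algebra

section Norm

theorem norm_pi {ι S : Type} [Fintype ι] [CommRing S] [Algebra ℝ S] [FiniteDimensional ℝ S]
    (x : ι → S) : Algebra.norm ℝ x = ∏ i, Algebra.norm ℝ (x i) := by
  classical
  simp only [Algebra.norm_apply]
  rw [← LinearMap.det_pi]
  rfl

theorem norm_prod {S T : Type} [CommRing S] [Algebra ℝ S] [FiniteDimensional ℝ S]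
    [CommRing T] [Algebra ℝ T] [FiniteDimensional ℝ T] (x : S × T) :
    Algebra.norm ℝ x = Algebra.norm ℝ x.1 * Algebra.norm ℝ x.2 := by
  simp only [Algebra.norm_apply]
  rw [← LinearMap.det_prodMap]
  rfl

variable {F : Type} [Field F] [NumberField F]

theorem abs_norm_mixedSpace (x : mixedEmbedding.mixedSpace F) :
    |Algebra.norm ℝ x| = mixedEmbedding.norm x := by
  classical
  rw [norm_prod, norm_pi, norm_pi, mixedEmbedding.norm_apply, abs_mul, Finset.abs_prod,
    Finset.abs_prod, InfinitePlace.prod_eq_prod_mul_prod]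
  congr 1
  · refine Finset.prod_congr (by congr) fun w _ => ?_
    rw [mixedEmbedding.normAtPlace_apply_of_isReal w.2, InfinitePlace.mult_isReal, pow_one,
      Algebra.norm_self, Real.norm_eq_abs]
    rfl
  · refine Finset.prod_congr (by congr) fun w _ => ?_
    rw [mixedEmbedding.normAtPlace_apply_of_isComplex w.2, InfinitePlace.mult_isComplex,
      Algebra.norm_complex_apply, Complex.sq_norm, abs_of_nonneg (Complex.normSq_nonneg _)]

theorem abs_norm_FReal (x : FReal F) :
    |Algebra.norm ℝ x| = mixedEmbedding.norm (toMixed F x) := by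
  rw [← abs_norm_mixedSpace, Algebra.norm_eq_of_algEquiv]

end Norm

section Exponential

open mixedEmbedding InfinitePlace

variable {F : Type} [Field F]

/-- The exponential map of the mixed space. -/
noncomputable def mexp (x : mixedSpace F) : mixedSpace F :=
  (fun w => Real.exp (x.1 w), fun w => Complex.exp (x.2 w))

/-- A logarithm on the mixed space. -/
noncomputable def mlog (x : mixedSpace F) : mixedSpace F :=
  (fun w => Real.log (x.1 w), fun w => Complex.log (x.2 w))

theorem mexp_zero : mexp (0 : mixedSpace F) = 1 := by
  ext <;> simp [mexp]

theorem mexp_add (x y : mixedSpace F) : mexp (x + y) = mexp x * mexp y := by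
  ext <;> simp [mexp, Real.exp_add, Complex.exp_add]

theorem mexp_mul_mexp_neg (x : mixedSpace F) : mexp x * mexp (-x) = 1 := by
  rw [← mexp_add, add_neg_cancel, mexp_zero]

theorem continuous_mexp : Continuous (mexp : mixedSpace F → mixedSpace F) := by
  unfold mexp
  fun_prop

theorem mlog_one : mlog (1 : mixedSpace F) = 0 := by
  ext <;> simp [mlog]

theorem continuousAt_mlog : ContinuousAt (mlog : mixedSpace F → mixedSpace F) 1 := by
  refine ContinuousAt.prodMk (continuousAt_pi.2 fun w => ?_) (continuousAt_pi.2 fun w => ?_)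
  · exact ContinuousAt.log (by fun_prop) (by simp)
  · exact ContinuousAt.clog (by fun_prop) (by simp [Complex.slitPlane])

theorem mexp_mlog (x : mixedSpace F) (h1 : ∀ w, 0 < x.1 w) (h2 : ∀ w, x.2 w ≠ 0) :
    mexp (mlog x) = x := by
  ext w
  · exact Real.exp_log (h1 w)
  · exact Complex.exp_log (h2 w)

open Classical in
/-- The real parts of the components of an element of the mixed space. -/
noncomputable def rePart : mixedSpace F →ₗ[ℝ] (InfinitePlace F → ℝ) where
  toFun x w := if h : IsReal w then x.1 ⟨w, h⟩ else (x.2 ⟨w, not_isReal_iff_isComplex.1 h⟩).re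
  map_add' x y := by
    funext w
    simp only [Pi.add_apply]
    split_ifs <;> simp
  map_smul' r x := by
    funext w
    simp only [Pi.smul_apply]
    split_ifs <;> simp

theorem rePart_real (x : mixedSpace F) (w : {w : InfinitePlace F // IsReal w}) :
    rePart x w = x.1 w := dif_pos w.2

theorem rePart_complex (x : mixedSpace F) (w : {w : InfinitePlace F // IsComplex w}) :
    rePart x w = (x.2 w).re := dif_neg (not_isReal_iff_isComplex.2 w.2)

theorem normAtPlace_mexp (x : mixedSpace F) (w : InfinitePlace F) :
    normAtPlace w (mexp x) = Real.exp (rePart x w) := by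
  by_cases h : IsReal w
  · rw [normAtPlace_apply_of_isReal h, rePart_real x ⟨w, h⟩]
    exact abs_of_pos (Real.exp_pos _)
  · rw [normAtPlace_apply_of_isComplex (not_isReal_iff_isComplex.1 h),
      rePart_complex x ⟨w, not_isReal_iff_isComplex.1 h⟩]
    exact Complex.norm_exp _

theorem rePart_mixedSpaceOfRealSpace (t : InfinitePlace F → ℝ) :
    rePart (mixedSpaceOfRealSpace t) = t := by
  funext w
  by_cases h : IsReal w
  · rw [rePart_real _ ⟨w, h⟩]
    rfl
  · rw [rePart_complex _ ⟨w, not_isReal_iff_isComplex.1 h⟩]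
    rfl

theorem eq_zero_of_mexp_eq_one (x : mixedSpace F) (h : mexp x = 1)
    (hx : ∀ w, normAtPlace w x < 1) : x = 0 := by
  have h1 (w) : Real.exp (x.1 w) = 1 := congrFun (congrArg Prod.fst h) w
  have h2 (w) : Complex.exp (x.2 w) = 1 := congrFun (congrArg Prod.snd h) w
  ext w
  · exact Real.exp_eq_one_iff _ |>.1 (h1 w)
  · change x.2 w = 0
    obtain ⟨n, hn⟩ := Complex.exp_eq_one_iff.1 (h2 w)
    have hle : ‖x.2 w‖ < 1 := by
      have := hx w
      rwa [normAtPlace_apply_of_isComplex w.2] at this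
    by_cases h0 : n = 0
    · rw [hn, h0]
      simp
    · exfalso
      rw [hn] at hle
      simp only [Complex.norm_mul, Complex.norm_intCast, Complex.norm_ofNat, Complex.norm_real,
        Real.norm_eq_abs, Complex.norm_I, mul_one, abs_of_pos Real.pi_pos] at hle
      have : (1 : ℝ) ≤ |(n : ℝ)| := by exact_mod_cast Int.one_le_abs h0
      nlinarith [Real.pi_gt_three]

variable [NumberField F]

theorem mexp_eq_exp (x : mixedSpace F) : mexp x = NormedSpace.exp x := by
  classical
  ext w
  · rw [Prod.fst_exp, Pi.coe_exp, mexp, Real.exp_eq_exp_ℝ]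
  · rw [Prod.snd_exp, Pi.coe_exp, mexp, Complex.exp_eq_exp_ℂ]

theorem map_mexp (τ : mixedSpace F ≃ₐ[ℝ] mixedSpace F) (x : mixedSpace F) :
    τ (mexp x) = mexp (τ x) := by
  classical
  rw [mexp_eq_exp, mexp_eq_exp]
  exact NormedSpace.map_exp τ τ.toLinearMap.continuous_of_finiteDimensional x

variable (F) in
/-- The weighted sum of the components, the logarithm of the norm of the exponential. -/
noncomputable def weightedSum : (InfinitePlace F → ℝ) →ₗ[ℝ] ℝ :=
  ∑ w : InfinitePlace F, (mult w : ℝ) • LinearMap.proj w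

theorem weightedSum_apply (t : InfinitePlace F → ℝ) : weightedSum F t = ∑ w, mult w * t w := by
  simp [weightedSum]

theorem norm_mexp (x : mixedSpace F) :
    mixedEmbedding.norm (mexp x) = Real.exp (weightedSum F (rePart x)) := by
  rw [mixedEmbedding.norm_apply, weightedSum_apply, Real.exp_sum]
  refine Finset.prod_congr rfl fun w _ => ?_
  rw [normAtPlace_mexp, ← Real.exp_nat_mul]

end Exponential

section Galois

open mixedEmbedding InfinitePlace

variable {F : Type} [Field F] [NumberField F]
  (K : Type) [Field K] [CharZero K] [Algebra K F]

/-- The Galois action on `F_ℝ`, as real algebra automorphisms. -/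
noncomputable def galR (g : F ≃ₐ[K] F) : FReal F ≃ₐ[ℝ] FReal F :=
  Algebra.TensorProduct.congr AlgEquiv.refl (g.restrictScalars ℚ)

theorem galR_apply (g : F ≃ₐ[K] F) (x : FReal F) : galR K g x = galFReal K g x := rfl

/-- The Galois action on the mixed space. -/
noncomputable def galMixed (g : F ≃ₐ[K] F) : mixedSpace F ≃ₐ[ℝ] mixedSpace F :=
  ((toMixed F).symm.trans (galR K g)).trans (toMixed F)

theorem toMixed_galFReal (g : F ≃ₐ[K] F) (x : FReal F) :
    toMixed F (galFReal K g x) = galMixed K g (toMixed F x) := by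
  rw [galMixed, AlgEquiv.trans_apply, AlgEquiv.trans_apply, AlgEquiv.symm_apply_apply, galR_apply]

/-- The real algebra map from `F_ℝ` to the complex numbers given by a complex embedding. -/
noncomputable def evalAt (φ : F →+* ℂ) : FReal F →ₐ[ℝ] ℂ :=
  Algebra.TensorProduct.lift (Algebra.ofId ℝ ℂ) φ.toRatAlgHom fun _ _ => Commute.all _ _

theorem evalAt_tmul (φ : F →+* ℂ) (r : ℝ) (a : F) : evalAt φ (r ⊗ₜ a) = r * φ a :=
  Algebra.TensorProduct.lift_tmul _ _ _ _ _

theorem norm_evalAt (w : InfinitePlace F) (x : FReal F) :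
    ‖evalAt w.embedding x‖ = normAtPlace w (toMixed F x) := by
  by_cases h : IsReal w
  · rw [normAtPlace_apply_of_isReal h]
    have : evalAt w.embedding = ((Algebra.ofId ℝ ℂ).comp ((Pi.evalAlgHom ℝ _
        (⟨w, h⟩ : {w // IsReal w})).comp (AlgHom.fst ℝ _ _))).comp (toMixed F).toAlgHom := by
      refine Algebra.TensorProduct.ext (by ext) ?_
      ext a
      change evalAt w.embedding (1 ⊗ₜ a) = (((toMixed F (1 ⊗ₜ a)).1 ⟨w, h⟩ : ℝ) : ℂ)
      rw [evalAt_tmul, toMixed_tmul, one_smul, Complex.ofReal_one, one_mul]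
      exact (embedding_of_isReal_apply h a).symm
    rw [this]
    exact Complex.norm_real _
  · have h := not_isReal_iff_isComplex.1 h
    rw [normAtPlace_apply_of_isComplex h]
    have : evalAt w.embedding = ((Pi.evalAlgHom ℝ _
        (⟨w, h⟩ : {w // IsComplex w})).comp (AlgHom.snd ℝ _ _)).comp (toMixed F).toAlgHom := by
      refine Algebra.TensorProduct.ext (by ext) ?_
      ext a
      change evalAt w.embedding (1 ⊗ₜ a) = (toMixed F (1 ⊗ₜ a)).2 ⟨w, h⟩
      rw [evalAt_tmul, toMixed_tmul, one_smul, Complex.ofReal_one, one_mul]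
      rfl
    rw [this]
    rfl

theorem evalAt_galFReal (g : F ≃ₐ[K] F) (φ : F →+* ℂ) (x : FReal F) :
    evalAt φ (galFReal K g x) = evalAt (φ.comp (g : F →+* F)) x := by
  induction x using TensorProduct.induction_on with
  | zero => simp only [map_zero]
  | add x y hx hy => rw [map_add, map_add, map_add, hx, hy]
  | tmul r a =>
    change evalAt φ (r ⊗ₜ g a) = _
    rw [evalAt_tmul, evalAt_tmul]
    rfl

theorem evalAt_conjugate (φ : F →+* ℂ) (x : FReal F) :
    evalAt (ComplexEmbedding.conjugate φ) x = (starRingEnd ℂ) (evalAt φ x) := by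
  induction x using TensorProduct.induction_on with
  | zero => simp only [map_zero]
  | add x y hx hy => rw [map_add, map_add, map_add, hx, hy]
  | tmul r a =>
    rw [evalAt_tmul, evalAt_tmul, map_mul, Complex.conj_ofReal]
    rfl

theorem normAtPlace_galMixed (g : F ≃ₐ[K] F) (w : InfinitePlace F) (x : mixedSpace F) :
    normAtPlace w (galMixed K g x) = normAtPlace (g⁻¹ • w) x := by
  obtain ⟨x, rfl⟩ := (toMixed F).surjective x
  rw [← toMixed_galFReal, ← norm_evalAt, ← norm_evalAt, evalAt_galFReal]
  have h : InfinitePlace.mk (g⁻¹ • w).embedding =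
      InfinitePlace.mk (w.embedding.comp (g : F →+* F)) := by
    rw [mk_embedding]
    conv_lhs => rw [← mk_embedding w]
    rw [smul_mk]
    rfl
  rcases mk_eq_iff.1 h with h | h
  · rw [h]
  · rw [← h, evalAt_conjugate, RCLike.norm_conj]

end Galois

section Lattices

open mixedEmbedding InfinitePlace Units Units.dirichletUnitTheorem
open scoped Classical

variable (F : Type) [Field F] [NumberField F]

/-- The hyperplane of elements of the mixed space whose exponential has norm `1`. -/
noncomputable abbrev nullSpace : Submodule ℝ (mixedSpace F) :=
  LinearMap.ker ((weightedSum F).comp rePart)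

/-- The hyperplane of real vectors indexed by the places with weighted sum `0`. -/
noncomputable abbrev sumZero : Submodule ℝ (InfinitePlace F → ℝ) :=
  LinearMap.ker (weightedSum F)

/-- The weighted projection onto the logarithmic space. -/
noncomputable def toLogSpace : (InfinitePlace F → ℝ) →ₗ[ℝ] logSpace F :=
  LinearMap.pi fun w => (mult w.1 : ℝ) • LinearMap.proj w.1

variable {F}

theorem toLogSpace_apply (t : InfinitePlace F → ℝ) (w : {w : InfinitePlace F // w ≠ w₀}) :
    toLogSpace F t w = mult w.1 * t w.1 := by
  simp [toLogSpace]

theorem eq_zero_of_toLogSpace {t : InfinitePlace F → ℝ} (ht : weightedSum F t = 0)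
    (h : toLogSpace F t = 0) : t = 0 := by
  have h1 : ∀ w : InfinitePlace F, w ≠ w₀ → t w = 0 := fun w hw => by
    have := congrFun h ⟨w, hw⟩
    rw [toLogSpace_apply] at this
    exact (mul_eq_zero.1 this).resolve_left (Nat.cast_ne_zero.2 mult_ne_zero)
  have h0 : t w₀ = 0 := by
    rw [weightedSum_apply, Finset.sum_eq_single w₀ (fun w _ hw => by rw [h1 w hw, mul_zero])
      (fun h => absurd (Finset.mem_univ _) h)] at ht
    exact (mul_eq_zero.1 ht).resolve_left (Nat.cast_ne_zero.2 mult_ne_zero)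
  funext w
  by_cases hw : w = w₀
  · rw [hw, h0]
    rfl
  · exact h1 w hw

theorem exists_toLogSpace (s : logSpace F) : ∃ t, weightedSum F t = 0 ∧ toLogSpace F t = s := by
  let t : InfinitePlace F → ℝ := fun w => if h : w = w₀ then
    -(mult (w₀ : InfinitePlace F) : ℝ)⁻¹ * ∑ w, s w else (mult w : ℝ)⁻¹ * s ⟨w, h⟩
  have ht (w : {w : InfinitePlace F // w ≠ w₀}) : mult w.1 * t w.1 = s w := by
    simp only [t, dif_neg w.2]
    rw [mul_inv_cancel_left₀ (Nat.cast_ne_zero.2 mult_ne_zero)]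
  refine ⟨t, ?_, funext fun w => by rw [toLogSpace_apply, ht]⟩
  rw [weightedSum_apply, Fintype.sum_eq_add_sum_subtype_ne _ w₀]
  simp only [ht]
  simp only [t, dite_true]
  rw [neg_mul, mul_neg, mul_inv_cancel_left₀ (Nat.cast_ne_zero.2 mult_ne_zero), neg_add_cancel]

variable (F) in
/-- The weighted projection of the hyperplane of real vectors onto the logarithmic space. -/
noncomputable def sumZeroEquiv : sumZero F ≃L[ℝ] logSpace F :=
  LinearEquiv.toContinuousLinearEquiv <|
    LinearEquiv.ofBijective ((toLogSpace F).comp (sumZero F).subtype)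
      ⟨(injective_iff_map_eq_zero _).2 fun t h => Subtype.ext (eq_zero_of_toLogSpace t.2 h),
        fun s => by
          obtain ⟨t, h1, h2⟩ := exists_toLogSpace s
          exact ⟨⟨t, h1⟩, h2⟩⟩

variable (F) in
/-- The lattice of logarithmic embeddings of units in the hyperplane of real vectors. -/
noncomputable abbrev realUnits : Submodule ℤ (sumZero F) :=
  ZLattice.comap ℝ (unitLattice F) (sumZeroEquiv F).toLinearEquiv.toLinearMap

theorem weightedSum_log_unit (ε : (𝓞 F)ˣ) :
    weightedSum F (fun w => Real.log (w (ε : F))) = 0 := by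
  rw [weightedSum_apply]
  have := sum_mult_mul_log ε
  simpa using this

theorem mem_realUnits (t : sumZero F) :
    t ∈ realUnits F ↔ ∃ ε : (𝓞 F)ˣ, ∀ w, t.1 w = Real.log (w (ε : F)) := by
  have key (ε : (𝓞 F)ˣ) : logEmbedding F (Additive.ofMul ε) =
      toLogSpace F (fun w => Real.log (w (ε : F))) := by
    funext w
    rw [logEmbedding_component, toLogSpace_apply]
  change toLogSpace F t.1 ∈ unitLattice F ↔ _
  constructor
  · rintro ⟨ε, -, hε⟩
    refine ⟨ε.toMul, fun w => ?_⟩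
    have h : toLogSpace F (t.1 - fun w => Real.log (w (ε.toMul : F))) = 0 := by
      rw [map_sub, ← key, sub_eq_zero]
      exact hε.symm
    refine congrFun (sub_eq_zero.1 (eq_zero_of_toLogSpace ?_ h)) w
    rw [map_sub, weightedSum_log_unit, sub_zero]
    exact t.2
  · rintro ⟨ε, hε⟩
    refine ⟨Additive.ofMul ε, trivial, ?_⟩
    rw [funext hε, ← key]
    rfl

variable (F) in
/-- The lattice of logarithms of units in the mixed space. -/
noncomputable def mixedUnits : Submodule ℤ (nullSpace F) :=
  AddSubgroup.toIntSubmodule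
    { carrier := {v | ∃ ε : (𝓞 F)ˣ, mixedEmbedding F (ε : F) = mexp v.1}
      zero_mem' := ⟨1, by simp [mexp_zero]⟩
      add_mem' := by
        rintro v w ⟨ε, hε⟩ ⟨δ, hδ⟩
        refine ⟨ε * δ, ?_⟩
        rw [Submodule.coe_add, mexp_add, ← hε, ← hδ, ← map_mul]
        simp
      neg_mem' := by
        rintro v ⟨ε, hε⟩
        refine ⟨ε⁻¹, ?_⟩
        have h : mixedEmbedding F (ε⁻¹ : (𝓞 F)ˣ) * mixedEmbedding F (ε : (𝓞 F)ˣ) = 1 := by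
          rw [← map_mul, ← map_one (mixedEmbedding F)]
          congr 1
          exact congrArg (fun u : (𝓞 F)ˣ => (u : F)) (inv_mul_cancel ε)
        calc mixedEmbedding F (ε⁻¹ : (𝓞 F)ˣ)
          _ = mixedEmbedding F (ε⁻¹ : (𝓞 F)ˣ) * (mexp v.1 * mexp (-v.1)) := by
            rw [mexp_mul_mexp_neg, mul_one]
          _ = mexp (-v.1) := by rw [← mul_assoc, ← hε, h, one_mul] }

theorem mem_mixedUnits (v : nullSpace F) :
    v ∈ mixedUnits F ↔ ∃ ε : (𝓞 F)ˣ, mixedEmbedding F (ε : F) = mexp v.1 := Iff.rfl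

instance discreteTopology_mixedUnits : DiscreteTopology (mixedUnits F) := by
  refine discreteTopology_of_isOpen_singleton_zero ?_
  have hU : IsOpen {v : mixedUnits F | ∀ w, normAtPlace w v.1.1 < 1 ∧
      normAtPlace w (mexp v.1.1 - 1) < 1} := by
    simp only [Set.ofPred_forall, Set.ofPred_and]
    refine isOpen_iInter_of_finite fun w => IsOpen.inter ?_ ?_
    · exact isOpen_lt ((continuous_normAtPlace w).comp
        (continuous_subtype_val.comp continuous_subtype_val)) continuous_const
    · exact isOpen_lt ((continuous_normAtPlace w).comp ((continuous_mexp.comp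
        (continuous_subtype_val.comp continuous_subtype_val)).sub continuous_const))
        continuous_const
  convert hU
  ext v
  refine ⟨?_, fun hv => ?_⟩
  · rintro rfl w
    simp [mexp_zero]
  · obtain ⟨ε, hε⟩ := v.2
    have h0 : (ε : 𝓞 F) - 1 = 0 := by
      by_contra hne
      have hlt (w : InfinitePlace F) : w (((ε : 𝓞 F) - 1 : 𝓞 F) : F) < 1 := by
        rw [← normAtPlace_apply]
        have := (hv w).2
        rw [← hε] at this
        simpa using this
      exact (hlt w₀).not_ge (one_le_of_lt_one hne fun z _ => hlt z)
    have h1 : mexp v.1.1 = 1 := by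
      rw [← hε, ← map_one (mixedEmbedding F)]
      congr 1
      exact congrArg (algebraMap (𝓞 F) F) (sub_eq_zero.1 h0)
    exact Subtype.ext (Subtype.ext (eq_zero_of_mexp_eq_one _ h1 fun w => (hv w).1))

theorem mem_span_mixedUnits_of_rePart (v : nullSpace F) (hv : rePart v.1 = 0) :
    v ∈ Submodule.span ℝ (mixedUnits F : Set (nullSpace F)) := by
  let e (w : {w : InfinitePlace F // IsComplex w}) : mixedSpace F :=
    (0, Pi.single w (2 * Real.pi * Complex.I))
  have he0 (w) : rePart (e w) = 0 := by
    funext w'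
    by_cases h : IsReal w'
    · exact rePart_real _ ⟨w', h⟩
    · rw [rePart_complex _ ⟨w', not_isReal_iff_isComplex.1 h⟩]
      by_cases hw : w = ⟨w', not_isReal_iff_isComplex.1 h⟩
      · subst hw
        simp [e]
      · simp [e, Pi.single_eq_of_ne (Ne.symm hw)]
  have hmem (w) : e w ∈ nullSpace F := by
    rw [LinearMap.mem_ker, LinearMap.comp_apply, he0, map_zero]
  have hunit (w) : (⟨e w, hmem w⟩ : nullSpace F) ∈ mixedUnits F := by
    refine ⟨1, ?_⟩
    have : mexp (e w) = 1 := by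
      ext w'
      · simp [mexp, e]
      · by_cases hw : w' = w
        · subst hw
          simp [mexp, e]
        · simp [mexp, e, Pi.single_eq_of_ne hw]
    simp [this]
  have hsum : v = ∑ w, ((v.1.2 w).im / (2 * Real.pi)) • (⟨e w, hmem w⟩ : nullSpace F) := by
    apply Subtype.ext
    rw [AddSubmonoidClass.coe_finsetSum]
    ext w
    · rw [Prod.fst_sum, Finset.sum_apply, ← rePart_real, hv]
      simp [e]
    · rw [Prod.snd_sum, Finset.sum_apply, Finset.sum_eq_single w]
      · have hre := congrFun hv w.1
        rw [rePart_complex] at hre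
        have hpi : (2 * Real.pi : ℂ) ≠ 0 := by
          exact_mod_cast (mul_pos two_pos Real.pi_pos).ne'
        change v.1.2 w = _
        conv_lhs => rw [← Complex.re_add_im (v.1.2 w), hre]
        simp [e]
        field_simp
      · intro w' _ hw
        simp [e, Pi.single_eq_of_ne (Ne.symm hw)]
      · exact fun h => absurd (Finset.mem_univ _) h
  rw [hsum]
  exact Submodule.sum_mem _ fun w _ => Submodule.smul_mem _ _ (Submodule.subset_span (hunit w))

theorem exists_mixedUnits (ε : (𝓞 F)ˣ) : ∃ v ∈ mixedUnits F,
    toLogSpace F (rePart v.1) = (2 : ℝ) • logEmbedding F (Additive.ofMul ε) := by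
  have hε : (ε : F) ≠ 0 := by simp
  have hm : mexp (mlog (mixedEmbedding F ((ε ^ 2 : (𝓞 F)ˣ) : F))) =
      mixedEmbedding F ((ε ^ 2 : (𝓞 F)ˣ) : F) := by
    rw [Units.coe_pow, map_pow]
    refine mexp_mlog _ (fun w => ?_) fun w => ?_
    · change 0 < (mixedEmbedding F ε).1 w ^ 2
      rw [mixedEmbedding_apply_isReal]
      exact sq_pos_of_ne_zero ((map_ne_zero _).2 hε)
    · change (mixedEmbedding F ε).2 w ^ 2 ≠ 0
      rw [mixedEmbedding_apply_isComplex]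
      exact pow_ne_zero _ ((map_ne_zero _).2 hε)
  set x := mlog (mixedEmbedding F ((ε ^ 2 : (𝓞 F)ˣ) : F))
  have hx (w : InfinitePlace F) : rePart x w = 2 * Real.log (w (ε : F)) := by
    rw [← Real.log_exp (rePart x w), ← normAtPlace_mexp, hm, normAtPlace_apply]
    simp
  have h0 : x ∈ nullSpace F := by
    rw [LinearMap.mem_ker, LinearMap.comp_apply, ← Real.exp_eq_one_iff, ← norm_mexp, hm, norm_unit]
  refine ⟨⟨x, h0⟩, ⟨ε ^ 2, hm.symm⟩, ?_⟩
  funext w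
  rw [toLogSpace_apply, hx, Pi.smul_apply, logEmbedding_component, _root_.smul_eq_mul]
  ring

instance isZLattice_mixedUnits : IsZLattice ℝ (mixedUnits F) where
  span_top := by
    let π : nullSpace F →ₗ[ℝ] logSpace F := (toLogSpace F).comp (rePart.comp (nullSpace F).subtype)
    have hker : LinearMap.ker π ≤ Submodule.span ℝ (mixedUnits F : Set (nullSpace F)) := by
      intro v hv
      exact mem_span_mixedUnits_of_rePart v (eq_zero_of_toLogSpace v.2 hv)
    have hmap : (Submodule.span ℝ (mixedUnits F : Set (nullSpace F))).map π = ⊤ := by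
      rw [eq_top_iff, ← unitLattice_span_eq_top, Submodule.span_le]
      rintro _ ⟨ε, -, rfl⟩
      obtain ⟨v, hv, h⟩ := exists_mixedUnits ε.toMul
      refine ⟨(2 : ℝ)⁻¹ • v, Submodule.smul_mem _ _ (Submodule.subset_span hv), ?_⟩
      rw [map_smul]
      change (2 : ℝ)⁻¹ • toLogSpace F (rePart v.1) = _
      rw [h, smul_smul, inv_mul_cancel₀ two_ne_zero, one_smul]
      rfl
    rw [← sup_of_le_left hker, ← Submodule.comap_map_eq, hmap, Submodule.comap_top]

end Lattices

section Topology

variable (F : Type) [Field F] [NumberField F]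

instance discreteTopology_idealGroup : DiscreteTopology (IdealGroup F) := ⟨rfl⟩

instance isTopologicalGroup_picTilde : IsTopologicalGroup (PicTilde F) :=
  inferInstanceAs (IsTopologicalGroup (picDom F ⧸ principalSub F))

instance isTopologicalGroup_picZero : IsTopologicalGroup (PicZero F) :=
  inferInstanceAs (IsTopologicalGroup (PicTilde F ⧸ compImage F))

variable {F}

theorem mem_picDom (x : IdealGroup F × (FReal F)ˣ) : x ∈ picDom F ↔
    ((FractionalIdeal.absNorm (x.1 : FractionalIdeal (𝓞 F)⁰ F) : ℚ) : ℝ) =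
      mixedEmbedding.norm (toMixed F x.2) := by
  rw [picDom, MonoidHom.mem_ker, MonoidHom.div_apply, div_eq_one, ← Units.val_inj,
    ← abs_norm_FReal]
  rfl

/-- The exponential map of the mixed space, with values in the units of `F_ℝ`. -/
noncomputable def expUnit (v : mixedEmbedding.mixedSpace F) : (FReal F)ˣ where
  val := (toMixed F).symm (mexp v)
  inv := (toMixed F).symm (mexp (-v))
  val_inv := by rw [← map_mul, mexp_mul_mexp_neg, map_one]
  inv_val := by rw [← map_mul, mul_comm, mexp_mul_mexp_neg, map_one]

theorem toMixed_expUnit (v : mixedEmbedding.mixedSpace F) : toMixed F (expUnit v) = mexp v :=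
  (toMixed F).apply_symm_apply _

theorem units_ext {a b : (FReal F)ˣ} (h : toMixed F a = toMixed F b) : a = b :=
  Units.ext ((toMixed F).injective h)

theorem expUnit_add (v w : mixedEmbedding.mixedSpace F) :
    expUnit (v + w) = expUnit v * expUnit w :=
  units_ext (by rw [Units.val_mul, map_mul, toMixed_expUnit, toMixed_expUnit, toMixed_expUnit,
    mexp_add])

theorem continuous_expUnit : Continuous (expUnit (F := F)) :=
  Units.continuous_iff.2 ⟨(continuous_toMixed_symm F).comp continuous_mexp,
    ((continuous_toMixed_symm F).comp continuous_mexp).comp continuous_neg⟩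

theorem expUnit_mem_picDom (v : nullSpace F) : ((1, expUnit v.1) : _ × _) ∈ picDom F := by
  rw [mem_picDom, toMixed_expUnit, norm_mexp]
  have : weightedSum F (rePart v.1) = 0 := v.2
  simp [this]

/-- The class in the fibre product of the exponential of an element of the hyperplane. -/
noncomputable def expPair (v : nullSpace F) : picDom F := ⟨(1, expUnit v.1), expUnit_mem_picDom v⟩

theorem expPair_add (v w : nullSpace F) : expPair (v + w) = expPair v * expPair w :=
  Subtype.ext (Prod.ext (one_mul _).symm (expUnit_add _ _))

theorem continuous_expPair : Continuous (expPair (F := F)) :=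
  Continuous.subtype_mk (continuous_const.prodMk
    (continuous_expUnit.comp continuous_subtype_val)) _

variable (F) in
/-- The exponential map onto the identity component of the oriented Arakelov class group. -/
noncomputable def expTilde : nullSpace F →+ Additive (PicTilde F) :=
  AddMonoidHom.mk' (fun v => Additive.ofMul (PicTilde.mk F (expPair v))) fun v w => by
    rw [expPair_add]
    rfl

theorem continuous_picTildeMk : Continuous (PicTilde.mk F) := continuous_quotient_mk'

theorem continuous_expTilde : Continuous (expTilde F) :=
  continuous_picTildeMk.comp continuous_expPair

theorem picTildeMk_eq_one (x : picDom F) :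
    PicTilde.mk F x = 1 ↔ ∃ α : Fˣ, principalHom F α = x.1 :=
  (QuotientGroup.eq_one_iff x).trans Iff.rfl

theorem toMixed_principalHom (α : Fˣ) :
    toMixed F (principalHom F α).2 = mixedEmbedding F α := by
  change toMixed F (1 ⊗ₜ (α : F)) = _
  rw [toMixed_tmul, one_smul]

theorem toPrincipalIdeal_eq_one (α : Fˣ) :
    toPrincipalIdeal (𝓞 F) F α = 1 ↔ ∃ ε : (𝓞 F)ˣ, (ε : F) = α := by
  rw [toPrincipalIdeal_eq_iff, Units.val_one, ← FractionalIdeal.spanSingleton_one, eq_comm,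
    FractionalIdeal.spanSingleton_eq_spanSingleton]
  refine exists_congr fun ε => ?_
  rw [Units.smul_def, Algebra.smul_def, mul_one]

theorem expPair_principal (v : nullSpace F) : (∃ α : Fˣ, principalHom F α = (expPair v).1) ↔
    ∃ ε : (𝓞 F)ˣ, mixedEmbedding F (ε : F) = mexp v.1 := by
  constructor
  · rintro ⟨α, hα⟩
    obtain ⟨ε, hε⟩ := (toPrincipalIdeal_eq_one α).1 (congrArg Prod.fst hα)
    refine ⟨ε, ?_⟩
    rw [hε, ← toMixed_principalHom, hα]
    exact toMixed_expUnit _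
  · rintro ⟨ε, hε⟩
    let α : Fˣ := Units.map (algebraMap (𝓞 F) F).toMonoidHom ε
    refine ⟨α, Prod.ext ((toPrincipalIdeal_eq_one α).2 ⟨ε, rfl⟩) (units_ext ?_)⟩
    rw [toMixed_principalHom]
    exact hε.trans (toMixed_expUnit _).symm

theorem expTilde_eq_zero_iff (v : nullSpace F) : expTilde F v = 0 ↔ v ∈ mixedUnits F := by
  rw [mem_mixedUnits, ← expPair_principal, ← picTildeMk_eq_one]
  rfl

theorem exists_expPair (x : picDom F) (h1 : x.1.1 = 1) (hpos : ∀ w, 0 < (toMixed F x.1.2).1 w) :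
    ∃ v : nullSpace F, v.1 = mlog (toMixed F x.1.2) ∧ expPair v = x := by
  have hnorm : mixedEmbedding.norm (toMixed F x.1.2) = 1 := by
    rw [← (mem_picDom x.1).1 x.2, h1]
    simp
  have hm : mexp (mlog (toMixed F x.1.2)) = toMixed F x.1.2 := by
    refine mexp_mlog _ hpos fun w h0 => ?_
    have : mixedEmbedding.norm (toMixed F x.1.2) = 0 := by
      refine mixedEmbedding.norm_eq_zero_iff.2 ⟨w.1, ?_⟩
      rw [mixedEmbedding.normAtPlace_apply_of_isComplex w.2, h0, norm_zero]
    rw [hnorm] at this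
    exact one_ne_zero this
  have h0 : mlog (toMixed F x.1.2) ∈ nullSpace F := by
    rw [LinearMap.mem_ker, LinearMap.comp_apply, ← Real.exp_eq_one_iff, ← norm_mexp, hm, hnorm]
  refine ⟨⟨_, h0⟩, rfl, Subtype.ext (Prod.ext h1.symm (units_ext ?_))⟩
  exact (toMixed_expUnit _).trans hm

theorem nhds_one_le_map_expPair : nhds (1 : picDom F) ≤ (nhds 0).map (expPair (F := F)) := by
  intro U hU
  rw [Filter.mem_map, nhds_subtype, Filter.mem_comap] at hU
  obtain ⟨W, hW, hWU⟩ := hU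
  have hc : Continuous fun x : picDom F => toMixed F x.1.2 :=
    (continuous_toMixed F).comp (Units.continuous_val.comp
      (continuous_snd.comp continuous_subtype_val))
  have hc1 : toMixed F (1 : picDom F).1.2 = 1 := map_one _
  have hev1 : ∀ᶠ x : picDom F in nhds 1, x.1.1 = 1 :=
    ((continuous_fst.comp continuous_subtype_val).tendsto' 1 1 rfl).eventually
      ((isOpen_discrete {(1 : IdealGroup F)}).mem_nhds rfl)
  have hev2 : ∀ᶠ x : picDom F in nhds 1, ∀ w, 0 < (toMixed F x.1.2).1 w := by
    refine Filter.eventually_all.2 fun w => ?_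
    refine ContinuousAt.eventually_lt continuousAt_const
      ((continuous_apply w).comp (continuous_fst.comp hc)).continuousAt ?_
    simp only [hc1]
    exact one_pos
  have hev3 : ∀ᶠ x : picDom F in nhds 1, mlog (toMixed F x.1.2) ∈ W := by
    refine (Filter.Tendsto.comp continuousAt_mlog (hc.tendsto' 1 1 hc1)).eventually ?_
    rw [mlog_one]
    exact hW
  filter_upwards [hev1, hev2, hev3] with x h1 h2 h3
  obtain ⟨v, hv, rfl⟩ := exists_expPair x h1 h2
  exact hWU (by rw [Set.mem_preimage, hv]; exact h3)

theorem nhds_zero_le_map_expTilde : nhds 0 ≤ (nhds 0).map (expTilde F) := by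
  have h : nhds (1 : PicTilde F) = (nhds 1).map (PicTilde.mk F) :=
    QuotientGroup.nhds_eq (principalSub F) 1
  have h2 : nhds (0 : Additive (PicTilde F)) = (nhds (1 : PicTilde F)).map Additive.ofMul := 
    nhds_ofMul 1
  rw [h2, h, Filter.map_map]
  exact (Filter.map_mono nhds_one_le_map_expPair).trans (by rw [Filter.map_map]; exact le_rfl)

end Topology

section FiniteIndex

variable {F : Type} [Field F] [NumberField F]

theorem exists_toPrincipalIdeal_mul {I J : IdealGroup F}
    (h : ClassGroup.mk F I = ClassGroup.mk F J) :
    ∃ α : Fˣ, I = toPrincipalIdeal (𝓞 F) F α * J := by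
  have h1 : ClassGroup.mk F (I / J) = 1 := by rw [map_div, h, div_self']
  obtain ⟨a, ha⟩ := (ClassGroup.mk_eq_one_iff (K := F)).1 h1
  have hs : FractionalIdeal.spanSingleton (𝓞 F)⁰ a =
      ((I / J : IdealGroup F) : FractionalIdeal (𝓞 F)⁰ F) := by
    refine FractionalIdeal.coeToSubmodule_injective ?_
    dsimp only
    rw [FractionalIdeal.coe_spanSingleton, ha]
  obtain ⟨α, hα⟩ := mem_principal_ideals_iff.2 ⟨a, hs⟩
  exact ⟨α, by rw [hα, div_mul_cancel]⟩

theorem principalHom_mem_picDom (α : Fˣ) : principalHom F α ∈ picDom F := by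
  rw [mem_picDom, toMixed_principalHom, mixedEmbedding.norm_eq_norm]
  change ((FractionalIdeal.absNorm
    (toPrincipalIdeal (𝓞 F) F α : FractionalIdeal (𝓞 F)⁰ F) : ℚ) : ℝ) = _
  rw [coe_toPrincipalIdeal, FractionalIdeal.absNorm_span_singleton, Rat.cast_abs]

theorem exists_expTilde_of_sign {x y : picDom F} {J : IdealGroup F} {α β : Fˣ}
    (hx : x.1.1 = toPrincipalIdeal (𝓞 F) F α * J) (hy : y.1.1 = toPrincipalIdeal (𝓞 F) F β * J)
    (hs : ∀ w, SignType.sign ((toMixed F x.1.2 * mixedEmbedding F (α⁻¹ : Fˣ)).1 w) =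
      SignType.sign ((toMixed F y.1.2 * mixedEmbedding F (β⁻¹ : Fˣ)).1 w)) :
    ∃ v, expTilde F v = Additive.ofMul (PicTilde.mk F (x / y)) := by
  let p : picDom F := ⟨principalHom F (α / β), principalHom_mem_picDom _⟩
  have hp : PicTilde.mk F p = 1 := (picTildeMk_eq_one p).2 ⟨_, rfl⟩
  let z : picDom F := x / y / p
  have hzmul : z * p * y = x := by rw [div_mul_cancel, div_mul_cancel]
  have hz1 : z.1.1 = 1 := by
    change x.1.1 / y.1.1 / toPrincipalIdeal (𝓞 F) F (α / β) = 1
    rw [hx, hy, map_div, mul_div_mul_right_eq_div, div_self']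
  have hz2 (w) : 0 < (toMixed F z.1.2).1 w := by
    have h1 : toMixed F z.1.2 * (toMixed F y.1.2 * mixedEmbedding F (β⁻¹ : Fˣ)) =
        toMixed F x.1.2 * mixedEmbedding F (α⁻¹ : Fˣ) := by
      have h2 : toMixed F z.1.2 * mixedEmbedding F (α / β : Fˣ) * toMixed F y.1.2 =
          toMixed F x.1.2 := by
        rw [← toMixed_principalHom, ← map_mul, ← map_mul, ← hzmul]
        rfl
      have h3 : ((β⁻¹ : Fˣ) : F) = (α / β : Fˣ) * (α⁻¹ : Fˣ) := by
        rw [← Units.val_mul]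
        congr 1
        rw [div_eq_mul_inv, mul_comm α, mul_inv_cancel_right]
      rw [← h2, h3, map_mul]
      ring
    have h2 := congrFun (congrArg Prod.fst h1) w
    have h4 : (toMixed F y.1.2 * mixedEmbedding F (β⁻¹ : Fˣ)).1 w *
        (toMixed F (y.1.2⁻¹ : (FReal F)ˣ) * mixedEmbedding F (β : Fˣ)).1 w = 1 := by
      have : (toMixed F y.1.2 * mixedEmbedding F (β⁻¹ : Fˣ)) *
          (toMixed F (y.1.2⁻¹ : (FReal F)ˣ) * mixedEmbedding F (β : Fˣ)) = 1 := by
        rw [mul_mul_mul_comm, ← map_mul, ← map_mul, Units.mul_inv, Units.inv_mul, map_one,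
          map_one, one_mul]
      exact congrFun (congrArg Prod.fst this) w
    have h5 := left_ne_zero_of_mul_eq_one h4
    have h6 := congrArg SignType.sign h2
    rw [hs] at h6
    change SignType.sign ((toMixed F z.1.2).1 w *
      (toMixed F y.1.2 * mixedEmbedding F (β⁻¹ : Fˣ)).1 w) = _ at h6
    rw [sign_mul] at h6
    exact sign_eq_one_iff.1 (mul_right_cancel₀ (sign_ne_zero.2 h5) (h6.trans (one_mul _).symm))
  obtain ⟨v, -, hv⟩ := exists_expPair z hz1 hz2
  refine ⟨v, ?_⟩
  change Additive.ofMul (PicTilde.mk F (expPair v)) = _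
  rw [hv, ← div_mul_cancel (x / y) p]
  change _ = Additive.ofMul (PicTilde.mk F z * PicTilde.mk F p)
  rw [hp, mul_one]

theorem classGroup_mk_surjective (c : ClassGroup (𝓞 F)) : ∃ I, ClassGroup.mk F I = c :=
  ClassGroup.induction F (fun I => ⟨I, rfl⟩) c

instance finite_quotient_expTilde : Finite (Additive (PicTilde F) ⧸ (expTilde F).range) := by
  let J (c : ClassGroup (𝓞 F)) : IdealGroup F := (classGroup_mk_surjective c).choose
  have hJ (c) : ClassGroup.mk F (J c) = c := (classGroup_mk_surjective c).choose_spec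
  choose α hα using fun x : picDom F => exists_toPrincipalIdeal_mul (hJ (ClassGroup.mk F x.1.1)).symm
  have hsurj (q : Additive (PicTilde F) ⧸ (expTilde F).range) :
      ∃ x, QuotientAddGroup.mk (Additive.ofMul (PicTilde.mk F x)) = q := by
    obtain ⟨a, rfl⟩ := QuotientAddGroup.mk_surjective q
    obtain ⟨x, hx⟩ := QuotientGroup.mk_surjective (s := principalSub F) a.toMul
    exact ⟨x, congrArg _ hx⟩
  choose r hr using hsurj
  let f (q : Additive (PicTilde F) ⧸ (expTilde F).range) :
      ClassGroup (𝓞 F) × ({w : InfinitePlace F // w.IsReal} → SignType) :=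
    (ClassGroup.mk F (r q).1.1, fun w =>
      SignType.sign ((toMixed F (r q).1.2 * mixedEmbedding F ((α (r q))⁻¹ : Fˣ)).1 w))
  refine Finite.of_injective f fun p q h => ?_
  have h1 : ClassGroup.mk F (r p).1.1 = ClassGroup.mk F (r q).1.1 := congrArg Prod.fst h
  obtain ⟨v, hv⟩ := exists_expTilde_of_sign (hα (r p)) (by rw [h1]; exact hα (r q))
    (congrFun (congrArg Prod.snd h))
  rw [← hr p, ← hr q, eq_comm, QuotientAddGroup.eq, neg_add_eq_sub]
  exact ⟨v, hv⟩

end FiniteIndex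

section MaximalCompact

open mixedEmbedding InfinitePlace

variable (F : Type) [Field F] [NumberField F]

/-- The subgroup of units of `F_ℝ` all of whose components have absolute value `1`. -/
noncomputable def unitSphere : Subgroup (FReal F)ˣ where
  carrier := {k | ∀ w, normAtPlace w (toMixed F k) = 1}
  one_mem' w := by simp
  mul_mem' {a b} ha hb w := by rw [Units.val_mul, map_mul, map_mul, ha, hb, mul_one]
  inv_mem' {a} ha w := by
    have h : normAtPlace w (toMixed F (a⁻¹ * a : (FReal F)ˣ)) = 1 := by simp
    rwa [Units.val_mul, map_mul, map_mul, ha, mul_one] at h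

variable {F}

theorem normAtPlace_le_one_of_isCompact {H : Subgroup (FReal F)ˣ}
    (hH : IsCompact (H : Set (FReal F)ˣ)) {k : (FReal F)ˣ} (hk : k ∈ H) (w : InfinitePlace F) :
    normAtPlace w (toMixed F k) ≤ 1 := by
  have hc : Continuous fun k : (FReal F)ˣ => normAtPlace w (toMixed F k) :=
    (continuous_normAtPlace w).comp ((continuous_toMixed F).comp Units.continuous_val)
  obtain ⟨C, hC⟩ := (hH.image hc).bddAbove
  by_contra! hlt
  obtain ⟨n, hn⟩ := pow_unbounded_of_one_lt C hlt
  refine (hC ⟨k ^ n, pow_mem hk n, rfl⟩).not_gt ?_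
  simpa using hn

theorem isCompact_unitSphere : IsCompact (unitSphere F : Set (FReal F)ˣ) := by
  let C : Set (mixedSpace F) := (Set.univ.pi fun _ => Metric.sphere 0 1) ×ˢ
    (Set.univ.pi fun _ => Metric.sphere 0 1)
  have hC : IsCompact C := (isCompact_univ_pi fun _ => isCompact_sphere _ _).prod
    (isCompact_univ_pi fun _ => isCompact_sphere _ _)
  let inv (x : mixedSpace F) : mixedSpace F := (x.1, fun w => (starRingEnd ℂ) (x.2 w))
  have hinv : Continuous inv := by
    refine continuous_fst.prodMk (continuous_pi fun w => ?_)
    exact Complex.continuous_conj.comp ((continuous_apply w).comp continuous_snd)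
  have hmul (x : C) : x.1 * inv x.1 = 1 := by
    ext w
    · have : |x.1.1 w| = 1 := mem_sphere_zero_iff_norm.1 (x.2.1 w trivial)
      change x.1.1 w * x.1.1 w = 1
      rw [← abs_mul_abs_self, this, one_mul]
    · have : ‖x.1.2 w‖ = 1 := mem_sphere_zero_iff_norm.1 (x.2.2 w trivial)
      change x.1.2 w * (starRingEnd ℂ) (x.1.2 w) = 1
      rw [Complex.mul_conj, Complex.normSq_eq_norm_sq, this]
      simp
  let u (x : C) : (FReal F)ˣ :=
    ⟨(toMixed F).symm x.1, (toMixed F).symm (inv x.1), by rw [← map_mul, hmul, map_one],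
      by rw [← map_mul, mul_comm, hmul, map_one]⟩
  have hu : Continuous u := Units.continuous_iff.2
    ⟨(continuous_toMixed_symm F).comp continuous_subtype_val,
      (continuous_toMixed_symm F).comp (hinv.comp continuous_subtype_val)⟩
  have := isCompact_iff_compactSpace.1 hC
  convert isCompact_range hu
  ext k
  refine ⟨fun hk => ⟨⟨toMixed F k, fun w _ => ?_, fun w _ => ?_⟩, ?_⟩, ?_⟩
  · rw [mem_sphere_zero_iff_norm, ← hk w.1, normAtPlace_apply_of_isReal w.2]
  · rw [mem_sphere_zero_iff_norm, ← hk w.1, normAtPlace_apply_of_isComplex w.2]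
  · exact Units.ext ((toMixed F).symm_apply_apply _)
  · rintro ⟨x, rfl⟩ w
    change normAtPlace w (toMixed F ((toMixed F).symm x.1)) = 1
    rw [AlgEquiv.apply_symm_apply]
    by_cases h : IsReal w
    · rw [normAtPlace_apply_of_isReal h]
      exact mem_sphere_zero_iff_norm.1 (x.2.1 ⟨w, h⟩ trivial)
    · rw [normAtPlace_apply_of_isComplex (not_isReal_iff_isComplex.1 h)]
      exact mem_sphere_zero_iff_norm.1 (x.2.2 ⟨w, not_isReal_iff_isComplex.1 h⟩ trivial)

variable (F) in
theorem maxCompact_eq_unitSphere : maxCompact F = unitSphere F := by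
  refine le_antisymm (sSup_le fun H hH k hk w => ?_) (le_sSup isCompact_unitSphere)
  refine le_antisymm (normAtPlace_le_one_of_isCompact hH hk w) ?_
  have h1 : normAtPlace w (toMixed F k) * normAtPlace w (toMixed F (k⁻¹ : (FReal F)ˣ)) = 1 := by
    rw [← map_mul, ← map_mul, Units.mul_inv, map_one, map_one]
  have h2 := normAtPlace_le_one_of_isCompact hH (inv_mem hk) w
  nlinarith [normAtPlace_nonneg w (toMixed F k)]

end MaximalCompact

section PicZero

open mixedEmbedding InfinitePlace

variable (F : Type) [Field F] [NumberField F]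

/-- The projection from the oriented Arakelov class group to the Arakelov class group. -/
noncomputable def picProj : Additive (PicTilde F) →+ Additive (PicZero F) :=
  MonoidHom.toAdditive (QuotientGroup.mk' (compImage F))

/-- The inclusion of real vectors of weighted sum `0` in the mixed space. -/
noncomputable def realIncl : sumZero F →ₗ[ℝ] nullSpace F :=
  (((mixedSpaceOfRealSpace (K := F)).toLinearMap).comp (sumZero F).subtype).codRestrict _ fun t => by
    rw [LinearMap.mem_ker]
    change weightedSum F (rePart (mixedSpaceOfRealSpace t.1)) = 0
    rw [rePart_mixedSpaceOfRealSpace]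
    exact t.2

/-- The real part of an element of the hyperplane in the mixed space. -/
noncomputable def realPart : nullSpace F →ₗ[ℝ] sumZero F :=
  (rePart.comp (nullSpace F).subtype).codRestrict _ fun v => v.2

/-- The exponential map onto the identity component of the Arakelov class group. -/
noncomputable def expZero : sumZero F →+ Additive (PicZero F) :=
  ((picProj F).comp (expTilde F)).comp (realIncl F).toAddMonoidHom

variable {F}

theorem realPart_realIncl (t : sumZero F) : realPart F (realIncl F t) = t :=
  Subtype.ext (rePart_mixedSpaceOfRealSpace t.1)

theorem picProj_eq_zero_iff (x : picDom F) :
    picProj F (Additive.ofMul (PicTilde.mk F x)) = 0 ↔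
      ∃ α : Fˣ, (principalHom F α).1 = x.1.1 ∧
        ∀ w, w (α : F) = normAtPlace w (toMixed F x.1.2) := by
  have h0 : picProj F (Additive.ofMul (PicTilde.mk F x)) = 0 ↔ PicTilde.mk F x ∈ compImage F :=
    QuotientGroup.eq_one_iff _
  rw [h0, compImage, maxCompact_eq_unitSphere]
  constructor
  · rintro ⟨y, ⟨hy1, hy2⟩, hy⟩
    obtain ⟨α, hα⟩ := QuotientGroup.eq.1 hy
    have hx : y.1 * principalHom F α = x.1 := by
      rw [hα]
      exact mul_inv_cancel_left _ _
    refine ⟨α, ?_, fun w => ?_⟩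
    · rw [← hx, Prod.fst_mul, show y.1.1 = 1 from hy1, one_mul]
    · rw [← hx, Prod.snd_mul, Units.val_mul, map_mul, map_mul, toMixed_principalHom,
        normAtPlace_apply, show normAtPlace w (toMixed F y.1.2) = 1 from hy2 w, one_mul]
  · rintro ⟨α, h1, h2⟩
    let p : picDom F := ⟨principalHom F α, principalHom_mem_picDom α⟩
    have hx : x / p * p = x := div_mul_cancel _ _
    refine ⟨x / p, ⟨?_, fun w => ?_⟩, ?_⟩
    · change x.1.1 / (principalHom F α).1 = 1
      rw [h1, div_self']
    · have h3 : normAtPlace w (toMixed F (x / p).1.2) * w (α : F) =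
          normAtPlace w (toMixed F x.1.2) := by
        rw [← normAtPlace_apply, ← toMixed_principalHom, ← map_mul, ← map_mul]
        conv_rhs => rw [← hx]
        rfl
      refine mul_right_cancel₀ (b := w (α : F)) ((map_ne_zero _).2 α.ne_zero) ?_
      rw [one_mul, h2, ← h2]
      exact h3.trans (h2 w).symm
    · exact QuotientGroup.eq.2 ⟨α, congrArg Subtype.val (eq_inv_mul_of_mul_eq hx : p = (x / p)⁻¹ * x)⟩

theorem picProj_expTilde_eq_zero_iff (v : nullSpace F) : picProj F (expTilde F v) = 0 ↔
    ∃ ε : (𝓞 F)ˣ, ∀ w, (realPart F v).1 w = Real.log (w (ε : F)) := by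
  refine (picProj_eq_zero_iff (expPair v)).trans ?_
  have h (w : InfinitePlace F) : normAtPlace w (toMixed F (expPair v).1.2) =
      Real.exp ((realPart F v).1 w) := by
    exact (congrArg _ (toMixed_expUnit v.1)).trans (normAtPlace_mexp v.1 w)
  simp only [h]
  constructor
  · rintro ⟨α, h1, h2⟩
    obtain ⟨ε, hε⟩ := (toPrincipalIdeal_eq_one α).1 h1
    exact ⟨ε, fun w => by rw [hε, h2, Real.log_exp]⟩
  · rintro ⟨ε, hε⟩
    refine ⟨Units.map (algebraMap (𝓞 F) F).toMonoidHom ε,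
      (toPrincipalIdeal_eq_one _).2 ⟨ε, rfl⟩, fun w => ?_⟩
    rw [hε, Real.exp_log (pos_iff.2 (by simp))]
    rfl

theorem picProj_expTilde (v : nullSpace F) :
    picProj F (expTilde F v) = expZero F (realPart F v) := by
  have h : picProj F (expTilde F (v - realIncl F (realPart F v))) = 0 := by
    rw [picProj_expTilde_eq_zero_iff]
    exact ⟨1, fun w => by simp [realPart_realIncl]⟩
  rw [map_sub, map_sub, sub_eq_zero] at h
  exact h

theorem expZero_eq_zero_iff (t : sumZero F) : expZero F t = 0 ↔ t ∈ realUnits F := by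
  rw [mem_realUnits]
  refine (picProj_expTilde_eq_zero_iff (realIncl F t)).trans ?_
  rw [realPart_realIncl]

theorem continuous_picProj : Continuous (picProj F) := continuous_quotient_mk'

theorem continuous_expZero : Continuous (expZero F) :=
  continuous_picProj.comp (continuous_expTilde.comp
    (realIncl F).continuous_of_finiteDimensional)

theorem nhds_zero_le_map_expZero : nhds 0 ≤ (nhds 0).map (expZero F) := by
  have h : nhds (0 : Additive (PicZero F)) = (nhds 0).map (picProj F) :=
    QuotientGroup.nhds_eq (compImage F) 1
  have hc : Filter.Tendsto (realPart F) (nhds 0) (nhds 0) :=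
    (realPart F).continuous_of_finiteDimensional.tendsto' 0 0 (map_zero _)
  calc nhds 0
    _ ≤ ((nhds 0).map (expTilde F)).map (picProj F) :=
      h.le.trans (Filter.map_mono nhds_zero_le_map_expTilde)
    _ = ((nhds 0).map (realPart F)).map (expZero F) := by
      rw [Filter.map_map, Filter.map_map]
      exact congrArg (fun f => Filter.map f _) (funext picProj_expTilde)
    _ ≤ (nhds 0).map (expZero F) := Filter.map_mono hc

instance finite_quotient_expZero : Finite (Additive (PicZero F) ⧸ (expZero F).range) := by
  refine Finite.of_surjective (QuotientAddGroup.map (expTilde F).range (expZero F).range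
    (picProj F) ?_) ?_
  · rintro _ ⟨v, rfl⟩
    exact ⟨realPart F v, (picProj_expTilde v).symm⟩
  · refine QuotientAddGroup.map_surjective_of_surjective _ _ _ ?_ _
    exact (QuotientAddGroup.mk_surjective).comp (QuotientGroup.mk'_surjective (compImage F))

end PicZero

section PlaceAction

open mixedEmbedding InfinitePlace

variable {F : Type} [Field F] [NumberField F] (K : Type) [Field K] [CharZero K] [Algebra K F]

theorem rePart_galMixed (g : F ≃ₐ[K] F) (x : mixedSpace F) (w : InfinitePlace F) :
    rePart (galMixed K g x) w = rePart x (g⁻¹ • w) := by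
  refine Real.exp_injective ?_
  rw [← normAtPlace_mexp, ← normAtPlace_mexp, ← map_mexp, normAtPlace_galMixed]

theorem mult_smul {F K : Type} [Field F] [Field K] [Algebra K F] (g : F ≃ₐ[K] F)
    (w : InfinitePlace F) : (g • w).mult = w.mult := by
  simp only [mult]
  congr 1
  exact propext isReal_smul_iff

variable {K}

/-- The permutation of the real vectors indexed by the places. -/
noncomputable def permPlaces (g : F ≃ₐ[K] F) :
    (InfinitePlace F → ℝ) →ₗ[ℝ] (InfinitePlace F → ℝ) :=
  LinearMap.funLeft ℝ ℝ fun w => g⁻¹ • w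

theorem permPlaces_apply {F K : Type} [Field F] [Field K] [Algebra K F] (g : F ≃ₐ[K] F)
    (t : InfinitePlace F → ℝ) (w : InfinitePlace F) :
    permPlaces g t w = t (g⁻¹ • w) := rfl

theorem weightedSum_permPlaces (g : F ≃ₐ[K] F) (t : InfinitePlace F → ℝ) :
    weightedSum F (permPlaces g t) = weightedSum F t := by
  rw [weightedSum_apply, weightedSum_apply]
  refine Fintype.sum_equiv (MulAction.toPerm g⁻¹) _ _ fun w => ?_
  rw [permPlaces_apply, MulAction.toPerm_apply, mult_smul]

theorem rePart_galMixed_eq (g : F ≃ₐ[K] F) (x : mixedSpace F) :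
    rePart (galMixed K g x) = permPlaces g (rePart x) :=
  funext fun w => rePart_galMixed K g x w

/-- The Galois action on the real vectors of weighted sum `0`. -/
noncomputable def permZero (g : F ≃ₐ[K] F) : sumZero F →ₗ[ℝ] sumZero F :=
  (permPlaces g).restrict fun t ht => by
    rw [LinearMap.mem_ker] at ht ⊢
    rw [weightedSum_permPlaces, ht]

/-- The Galois action on the hyperplane in the mixed space. -/
noncomputable def galNull (g : F ≃ₐ[K] F) : nullSpace F →ₗ[ℝ] nullSpace F :=
  (galMixed K g).toLinearMap.restrict fun v hv => by
    rw [LinearMap.mem_ker] at hv ⊢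
    change weightedSum F (rePart (galMixed K g v)) = 0
    rw [rePart_galMixed_eq, weightedSum_permPlaces]
    exact hv

theorem realPart_galNull (g : F ≃ₐ[K] F) (v : nullSpace F) :
    realPart F (galNull g v) = permZero g (realPart F v) :=
  Subtype.ext (rePart_galMixed_eq g v.1)

theorem expPair_galNull {g : F ≃ₐ[K] F} {v : nullSpace F} {y : picDom F}
    (h1 : ((((y.1.1 : FractionalIdeal (𝓞 F)⁰ F) : Submodule (𝓞 F) F) : Set F)) =
      g '' ((((expPair v).1.1 : FractionalIdeal (𝓞 F)⁰ F) : Submodule (𝓞 F) F) : Set F))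
    (h2 : (y.1.2 : FReal F) = galFReal K g ((expPair v).1.2 : FReal F)) :
    y = expPair (galNull g v) := by
  refine Subtype.ext (Prod.ext (Units.ext (FractionalIdeal.coeToSubmodule_injective
    (SetLike.coe_injective ?_))) (units_ext ?_))
  · dsimp only
    rw [h1]
    change g '' (((1 : FractionalIdeal (𝓞 F)⁰ F) : Submodule (𝓞 F) F) : Set F) =
      (((1 : FractionalIdeal (𝓞 F)⁰ F) : Submodule (𝓞 F) F) : Set F)
    have hmem (h : F ≃ₐ[K] F) (x : F)
        (hx : x ∈ ((1 : FractionalIdeal (𝓞 F)⁰ F) : Submodule (𝓞 F) F)) :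
        h x ∈ ((1 : FractionalIdeal (𝓞 F)⁰ F) : Submodule (𝓞 F) F) := by
      rw [FractionalIdeal.mem_coe, FractionalIdeal.mem_one_iff] at hx ⊢
      obtain ⟨z, rfl⟩ := hx
      exact ⟨⟨h z, z.2.map (h.restrictScalars ℤ)⟩, rfl⟩
    ext x
    constructor
    · rintro ⟨z, hz, rfl⟩
      exact hmem g z hz
    · intro hx
      exact ⟨g⁻¹ x, hmem g⁻¹ x hx, g.apply_symm_apply x⟩
  · rw [h2, toMixed_galFReal]
    change galMixed K g (toMixed F (expUnit v.1)) = toMixed F (expUnit (galNull g v).1)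
    rw [toMixed_expUnit, toMixed_expUnit, map_mexp]
    rfl

theorem weightedSum_surjective : Function.Surjective (weightedSum F) := by
  refine LinearMap.surjective fun h => ?_
  obtain ⟨w⟩ : Nonempty (InfinitePlace F) := inferInstance
  have h1 := LinearMap.congr_fun h 1
  rw [weightedSum_apply, LinearMap.zero_apply,
    Finset.sum_eq_zero_iff_of_nonneg fun _ _ => by simp] at h1
  have := h1 w (Finset.mem_univ _)
  simp [mult_ne_zero] at this

theorem trace_permPlaces (g : F ≃ₐ[K] F) :
    LinearMap.trace ℝ _ (permPlaces g) = LinearMap.trace ℝ _ (permZero g) + 1 := by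
  rw [trace_exact (sumZero F).subtype (weightedSum F) (sumZero F).injective_subtype
    weightedSum_surjective (LinearMap.exact_subtype_ker_map _) (permZero g) (permPlaces g)
    LinearMap.id (fun _ => rfl) (weightedSum_permPlaces g), LinearMap.trace_id,
    Module.finrank_self, Nat.cast_one]

theorem trace_galMixed (g : F ≃ₐ[K] F) :
    LinearMap.trace ℝ _ (galMixed K g).toLinearMap = LinearMap.trace ℝ _ (galNull g) + 1 := by
  rw [trace_exact (nullSpace F).subtype ((weightedSum F).comp rePart)
    (nullSpace F).injective_subtype (weightedSum_surjective.comp fun t =>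
      ⟨_, rePart_mixedSpaceOfRealSpace t⟩)
    (LinearMap.exact_subtype_ker_map _) (galNull g) (galMixed K g).toLinearMap
    LinearMap.id (fun _ => rfl) (fun x => ?_), LinearMap.trace_id,
    Module.finrank_self, Nat.cast_one]
  change weightedSum F (rePart (galMixed K g x)) = _
  rw [rePart_galMixed_eq, weightedSum_permPlaces]
  rfl

theorem trace_galMixed_eq (g : F ≃ₐ[K] F) : LinearMap.trace ℝ _ (galMixed K g).toLinearMap =
    (LinearMap.trace ℚ F (g.restrictScalars ℚ).toLinearMap : ℚ) := by
  have h : (galMixed K g).toLinearMap =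
      (toMixed F).toLinearEquiv.conj ((g.restrictScalars ℚ).toLinearMap.baseChange ℝ) := rfl
  rw [h, LinearMap.trace_conj', LinearMap.trace_baseChange]
  rfl

open Classical in
theorem trace_gal (K F : Type) [Field K] [NumberField K] [Field F] [NumberField F] [Algebra K F]
    [IsGalois K F] (g : F ≃ₐ[K] F) : LinearMap.trace ℚ F (g.restrictScalars ℚ).toLinearMap =
      if g = 1 then (Module.finrank ℚ K * Nat.card (F ≃ₐ[K] F) : ℚ) else 0 := by
  have : FiniteDimensional K F := Module.Finite.of_restrictScalars_finite ℚ K F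
  split_ifs with h
  · rw [h]
    have : ((1 : F ≃ₐ[K] F).restrictScalars ℚ).toLinearMap = LinearMap.id := rfl
    rw [this, LinearMap.trace_id, IsGalois.card_aut_eq_finrank, ← Nat.cast_mul,
      Module.finrank_mul_finrank]
  · let b := (Module.finBasis ℚ K).smulTower (IsGalois.normalBasis K F)
    rw [LinearMap.trace_eq_matrix_trace ℚ b, Matrix.trace]
    refine Finset.sum_eq_zero fun i _ => ?_
    rw [Matrix.diag_apply, LinearMap.toMatrix_apply]
    have h1 : (g.restrictScalars ℚ).toLinearMap (b i) = b (i.1, g * i.2) := by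
      rw [Module.Basis.smulTower_apply, Module.Basis.smulTower_apply]
      refine (g.toLinearMap.map_smul _ _).trans (congrArg _ ?_)
      dsimp only
      rw [IsGalois.normalBasis_apply, IsGalois.normalBasis_apply (g * i.2)]
      rfl
    rw [h1, Module.Basis.repr_self, Finsupp.single_eq_of_ne]
    intro h2
    exact h (mul_eq_right.1 (congrArg Prod.snd h2).symm)

theorem trace_permPlaces_eq (g : F ≃ₐ[K] F) : LinearMap.trace ℝ _ (permPlaces g) =
    Nat.card {w : InfinitePlace F // g • w = w} := by
  classical
  rw [LinearMap.trace_eq_matrix_trace ℝ (Pi.basisFun ℝ _), Matrix.trace,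
    Nat.card_eq_fintype_card, Fintype.card_subtype, Finset.card_filter, Nat.cast_sum]
  refine Finset.sum_congr rfl fun w _ => ?_
  rw [Matrix.diag_apply, LinearMap.toMatrix_apply, Pi.basisFun_repr, Pi.basisFun_apply,
    permPlaces_apply, Pi.single_apply]
  rw [Nat.cast_ite, Nat.cast_one, Nat.cast_zero]
  congr 1
  exact propext ⟨fun h => inv_smul_eq_iff.2 h.symm, fun h => (inv_smul_eq_iff.1 h).symm⟩

end PlaceAction

section ModuleClasses

variable {G : Type} [Group G]

/-- The integral representation underlying a `ℤ[G]`-module. -/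
noncomputable def toRep (G : Type) [Group G] (M : Type) [AddCommGroup M]
    [Module (MonoidAlgebra ℤ G) M] : Representation ℤ G M where
  toFun g := (DistribSMul.toAddMonoidHom M
    (MonoidAlgebra.single g (1 : ℤ) : MonoidAlgebra ℤ G)).toIntLinearMap
  map_one' := LinearMap.ext fun x => one_smul (MonoidAlgebra ℤ G) x
  map_mul' g h := LinearMap.ext fun x => by
    change (MonoidAlgebra.single (g * h) (1 : ℤ) : MonoidAlgebra ℤ G) • x =
      (MonoidAlgebra.single g (1 : ℤ) : MonoidAlgebra ℤ G) •
        (MonoidAlgebra.single h (1 : ℤ) : MonoidAlgebra ℤ G) • x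
    rw [smul_smul, MonoidAlgebra.single_mul_single, one_mul]

theorem toRep_apply {M : Type} [AddCommGroup M] [Module (MonoidAlgebra ℤ G) M] (g : G) (x : M) :
    toRep G M g x = (MonoidAlgebra.single g (1 : ℤ) : MonoidAlgebra ℤ G) • x := rfl

theorem cls_eq (M : Type) [AddCommGroup M] [Module (MonoidAlgebra ℤ G) M] :
    G0.cls (MonoidAlgebra ℤ G) M = cl (toRep G M) :=
  cls_eq_cl _ fun _ _ => rfl

/-- The group ring as a space of functions. -/
noncomputable def groupRingEquiv (G : Type) [Group G] [Finite G] :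
    MonoidAlgebra ℤ G ≃ₗ[ℤ] (G → ℤ) :=
  (MonoidAlgebra.coeffLinearEquiv ℤ).trans (Finsupp.linearEquivFunOnFinite ℤ ℤ G)

instance moduleFinite_groupRing [Finite G] : Module.Finite ℤ (MonoidAlgebra ℤ G) :=
  Module.Finite.equiv (groupRingEquiv G).symm

open Classical in
theorem ch_regular [Finite G] (g : G) :
    ch (toRep G (MonoidAlgebra ℤ G)) g = if g = 1 then (Nat.card G : ℚ) else 0 := by
  rw [ch_congr (toRep G (MonoidAlgebra ℤ G))
    (funRep (MulAction.toPermHom G G) (1 : Representation ℤ G ℤ)) (groupRingEquiv G) fun g x => ?_,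
    ch_permutation, fixCount]
  · simp only [MulAction.toPermHom_apply, MulAction.toPerm_apply, smul_eq_mul, mul_eq_right]
    split_ifs with h
    · simp [h]
    · simp [h]
  · ext h
    change (MonoidAlgebra.single g (1 : ℤ) * x).coeff h = x.coeff (g⁻¹ * h)
    rw [MonoidAlgebra.coeff_single_mul_apply, one_mul]

theorem ch_trivial [Module (MonoidAlgebra ℤ G) ℤ]
    (h : ∀ (g : G) (n : ℤ), (MonoidAlgebra.single g (1 : ℤ) : MonoidAlgebra ℤ G) • n = n) (g : G) :
    ch (toRep G ℤ) g = 1 := by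
  have h1 : toRep G ℤ g = LinearMap.id := LinearMap.ext fun n => h g n
  rw [ch_eq_trace, h1, LinearMap.trace_id, Module.finrank_self]
  norm_num

theorem ch_finsupp {X : Type} [Finite X] (a : G →* Equiv.Perm X) [Module (MonoidAlgebra ℤ G) (X →₀ ℤ)]
    (h : ∀ (g : G) (x : X →₀ ℤ),
      (MonoidAlgebra.single g (1 : ℤ) : MonoidAlgebra ℤ G) • x = Finsupp.mapDomain (a g) x) (g : G) :
    ch (toRep G (X →₀ ℤ)) g = Nat.card {x // a g x = x} := by
  rw [ch_congr (toRep G (X →₀ ℤ)) (funRep a (1 : Representation ℤ G ℤ))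
    (Finsupp.linearEquivFunOnFinite ℤ ℤ X) fun g x => ?_, ch_permutation, fixCount]
  ext y
  rw [toRep_apply, h]
  change Finsupp.mapDomain (a g) x y = x (a g⁻¹ y)
  rw [map_inv, Equiv.Perm.inv_def, ← Finsupp.equivMapDomain_eq_mapDomain,
    Finsupp.equivMapDomain_apply]

theorem exists_nsmul_eq_zero_iff {A : Type*} [AddCommGroup A] (x : A) :
    (∃ n : ℕ, 0 < n ∧ n • x = 0) ↔ (QuotientAddGroup.mk x : A ⧸ AddCommGroup.torsion A) = 0 := by
  rw [QuotientAddGroup.eq_zero_iff]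
  exact isOfFinAddOrder_iff_nsmul_eq_zero.symm

end ModuleClasses

section Duals

variable {K F : Type} [Field K] [NumberField K] [Field F] [NumberField F] [Algebra K F]
  {G : Type} [Group G] (iso : G ≃* (F ≃ₐ[K] F))

open scoped Classical in
theorem ch_arTilde (ρT : G → PicTilde F → PicTilde F)
    (hρT : ∀ (g : G) (v : nullSpace F),
      ρT g (PicTilde.mk F (expPair v)) = PicTilde.mk F (expPair (galNull (iso g) v)))
    [Module (MonoidAlgebra ℤ G) (ArTilde F)]
    (hm : ∀ (g : G) (φ : ArTilde F) (z : PicTilde F),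
      ((MonoidAlgebra.single g (1 : ℤ) : MonoidAlgebra ℤ G) • φ) (Additive.ofMul z) =
        φ (Additive.ofMul (ρT g⁻¹ z))) :
    Module.Finite ℤ (ArTilde F) ∧ ∀ g, ((ch (toRep G (ArTilde F)) g : ℚ) : ℝ) =
      LinearMap.trace ℝ _ (galNull (iso g⁻¹)) := by
  let ev : ArTilde F ≃+ ContinuousAddMonoidHom (Additive (PicTilde F)) (AddCircle (1 : ℝ)) :=
    AddEquiv.refl _
  refine ⟨(finite_and_finrank_le (expTilde F) (mixedUnits F) ev continuous_expTilde
    expTilde_eq_zero_iff).1, fun g => ?_⟩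
  refine ch_dual ev (expTilde F) (mixedUnits F) continuous_expTilde expTilde_eq_zero_iff
    nhds_zero_le_map_expTilde (toRep G (ArTilde F)) g (galNull (iso g⁻¹)) fun φ v => ?_
  refine (hm g φ (PicTilde.mk F (expPair v))).trans ?_
  rw [hρT]
  rfl

open scoped Classical in
theorem ch_arF (ρ0 : G → PicZero F → PicZero F)
    (hρ0 : ∀ (g : G) (v : nullSpace F),
      ρ0 g (PicZero.mk F (expPair v)) = PicZero.mk F (expPair (galNull (iso g) v)))
    [Module (MonoidAlgebra ℤ G) (ArF F)]
    (hm : ∀ (g : G) (φ : ArF F) (z : PicZero F),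
      ((MonoidAlgebra.single g (1 : ℤ) : MonoidAlgebra ℤ G) • φ) (Additive.ofMul z) =
        φ (Additive.ofMul (ρ0 g⁻¹ z))) :
    Module.Finite ℤ (ArF F) ∧ ∀ g, ((ch (toRep G (ArF F)) g : ℚ) : ℝ) =
      LinearMap.trace ℝ _ (permZero (iso g⁻¹)) := by
  let ev : ArF F ≃+ ContinuousAddMonoidHom (Additive (PicZero F)) (AddCircle (1 : ℝ)) :=
    AddEquiv.refl _
  refine ⟨(finite_and_finrank_le (expZero F) (realUnits F) ev continuous_expZero
    expZero_eq_zero_iff).1, fun g => ?_⟩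
  refine ch_dual ev (expZero F) (realUnits F) continuous_expZero expZero_eq_zero_iff
    nhds_zero_le_map_expZero (toRep G (ArF F)) g (permZero (iso g⁻¹)) fun φ t => ?_
  refine (hm g φ (PicZero.mk F (expPair (realIncl F t)))).trans ?_
  rw [hρ0]
  change φ (picProj F (expTilde F _)) = φ (expZero F _)
  rw [picProj_expTilde, realPart_galNull, realPart_realIncl]

theorem finite_torsion_units (F : Type) [Field F] [NumberField F] :
    Finite (CommGroup.torsion Fˣ) := by
  have h := Embeddings.finite_of_norm_le F ℂ 1
  have := h.to_subtype
  refine Finite.of_injective (β := {x : F | IsIntegral ℤ x ∧ ∀ φ : F →+* ℂ, ‖φ x‖ ≤ 1})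
    (fun u => ⟨((u : Fˣ) : F), ?_⟩) fun u v huv =>
      Subtype.ext (Units.ext (congrArg Subtype.val huv))
  obtain ⟨n, hn, hu⟩ := isOfFinOrder_iff_pow_eq_one.1 u.2
  have hu' : ((u : Fˣ) : F) ^ n = 1 := by rw [← Units.val_pow_eq_pow_val, hu, Units.val_one]
  refine ⟨.of_pow hn (hu' ▸ isIntegral_one), fun φ => (Complex.norm_eq_one_of_pow_eq_one ?_ hn.ne').le⟩
  rw [← map_pow, hu', map_one]

end Duals

section Comparison

variable {K F : Type} [Field K] [NumberField K] [Field F] [NumberField F] [Algebra K F]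
  {G : Type} [Group G] [Finite G] (iso : G ≃* (F ≃ₐ[K] F))

theorem mk_regular_eq_zero [IsGalois K F] [Module (MonoidAlgebra ℤ G) (ArTilde F)]
    [Module (MonoidAlgebra ℤ G) ℤ] [Module.Finite ℤ (ArTilde F)]
    (hZ : ∀ (g : G) (n : ℤ), (MonoidAlgebra.single g (1 : ℤ) : MonoidAlgebra ℤ G) • n = n)
    (hch : ∀ g, ((ch (toRep G (ArTilde F)) g : ℚ) : ℝ) =
      LinearMap.trace ℝ _ (galNull (iso g⁻¹))) :
    (QuotientAddGroup.mk ((Module.finrank ℚ K) • G0.cls (MonoidAlgebra ℤ G) (MonoidAlgebra ℤ G) -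
        G0.cls (MonoidAlgebra ℤ G) ℤ - G0.cls (MonoidAlgebra ℤ G) (ArTilde F)) :
      G0 (MonoidAlgebra ℤ G) ⧸ AddCommGroup.torsion (G0 (MonoidAlgebra ℤ G))) = 0 := by
  classical
  obtain ⟨N, _, _, ρ, hcl, hρ⟩ :=
    exists_nsmul (toRep G (MonoidAlgebra ℤ G)) (Module.finrank ℚ K)
  have h : ch ρ = ch ((toRep G ℤ).prod (toRep G (ArTilde F))) := by
    funext g
    rw [hρ, ch_prod, Pi.smul_apply, Pi.add_apply, ch_regular, ch_trivial hZ]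
    refine Rat.cast_injective (α := ℝ) ?_
    rw [Rat.cast_add, hch, Rat.cast_one, add_comm, ← trace_galMixed, trace_galMixed_eq, trace_gal]
    refine congrArg _ ?_
    have hc : Nat.card G = Nat.card (F ≃ₐ[K] F) := Nat.card_congr iso.toEquiv
    have h1 : iso g⁻¹ = 1 ↔ g = 1 := by rw [map_inv, inv_eq_one, map_eq_one_iff iso iso.injective]
    by_cases hg : g = 1
    · rw [if_pos hg, if_pos (h1.2 hg), nsmul_eq_mul, hc]
    · rw [if_neg hg, if_neg (mt h1.1 hg), nsmul_zero]
  have h2 := tcl_eq_of_ch _ _ h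
  rw [tcl, tcl, cl_prod, hcl] at h2
  rw [cls_eq, cls_eq, cls_eq, sub_sub, QuotientAddGroup.mk_sub, sub_eq_zero]
  exact h2

theorem mk_places_eq_zero [Module (MonoidAlgebra ℤ G) (ArF F)]
    [Module.Finite ℤ (ArF F)] [mS : Module (MonoidAlgebra ℤ G) (InfinitePlace F →₀ ℤ)]
    [Module (MonoidAlgebra ℤ G) (Additive (CommGroup.torsion Fˣ))]
    (hS : ∀ (g : G) (x : InfinitePlace F →₀ ℤ),
      (MonoidAlgebra.single g (1 : ℤ) : MonoidAlgebra ℤ G) • x =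
        Finsupp.mapDomain (fun w => iso g • w) x)
    [Module (MonoidAlgebra ℤ G) ℤ]
    (hZ : ∀ (g : G) (n : ℤ), (MonoidAlgebra.single g (1 : ℤ) : MonoidAlgebra ℤ G) • n = n)
    (σ : G0 (MonoidAlgebra ℤ G) →+ G0 (MonoidAlgebra ℤ G))
    (hch : ∀ g, ((ch (toRep G (ArF F)) g : ℚ) : ℝ) =
      LinearMap.trace ℝ _ (permZero (iso g⁻¹))) :
    (QuotientAddGroup.mk (G0.cls (MonoidAlgebra ℤ G) (InfinitePlace F →₀ ℤ) -
        G0.cls (MonoidAlgebra ℤ G) ℤ -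
        σ (G0.cls (MonoidAlgebra ℤ G) (Additive (CommGroup.torsion Fˣ))) -
        G0.cls (MonoidAlgebra ℤ G) (ArF F)) :
      G0 (MonoidAlgebra ℤ G) ⧸ AddCommGroup.torsion (G0 (MonoidAlgebra ℤ G))) = 0 := by
  have h : ch (toRep G (InfinitePlace F →₀ ℤ)) =
      ch ((toRep G ℤ).prod (toRep G (ArF F))) := by
    funext g
    rw [ch_finsupp ((MulAction.toPermHom (F ≃ₐ[K] F) (InfinitePlace F)).comp iso.toMonoidHom) hS,
      ch_prod, Pi.add_apply, ch_trivial hZ]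
    refine Rat.cast_injective (α := ℝ) ?_
    rw [Rat.cast_add, hch, Rat.cast_one, add_comm, ← trace_permPlaces, trace_permPlaces_eq,
      Rat.cast_natCast]
    refine congrArg _ (Nat.card_congr (Equiv.subtypeEquivRight fun w => ?_))
    change iso g • w = w ↔ _
    rw [map_inv, inv_smul_eq_iff, eq_comm]
  have h2 := tcl_eq_of_ch _ _ h
  rw [tcl, tcl, cl_prod] at h2
  have := finite_torsion_units F
  have hμ : (QuotientAddGroup.mk (σ (G0.cls (MonoidAlgebra ℤ G)
      (Additive (CommGroup.torsion Fˣ)))) :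
      G0 (MonoidAlgebra ℤ G) ⧸ AddCommGroup.torsion (G0 (MonoidAlgebra ℤ G))) = 0 := by
    rw [← exists_nsmul_eq_zero_iff]
    obtain ⟨n, hn, hx⟩ := (exists_nsmul_eq_zero_iff _).2
      (tcl_of_finite _ (toRep G (Additive (CommGroup.torsion Fˣ))) rfl)
    exact ⟨n, hn, by rw [cls_eq, ← map_nsmul, hx, map_zero]⟩
  rw [sub_right_comm, QuotientAddGroup.mk_sub, hμ, sub_zero, cls_eq, cls_eq, cls_eq, sub_sub,
    QuotientAddGroup.mk_sub, sub_eq_zero]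
  exact h2

end Comparison

end ArakelovG0

/-!
STATEMENT 12: Let F/K be a finite Galois extension of number fields with Galois group G,
let d be the degree of K over ℚ, let S∞ be the set of archimedean places of F, and let
μ_F be the group of roots of unity of F.  Then both elements
d·[ℤ[G]] − [ℤ] − [Ãr_F] and [ℤ[S∞]] − [ℤ] − σ[μ_F] − [Ar_F] lie in the torsion subgroup
of G₀(ℤ[G]) (i.e. are of finite additive order).
-/
theorem stmt12
    (K F : Type) [Field K] [NumberField K] [Field F] [NumberField F] [Algebra K F]
    [IsGalois K F] (G : Type) [Group G] (iso : G ≃* (F ≃ₐ[K] F))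
    -- the Galois action of G on the oriented Arakelov class group, characterized on classes
    -- of oriented Arakelov divisors (I, b) via the action on the underlying ideals and on F_ℝ
    (ρT : G → PicTilde F → PicTilde F)
    (hρT : ∀ (g : G) (x : picDom F), ∃ y : picDom F,
      ((((((y : IdealGroup F × (FReal F)ˣ).1 : FractionalIdeal (𝓞 F)⁰ F) :
          Submodule (𝓞 F) F) : Set F)) =
        (iso g) '' (((((x : IdealGroup F × (FReal F)ˣ).1 : FractionalIdeal (𝓞 F)⁰ F) :
          Submodule (𝓞 F) F) : Set F))) ∧
      (((y : IdealGroup F × (FReal F)ˣ).2 : FReal F) =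
        galFReal K (iso g) ((x : IdealGroup F × (FReal F)ˣ).2 : FReal F)) ∧
      ρT g (PicTilde.mk F x) = PicTilde.mk F y)
    -- the ℤ[G]-module structure on the Pontryagin dual (G acting via g ↦ g⁻¹)
    [mAT : Module (MonoidAlgebra ℤ G) (ArTilde F)]
    (hmAT : ∀ (g : G) (φ : ArTilde F) (z : PicTilde F),
      ((MonoidAlgebra.single g (1 : ℤ) : MonoidAlgebra ℤ G) • φ) (Additive.ofMul z) =
        φ (Additive.ofMul (ρT g⁻¹ z)))
    -- the Galois action of G on the Arakelov class group, characterized on classes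
    -- of oriented Arakelov divisors (I, b) via the action on the underlying ideals and on F_ℝ
    (ρ0 : G → PicZero F → PicZero F)
    (hρ0 : ∀ (g : G) (x : picDom F), ∃ y : picDom F,
      ((((((y : IdealGroup F × (FReal F)ˣ).1 : FractionalIdeal (𝓞 F)⁰ F) :
          Submodule (𝓞 F) F) : Set F)) =
        (iso g) '' (((((x : IdealGroup F × (FReal F)ˣ).1 : FractionalIdeal (𝓞 F)⁰ F) :
          Submodule (𝓞 F) F) : Set F))) ∧
      (((y : IdealGroup F × (FReal F)ˣ).2 : FReal F) =
        galFReal K (iso g) ((x : IdealGroup F × (FReal F)ˣ).2 : FReal F)) ∧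
      ρ0 g (PicZero.mk F x) = PicZero.mk F y)
    -- the ℤ[G]-module structure on the Pontryagin dual (G acting via g ↦ g⁻¹)
    [mAr : Module (MonoidAlgebra ℤ G) (ArF F)]
    (hmAr : ∀ (g : G) (φ : ArF F) (z : PicZero F),
      ((MonoidAlgebra.single g (1 : ℤ) : MonoidAlgebra ℤ G) • φ) (Additive.ofMul z) =
        φ (Additive.ofMul (ρ0 g⁻¹ z)))
    -- the permutation ℤ[G]-module ℤ[S∞] on the set of archimedean places of F
    [mS : Module (MonoidAlgebra ℤ G) (NumberField.InfinitePlace F →₀ ℤ)]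
    (hmS : ∀ (g : G) (x : NumberField.InfinitePlace F →₀ ℤ),
      (MonoidAlgebra.single g (1 : ℤ) : MonoidAlgebra ℤ G) • x =
        Finsupp.mapDomain (fun w => iso g • w) x)
    -- the ℤ[G]-module μ_F of roots of unity of F
    [mMu : Module (MonoidAlgebra ℤ G) (Additive (CommGroup.torsion Fˣ))]
    (hmMu : ∀ (g : G) (u v : CommGroup.torsion Fˣ), ((v : Fˣ) : F) = iso g ((u : Fˣ) : F) →
      (MonoidAlgebra.single g (1 : ℤ) : MonoidAlgebra ℤ G) • Additive.ofMul u =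
        Additive.ofMul v)
    -- the trivial ℤ[G]-module ℤ
    [mZ : Module (MonoidAlgebra ℤ G) ℤ]
    (hmZ : ∀ (g : G) (n : ℤ),
      (MonoidAlgebra.single g (1 : ℤ) : MonoidAlgebra ℤ G) • n = n)
    -- σ : the duality endomorphism of G₀(ℤ[G]) induced by M ↦ Hom_ℤ(M,ℤ) on lattices
    -- (with G acting via the involution g ↦ g⁻¹); on a finite module N it satisfies
    -- σ[N] = −[Hom_ℤ(N, ℚ/ℤ)]
    (σ : G0 (MonoidAlgebra ℤ G) →+ G0 (MonoidAlgebra ℤ G))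
    (hσlat : ∀ (M : Type) [AddCommGroup M] [Module (MonoidAlgebra ℤ G) M]
        [Module.Finite (MonoidAlgebra ℤ G) M] [Module.Projective ℤ M]
        [Module (MonoidAlgebra ℤ G) (M →ₗ[ℤ] ℤ)],
      (∀ (g : G) (φ : M →ₗ[ℤ] ℤ) (x : M),
        ((MonoidAlgebra.single g (1 : ℤ) : MonoidAlgebra ℤ G) • φ) x =
          φ ((MonoidAlgebra.single g⁻¹ (1 : ℤ) : MonoidAlgebra ℤ G) • x)) →
      σ (G0.cls (MonoidAlgebra ℤ G) M) = G0.cls (MonoidAlgebra ℤ G) (M →ₗ[ℤ] ℤ))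
    (hσtor : ∀ (N : Type) [AddCommGroup N] [Module (MonoidAlgebra ℤ G) N]
        [Module (MonoidAlgebra ℤ G) (N →ₗ[ℤ] QmodZ)], Finite N →
      (∀ (g : G) (φ : N →ₗ[ℤ] QmodZ) (x : N),
        ((MonoidAlgebra.single g (1 : ℤ) : MonoidAlgebra ℤ G) • φ) x =
          φ ((MonoidAlgebra.single g⁻¹ (1 : ℤ) : MonoidAlgebra ℤ G) • x)) →
      σ (G0.cls (MonoidAlgebra ℤ G) N) = - G0.cls (MonoidAlgebra ℤ G) (N →ₗ[ℤ] QmodZ))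
 :
    (∃ n : ℕ, 0 < n ∧ n • ((Module.finrank ℚ K) • G0.cls (MonoidAlgebra ℤ G) (MonoidAlgebra ℤ G) -
        G0.cls (MonoidAlgebra ℤ G) ℤ - G0.cls (MonoidAlgebra ℤ G) (ArTilde F)) = 0) ∧
    (∃ n : ℕ, 0 < n ∧ n • (G0.cls (MonoidAlgebra ℤ G) (NumberField.InfinitePlace F →₀ ℤ) -
        G0.cls (MonoidAlgebra ℤ G) ℤ -
        σ (G0.cls (MonoidAlgebra ℤ G) (Additive (CommGroup.torsion Fˣ))) -
        G0.cls (MonoidAlgebra ℤ G) (ArF F)) = 0) := by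
  have : FiniteDimensional K F := Module.Finite.of_restrictScalars_finite ℚ K F
  have : Finite G := Finite.of_equiv _ iso.symm.toEquiv
  have hT (g : G) (v : ArakelovG0.nullSpace F) :
      ρT g (PicTilde.mk F (ArakelovG0.expPair v)) =
        PicTilde.mk F (ArakelovG0.expPair (ArakelovG0.galNull (iso g) v)) := by
    obtain ⟨y, h1, h2, h3⟩ := hρT g (ArakelovG0.expPair v)
    rw [h3, ArakelovG0.expPair_galNull h1 h2]
  have h0 (g : G) (v : ArakelovG0.nullSpace F) :
      ρ0 g (PicZero.mk F (ArakelovG0.expPair v)) =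
        PicZero.mk F (ArakelovG0.expPair (ArakelovG0.galNull (iso g) v)) := by
    obtain ⟨y, h1, h2, h3⟩ := hρ0 g (ArakelovG0.expPair v)
    rw [h3, ArakelovG0.expPair_galNull h1 h2]
  obtain ⟨hfT, hchT⟩ := ArakelovG0.ch_arTilde iso ρT hT hmAT
  obtain ⟨hfA, hchA⟩ := ArakelovG0.ch_arF iso ρ0 h0 hmAr
  rw [ArakelovG0.exists_nsmul_eq_zero_iff, ArakelovG0.exists_nsmul_eq_zero_iff]
  constructor
  · exact ArakelovG0.mk_regular_eq_zero iso hmZ hchT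
  · exact ArakelovG0.mk_places_eq_zero iso hmS hmZ σ hchA
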